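/- arXiv:nlin/0302026 — 2 statements merged into one kernel-verified Lean document; each statement's English description precedes it below -/
import Mathlib

section
/- With the family (φ_μ) and the Hankel determinants τ_n^{μ} as in the context, for every integer n ≥ 0, on every open interval on which none of the τ-functions appearing in the denominators vanishes, the pair q = −τ_n^{ν}τ_{n+1}^{ν−1}/(τ_n^{ν−1}τ_{n+1}^{ν}) and p = (ν+1)·τ_n^{ν−1}τ_{n+1}^{ν+1}/(τ_{n+1}^{ν}τ_n^{ν}) gives a solution of the Hamiltonian system S_IV with parameters κ₀ = −ν+n and θ∞ = −ν−1. -/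
namespace Matrix

section CommRing

variable {R : Type*} [CommRing R]

/-- Replacing each row of `M` in turn by the corresponding row of `M * T` multiplies the
determinant by the trace of `T`. -/
theorem sum_det_updateRow_mul {n : Type*} [Fintype n] [DecidableEq n] (M T : Matrix n n R) :
    ∑ i, (M.updateRow i ((M * T) i)).det = T.trace * M.det := by
  have h (i : n) : (M.updateRow i ((M * T) i)).det = (M * T * M.adjugate) i i := by
    rw [← cramer_transpose_apply, cramer_eq_adjugate_mulVec, ← adjugate_transpose, mul_apply]
    simp [mulVec, dotProduct, mul_comm]
  simp_rw [h]
  change (M * T * M.adjugate).trace = _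
  rw [Matrix.mul_assoc, trace_mul_comm, Matrix.mul_assoc, adjugate_mul]
  simp [mul_comm]

theorem det_snoc_eq_neg_one_pow_mul {n : ℕ} (w : Fin n → Fin (n + 1) → R) (x : Fin (n + 1) → R) :
    (of (Fin.snoc w x : Fin (n + 1) → Fin (n + 1) → R)).det =
      (-1) ^ n * (of (Fin.cons x w : Fin (n + 1) → Fin (n + 1) → R)).det := by
  have h := det_permute (finRotate (n + 1)) (of (Fin.cons x w : Fin (n + 1) → Fin (n + 1) → R))
  rw [sign_finRotate] at h
  rw [Fin.snoc_eq_cons_rotate]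
  refine Eq.trans (congrArg det ?_) (h.trans ?_)
  · rfl
  · simp

theorem det_cons_cons_swap {n : ℕ} (w : Fin n → Fin (n + 2) → R) (x y : Fin (n + 2) → R) :
    (of (Fin.cons y (Fin.cons x w : Fin (n + 1) → Fin (n + 2) → R) :
        Fin (n + 2) → Fin (n + 2) → R)).det =
      -(of (Fin.cons x (Fin.cons y w : Fin (n + 1) → Fin (n + 2) → R) :
        Fin (n + 2) → Fin (n + 2) → R)).det := by
  have h := det_permute (Equiv.swap (0 : Fin (n + 2)) 1)
    (of (Fin.cons x (Fin.cons y w : Fin (n + 1) → Fin (n + 2) → R) :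
        Fin (n + 2) → Fin (n + 2) → R))
  rw [Equiv.Perm.sign_swap (by simp)] at h
  rw [← neg_one_mul]
  convert h using 2
  · ext i k
    refine Fin.cases ?_ (fun i => Fin.cases ?_ (fun i => ?_) i) i
    · simp
    · simp
    · simp only [of_apply, submatrix_apply, Fin.cons_succ]
      rw [Equiv.swap_apply_of_ne_of_ne]
      · simp
      · exact Fin.succ_ne_zero _
      · exact fun h => Fin.succ_ne_zero i (Fin.succ_injective _ h)
  · simp

/-- The three-term Grassmann–Plücker relation. -/
theorem det_cons_cons_plucker {n : ℕ} (w : Fin n → Fin (n + 2) → R) (a b c d : Fin (n + 2) → R)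
    (D : (Fin (n + 2) → R) → (Fin (n + 2) → R) → R)
    (hD : ∀ x y, D x y = (of (Fin.cons x (Fin.cons y w : Fin (n + 1) → Fin (n + 2) → R) :
        Fin (n + 2) → Fin (n + 2) → R)).det) :
    D a b * D c d - D a c * D b d + D a d * D b c = 0 := by
  have hswap (x y) : D y x = - D x y := by rw [hD, hD, det_cons_cons_swap]
  set M : Matrix (Fin (n + 2)) (Fin (n + 2)) R :=
    of (Fin.cons c (Fin.cons d w : Fin (n + 1) → Fin (n + 2) → R) :
        Fin (n + 2) → Fin (n + 2) → R)
  have hcr := mulVec_cramer Mᵀ b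
  let L : (Fin (n + 2) → R) →ₗ[R] R :=
    (detRowAlternating (n := Fin (n + 2)) (R := R)).toMultilinearMap.toLinearMap
      (Fin.cons a (Fin.cons 0 w : Fin (n + 1) → Fin (n + 2) → R) :
        Fin (n + 2) → Fin (n + 2) → R) (Fin.succ 0)
  have hL (x) : L x = D a x := by
    rw [hD]
    simp only [L, MultilinearMap.toLinearMap_apply]
    change det _ = _
    rw [← Fin.cons_update, Fin.update_cons_zero]
    rfl
  have h1 := congrArg L hcr
  have h2 : Mᵀ *ᵥ cramer Mᵀ b = ∑ i, cramer Mᵀ b i • M i := by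
    ext k
    simp [mulVec, dotProduct, mul_comm]
  rw [h2, map_sum, map_smul, det_transpose, hL, Fin.sum_univ_succ, Fin.sum_univ_succ] at h1
  simp_rw [map_smul, hL, cramer_transpose_apply] at h1
  rw [Finset.sum_eq_zero (fun i _ => ?_)] at h1
  · have e0 : M 0 = c := rfl
    have e1 : M (Fin.succ 0) = d := rfl
    have e2 : (M.updateRow 0 b).det = D b d := by
      rw [hD]; congr 1; ext i k
      refine Fin.cases ?_ (fun i => ?_) i
      · simp
      · rw [updateRow_ne (Fin.succ_ne_zero _)]; rfl
    have e3 : (M.updateRow (Fin.succ 0) b).det = D c b := by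
      rw [hD]; congr 1; ext i k
      refine Fin.cases ?_ (fun i => Fin.cases ?_ (fun i => ?_) i) i
      · rw [updateRow_ne (Fin.succ_ne_zero _).symm]; rfl
      · simp
      · rw [updateRow_ne (fun h => Fin.succ_ne_zero i (Fin.succ_injective _ h))]; rfl
    have e4 : M.det = D c d := (hD c d).symm
    rw [e0, e1, e2, e3, e4, hswap b c] at h1
    simp only [smul_eq_mul] at h1
    linear_combination -h1
  · have : D a (M i.succ.succ) = 0 := by
      rw [hD]
      refine det_zero_of_row_eq (i := Fin.succ 0) (j := i.succ.succ) ?_ ?_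
      · exact fun h => Fin.succ_ne_zero i (Fin.succ_injective _ h).symm
      · rfl
    rw [this, smul_zero]

theorem det_cons_snoc {n : ℕ} (w : Fin n → Fin (n + 2) → R) (x y : Fin (n + 2) → R) :
    (of (Fin.snoc (Fin.cons x w : Fin (n + 1) → Fin (n + 2) → R) y :
        Fin (n + 2) → Fin (n + 2) → R)).det =
      (-1) ^ n * (of (Fin.cons x (Fin.cons y w : Fin (n + 1) → Fin (n + 2) → R) :
        Fin (n + 2) → Fin (n + 2) → R)).det := by
  rw [det_snoc_eq_neg_one_pow_mul, det_cons_cons_swap]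
  ring

theorem det_snoc_snoc {n : ℕ} (w : Fin n → Fin (n + 2) → R) (x y : Fin (n + 2) → R) :
    (of (Fin.snoc (Fin.snoc w x : Fin (n + 1) → Fin (n + 2) → R) y :
        Fin (n + 2) → Fin (n + 2) → R)).det =
      (of (Fin.cons x (Fin.cons y w : Fin (n + 1) → Fin (n + 2) → R) :
        Fin (n + 2) → Fin (n + 2) → R)).det := by
  rw [det_snoc_eq_neg_one_pow_mul, Fin.cons_snoc_eq_snoc_cons, det_snoc_eq_neg_one_pow_mul,
    ← mul_assoc, ← mul_pow]
  simp

theorem det_snoc_plucker {n : ℕ} (w : Fin n → Fin (n + 2) → R) (x y z e : Fin (n + 2) → R)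
    (S : (Fin (n + 1) → Fin (n + 2) → R) → (Fin (n + 2) → R) → R)
    (hS : ∀ r v, S r v = (of (Fin.snoc r v : Fin (n + 2) → Fin (n + 2) → R)).det) :
    S (Fin.cons x w) y * S (Fin.snoc w z) e - S (Fin.cons x w) z * S (Fin.snoc w y) e
      + S (Fin.cons x w) e * S (Fin.snoc w y) z = 0 := by
  have h := det_cons_cons_plucker w x y z e _ fun _ _ => rfl
  simp only [hS, det_cons_snoc, det_snoc_snoc]
  linear_combination (-1) ^ n * h

theorem det_snoc_single_last {n : ℕ} (r : Fin n → Fin (n + 1) → R) :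
    (of (Fin.snoc r (Pi.single (Fin.last n) 1) : Fin (n + 1) → Fin (n + 1) → R)).det =
      (of fun i k : Fin n => r i k.castSucc).det := by
  rw [det_succ_row _ (Fin.last n), Finset.sum_eq_single (Fin.last n)]
  · simp only [Fin.val_last, of_apply, Fin.snoc_last, Pi.single_eq_same, mul_one,
      Fin.succAbove_last]
    rw [← two_mul, pow_mul, neg_one_sq, one_pow, one_mul]
    congr 1
    ext i k
    simp
  · intro k _ hk
    simp [hk]
  · simp

theorem det_snoc_single_zero {n : ℕ} (r : Fin n → Fin (n + 1) → R) :
    (of (Fin.snoc r (Pi.single 0 1) : Fin (n + 1) → Fin (n + 1) → R)).det =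
      (-1) ^ n * (of fun i k : Fin n => r i k.succ).det := by
  rw [det_succ_row _ (Fin.last n), Finset.sum_eq_single 0]
  · simp only [Fin.val_last, of_apply, Fin.snoc_last, Pi.single_eq_same, mul_one,
      Fin.succAbove_last, Fin.val_zero, add_zero, Fin.succAbove_zero]
    congr 2
    ext i k
    simp
  · intro k _ hk
    simp [hk]
  · simp

end CommRing

theorem hasDerivAt_det {n : Type*} [Fintype n] [DecidableEq n] {M : ℝ → Matrix n n ℂ}
    {M' : Matrix n n ℂ} {t : ℝ} (h : ∀ i j, HasDerivAt (fun s => M s i j) (M' i j) t) :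
    HasDerivAt (fun s => (M s).det) (∑ i, ((M t).updateRow i (M' i)).det) t := by
  have e : ∑ i, ((M t).updateRow i (M' i)).det = ∑ σ : Equiv.Perm n,
      (Equiv.Perm.sign σ : ℂ) * ∑ i, (∏ j ∈ Finset.univ.erase i, M t j (σ j)) • M' i (σ i) := by
    simp_rw [← det_transpose (updateRow _ _ _), det_apply', Finset.mul_sum]
    rw [Finset.sum_comm]
    refine Finset.sum_congr rfl fun σ _ => Finset.sum_congr rfl fun i _ => ?_
    rw [← Finset.mul_prod_erase _ _ (Finset.mem_univ i), transpose_apply, updateRow_self,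
      smul_eq_mul, mul_comm (M' i (σ i))]
    congr 2
    refine Finset.prod_congr rfl fun j hj => ?_
    rw [transpose_apply, updateRow_ne (Finset.ne_of_mem_erase hj)]
  rw [e]
  simp_rw [← det_transpose (M _), det_apply', transpose_apply]
  refine HasDerivAt.fun_sum fun σ _ => HasDerivAt.const_mul _ ?_
  exact HasDerivAt.fun_finsetProd fun i _ => h i (σ i)

end Matrix

/-- The determinant with rows `(f (g i), f (g i - 1), f (g i - 2), …)`. -/
def shiftDet (f : ℤ → ℂ) {N : ℕ} (g : Fin N → ℤ) : ℂ :=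
  (Matrix.of fun i k : Fin N => f (g i - k)).det

/-- `shiftDet` for the indices `a, a - 1, …, a - m + 1, z`. -/
def stepDet (f : ℤ → ℂ) (a : ℤ) (m : ℕ) (z : ℤ) : ℂ :=
  shiftDet f (Fin.snoc (fun i : Fin m => a - i) z : Fin (m + 1) → ℤ)

/-- `shiftDet` for the indices `a + 1, a - 1, a - 2, …, a - m`. -/
def raisedDet (f : ℤ → ℂ) (a : ℤ) (m : ℕ) : ℂ :=
  shiftDet f (Fin.cons (a + 1) (fun i : Fin m => a - 1 - i) : Fin (m + 1) → ℤ)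

theorem shiftDet_eq_zero (f : ℤ → ℂ) {N : ℕ} {g : Fin N → ℤ} {i j : Fin N} (hij : i ≠ j)
    (h : g i = g j) : shiftDet f g = 0 :=
  Matrix.det_zero_of_row_eq hij (by ext k; simp [h])

theorem shiftDet_update_eq_zero (f : ℤ → ℂ) {N : ℕ} {g : Fin N → ℤ} {i j : Fin N} {z : ℤ}
    (hij : j ≠ i) (h : g j = z) : shiftDet f (Function.update g i z) = 0 :=
  shiftDet_eq_zero f hij.symm (by simp [Function.update_of_ne hij, h])

theorem shiftDet_update (f : ℤ → ℂ) {N : ℕ} (g : Fin N → ℤ) (i : Fin N) (z : ℤ) :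
    shiftDet f (Function.update g i z) =
      ((Matrix.of fun i k : Fin N => f (g i - k)).updateRow i fun k => f (z - k)).det := by
  unfold shiftDet
  congr 1
  ext j k
  obtain rfl | h := eq_or_ne j i
  · simp
  · simp [h]

theorem snoc_sub_eq (a : ℤ) (m : ℕ) :
    (Fin.snoc (fun i : Fin m => a - i) (a - m) : Fin (m + 1) → ℤ) =
      fun i : Fin (m + 1) => a - ((i : ℕ) : ℤ) := by
  ext i
  refine Fin.lastCases ?_ (fun i => ?_) i <;> simp

theorem stepDet_eq_shiftDet (f : ℤ → ℂ) (a : ℤ) (m : ℕ) :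
    stepDet f a m (a - m) = shiftDet f (fun i : Fin (m + 1) => a - ((i : ℕ) : ℤ)) := by
  rw [stepDet, snoc_sub_eq]

theorem update_snoc_sub_last (a : ℤ) (m : ℕ) (y z : ℤ) :
    Function.update (Fin.snoc (fun i : Fin m => a - i) y : Fin (m + 1) → ℤ) (Fin.last m) z =
      Fin.snoc (fun i : Fin m => a - i) z :=
  Fin.update_snoc_last ..

theorem shiftDet_update_castSucc (f : ℤ → ℂ) (a : ℤ) {m : ℕ} (i : Fin m) :
    shiftDet f (Function.update (Fin.snoc (fun i : Fin m => a - i) (a - m) : Fin (m + 1) → ℤ)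
      i.castSucc (a - (i : ℕ) - 1)) = 0 := by
  rw [snoc_sub_eq]
  refine shiftDet_update_eq_zero f (j := i.succ) i.castSucc_lt_succ.ne' ?_
  simp
  ring

theorem shiftDet_update_castSucc_add (f : ℤ → ℂ) (a : ℤ) {m : ℕ} (i : Fin m) :
    shiftDet f (Function.update (Fin.snoc (fun i : Fin m => a - i) (a - m - 1) : Fin (m + 1) → ℤ)
      i.castSucc (a - (i : ℕ) - 1)) +
    shiftDet f (Function.update (Fin.snoc (fun i : Fin m => a - i) (a - m) : Fin (m + 1) → ℤ)
      i.castSucc (a - (i : ℕ) - 2)) = 0 := by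
  rcases lt_or_ge ((i : ℕ) + 1) m with hi | hi
  · rw [shiftDet_update_eq_zero f (j := Fin.castSucc ⟨i + 1, hi⟩),
      snoc_sub_eq, shiftDet_update_eq_zero f (j := Fin.succ ⟨i + 1, hi⟩), add_zero]
    · simp [Fin.ext_iff]
      omega
    · simp
      ring
    · simp [Fin.ext_iff]
    · rw [Fin.snoc_castSucc]
      push_cast
      ring
  · have him : (m : ℤ) = i + 1 := by have := i.2; omega
    have hne : i.castSucc ≠ Fin.last m := (Fin.castSucc_lt_last i).ne
    have hp := Matrix.det_permute (Equiv.swap i.castSucc (Fin.last m)) (Matrix.of fun j k => f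
      (Function.update (Fin.snoc (fun i : Fin m => a - i) (a - m) : Fin (m + 1) → ℤ)
        i.castSucc (a - (i : ℕ) - 2) j - (k : ℕ)))
    rw [Equiv.Perm.sign_swap hne] at hp
    refine eq_neg_iff_add_eq_zero.mp (Eq.trans ?_ (hp.trans ?_))
    · unfold shiftDet
      congr 1
      ext j k
      simp only [Matrix.submatrix_apply, Matrix.of_apply, id]
      congr 2
      refine Fin.lastCases ?_ (fun l => ?_) j
      · simp [Function.update_of_ne hne.symm, him]
        ring
      · obtain rfl | hl := eq_or_ne l i
        · simp [Function.update_of_ne hne.symm, him]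
          ring
        · have hl' : l.castSucc ≠ i.castSucc := fun h => hl (Fin.castSucc_injective _ h)
          rw [Equiv.swap_apply_of_ne_of_ne hl' (Fin.castSucc_lt_last l).ne,
            Function.update_of_ne hl', Function.update_of_ne hl']
          simp
    · simp [shiftDet]

theorem sum_shiftDet_update_sub_one (f : ℤ → ℂ) (a : ℤ) (m : ℕ) :
    ∑ i : Fin (m + 1), shiftDet f (Function.update (fun i : Fin (m + 1) => a - ((i : ℕ) : ℤ)) i
      (a - ((i : ℕ) : ℤ) - 1)) = stepDet f a m (a - m - 1) := by
  rw [← snoc_sub_eq, Fin.sum_univ_castSucc, Finset.sum_eq_zero, zero_add, Fin.val_last,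
    update_snoc_sub_last, stepDet]
  intro i _
  rw [Fin.val_castSucc, shiftDet_update_castSucc]

theorem hasDerivAt_shiftDet {F : ℤ → ℝ → ℂ} {t : ℝ}
    (hF : ∀ j, HasDerivAt (F j) (F (j - 1) t) t) {N : ℕ} (g : Fin N → ℤ) :
    HasDerivAt (fun s => shiftDet (fun j => F j s) g)
      (∑ i, shiftDet (fun j => F j t) (Function.update g i (g i - 1))) t := by
  simp_rw [shiftDet_update]
  refine Matrix.hasDerivAt_det (M' := Matrix.of fun i k => F (g i - 1 - (k : ℕ)) t) fun i k => ?_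
  convert! hF (g i - k) using 2
  simp only [Matrix.of_apply]
  congr 1
  ring

theorem hasDerivAt_stepDet {F : ℤ → ℝ → ℂ} {t : ℝ}
    (hF : ∀ j, HasDerivAt (F j) (F (j - 1) t) t) (a : ℤ) (m : ℕ) :
    HasDerivAt (fun s => stepDet (fun j => F j s) a m (a - m))
      (stepDet (fun j => F j t) a m (a - m - 1)) t := by
  simp_rw [stepDet_eq_shiftDet]
  rw [← sum_shiftDet_update_sub_one]
  exact hasDerivAt_shiftDet hF _

theorem sum_shiftDet_update_sub_two {f : ℤ → ℂ} {ν t : ℂ}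
    (hf : ∀ j : ℤ, f (j - 2) = t * f (j - 1) - (ν + j) * f j) {N : ℕ} (g : Fin N → ℤ) :
    ∑ i, shiftDet f (Function.update g i (g i - 2)) =
      t * ∑ i, shiftDet f (Function.update g i (g i - 1))
        - (∑ i, (ν + g i)) * shiftDet f g + (∑ i : Fin N, (i : ℂ)) * shiftDet f g := by
  set M := Matrix.of fun i k : Fin N => f (g i - k) with hM
  have hT := Matrix.sum_det_updateRow_mul M (Matrix.diagonal fun k : Fin N => (k : ℂ))
  have h (i : Fin N) : shiftDet f (Function.update g i (g i - 2)) =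
      t * shiftDet f (Function.update g i (g i - 1)) - (ν + g i) * shiftDet f g +
        (M.updateRow i ((M * Matrix.diagonal fun k : Fin N => (k : ℂ)) i)).det := by
    have hrow : (fun k : Fin N => f (g i - 2 - k)) =
        t • (fun k : Fin N => f (g i - 1 - k)) + -(ν + g i) • M i +
          (M * Matrix.diagonal fun k : Fin N => (k : ℂ)) i := by
      ext k
      have := hf (g i - k)
      rw [show g i - k - 2 = g i - 2 - k by ring, show g i - k - 1 = g i - 1 - k by ring] at this
      simp [this, hM]
      ring
    rw [shiftDet_update, shiftDet_update, hrow, Matrix.det_updateRow_add, Matrix.det_updateRow_add,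
      Matrix.det_updateRow_smul, Matrix.det_updateRow_smul, Matrix.updateRow_eq_self, shiftDet]
    ring
  rw [Finset.sum_congr rfl fun i _ => h i, Finset.sum_add_distrib, hT, Matrix.trace_diagonal,
    Finset.sum_sub_distrib, ← Finset.mul_sum, ← Finset.sum_mul]
  rfl

theorem sum_shiftDet_update_add_one {f : ℤ → ℂ} {ν t : ℂ}
    (hf : ∀ j : ℤ, f (j - 2) = t * f (j - 1) - (ν + j) * f j) {N : ℕ} (g : Fin N → ℤ) :
    ∑ i, (ν + 1 + g i) * shiftDet f (Function.update g i (g i + 1)) =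
      N * t * shiftDet f g - ∑ i, shiftDet f (Function.update g i (g i - 1)) := by
  set M := Matrix.of fun i k : Fin N => f (g i - k) with hM
  set T : Matrix (Fin N) (Fin N) ℂ :=
    Matrix.of fun l k => if (l : ℕ) + 1 = k then (k : ℂ) else 0 with hTdef
  have hT := Matrix.sum_det_updateRow_mul M T
  have htr : T.trace = 0 := by simp [Matrix.trace, hTdef]
  have hMT (i k : Fin N) : (M * T) i k = k * f (g i + 1 - k) := by
    rw [Matrix.mul_apply]
    obtain ⟨k, hk⟩ := k
    cases k with
    | zero => simp [hTdef]
    | succ k =>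
      rw [Finset.sum_eq_single ⟨k, by omega⟩]
      · simp only [hM, hTdef, Matrix.of_apply, if_true]
        rw [mul_comm]
        congr 2
        push_cast
        ring
      · intro l _ hl
        have : (l : ℕ) ≠ k := fun h => hl (Fin.ext h)
        simp [hTdef, this]
      · simp
  have h (i : Fin N) : (ν + 1 + g i) * shiftDet f (Function.update g i (g i + 1)) =
      t * shiftDet f g - shiftDet f (Function.update g i (g i - 1)) +
        (M.updateRow i ((M * T) i)).det := by
    have hrow : (ν + 1 + g i) • (fun k : Fin N => f (g i + 1 - k)) =
        t • M i + (-1 : ℂ) • (fun k : Fin N => f (g i - 1 - k)) + (M * T) i := by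
      ext k
      have := hf (g i + 1 - k)
      rw [show g i + 1 - k - 2 = g i - 1 - k by ring, show g i + 1 - k - 1 = g i - k by ring]
        at this
      push_cast at this
      simp only [Pi.add_apply, Pi.smul_apply, smul_eq_mul, hMT, this]
      simp only [hM, Matrix.of_apply]
      ring
    rw [shiftDet_update, shiftDet_update, ← Matrix.det_updateRow_smul, hrow,
      Matrix.det_updateRow_add, Matrix.det_updateRow_add,
      Matrix.det_updateRow_smul, Matrix.det_updateRow_smul, Matrix.updateRow_eq_self, shiftDet]
    ring
  rw [Finset.sum_congr rfl fun i _ => h i, Finset.sum_add_distrib, hT, htr,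
    Finset.sum_sub_distrib]
  simp
  ring

theorem raisedDet_eq {f : ℤ → ℂ} {ν t : ℂ}
    (hf : ∀ j : ℤ, f (j - 2) = t * f (j - 1) - (ν + j) * f j) (a : ℤ) (m : ℕ) :
    (ν + 1 + a) * raisedDet f a m =
      (m + 1) * t * stepDet f a m (a - m) - stepDet f a m (a - m - 1) := by
  have h := sum_shiftDet_update_add_one hf (fun i : Fin (m + 1) => a - ((i : ℕ) : ℤ))
  rw [sum_shiftDet_update_sub_one, ← stepDet_eq_shiftDet, Fin.sum_univ_succ,
    Finset.sum_eq_zero, add_zero] at h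
  · have e : Function.update (fun i : Fin (m + 1) => a - ((i : ℕ) : ℤ)) 0
        (a - (((0 : Fin (m + 1)) : ℕ) : ℤ) + 1) = Fin.cons (a + 1) fun i : Fin m => a - 1 - i := by
      ext i
      refine Fin.cases ?_ (fun i => ?_) i
      · simp
      · simp
        ring
    rw [e] at h
    simpa [raisedDet] using h
  · intro i _
    rw [shiftDet_update_eq_zero f (j := i.castSucc) i.castSucc_lt_succ.ne, mul_zero]
    simp only [Fin.val_castSucc, Fin.val_succ]
    push_cast
    ring

theorem hasDerivAt_stepDet_sub_one {F : ℤ → ℝ → ℂ} {ν : ℂ} {t : ℝ}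
    (hF : ∀ j, HasDerivAt (F j) (F (j - 1) t) t)
    (hf : ∀ j : ℤ, F (j - 2) t = t * F (j - 1) t - (ν + j) * F j t) (a : ℤ) (m : ℕ) :
    HasDerivAt (fun s => stepDet (fun j => F j s) a m (a - m - 1))
      (2 * stepDet (fun j => F j t) a m (a - m - 2)
        - t * stepDet (fun j => F j t) a m (a - m - 1)
        + (m + 1) * (ν + a - m) * stepDet (fun j => F j t) a m (a - m)) t := by
  have hs : ∑ i : Fin (m + 1), (ν + ((a - ((i : ℕ) : ℤ) : ℤ) : ℂ)) -
      ∑ i : Fin (m + 1), ((i : ℕ) : ℂ) = (m + 1) * (ν + a - m) := by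
    rw [← Finset.sum_sub_distrib]
    clear hf
    induction m with
    | zero => simp
    | succ m ih =>
      rw [Fin.sum_univ_castSucc]
      simp only [Fin.val_castSucc, Fin.val_last, ih]
      push_cast
      ring
  convert! hasDerivAt_shiftDet hF _ using 1
  have h := sum_shiftDet_update_sub_two (f := fun j => F j t) hf
    (fun i : Fin (m + 1) => a - ((i : ℕ) : ℤ))
  rw [sum_shiftDet_update_sub_one, ← stepDet_eq_shiftDet, ← snoc_sub_eq, Fin.sum_univ_castSucc]
    at h
  have hadd := Finset.sum_congr (rfl : (Finset.univ : Finset (Fin m)) = _) fun i _ =>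
    shiftDet_update_castSucc_add (fun j => F j t) a i
  rw [Finset.sum_add_distrib, Finset.sum_const_zero] at hadd
  rw [Fin.sum_univ_castSucc]
  simp only [Fin.snoc_castSucc, Fin.snoc_last, update_snoc_sub_last] at h ⊢
  simp only [Fin.val_castSucc, Fin.val_last] at h
  rw [show a - (m : ℤ) - 1 - 1 = a - m - 2 by ring]
  change _ + stepDet (fun j => F j t) a m (a - m - 2) = _ at h
  change _ = _ + stepDet (fun j => F j t) a m (a - m - 2)
  linear_combination h - hadd - stepDet (fun j => F j t) a m (a - m) * hs

theorem cons_row (f : ℤ → ℂ) {N M : ℕ} (s : Fin N → ℤ) (z : ℤ) :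
    (Fin.cons (fun k : Fin M => f (z - k)) (fun (i : Fin N) (k : Fin M) => f (s i - k)) :
      Fin (N + 1) → Fin M → ℂ) =
      fun (i : Fin (N + 1)) (k : Fin M) => f ((Fin.cons z s : Fin (N + 1) → ℤ) i - k) := by
  ext i k
  refine Fin.cases ?_ (fun i => ?_) i <;> simp

theorem snoc_row (f : ℤ → ℂ) {N M : ℕ} (s : Fin N → ℤ) (z : ℤ) :
    (Fin.snoc (fun (i : Fin N) (k : Fin M) => f (s i - k)) (fun k : Fin M => f (z - k)) :
      Fin (N + 1) → Fin M → ℂ) =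
      fun (i : Fin (N + 1)) (k : Fin M) => f ((Fin.snoc s z : Fin (N + 1) → ℤ) i - k) := by
  ext i k
  refine Fin.lastCases ?_ (fun i => ?_) i <;> simp

theorem det_snoc_row (f : ℤ → ℂ) {N : ℕ} (s : Fin N → ℤ) (z : ℤ) :
    (Matrix.of (Fin.snoc (fun (i : Fin N) (k : Fin (N + 1)) => f (s i - k))
      (fun k : Fin (N + 1) => f (z - k)) : Fin (N + 1) → Fin (N + 1) → ℂ)).det =
      shiftDet f (Fin.snoc s z : Fin (N + 1) → ℤ) := by
  rw [snoc_row]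
  rfl

theorem cons_sub_eq (a : ℤ) (m : ℕ) :
    (Fin.cons a (fun i : Fin m => a - 1 - i) : Fin (m + 1) → ℤ) =
      fun i : Fin (m + 1) => a - ((i : ℕ) : ℤ) := by
  ext i
  refine Fin.cases ?_ (fun i => ?_) i
  · simp
  · simp
    ring

/-- The Plücker relation for rows of shifted values together with the last unit vector. -/
theorem shiftDet_plucker_last (f : ℤ → ℂ) {m : ℕ} (s : Fin m → ℤ) (x y z : ℤ) :
    shiftDet f (Fin.snoc (Fin.cons x s : Fin (m + 1) → ℤ) y : Fin (m + 2) → ℤ) *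
        shiftDet f (Fin.snoc s z : Fin (m + 1) → ℤ)
      - shiftDet f (Fin.snoc (Fin.cons x s : Fin (m + 1) → ℤ) z : Fin (m + 2) → ℤ) *
        shiftDet f (Fin.snoc s y : Fin (m + 1) → ℤ)
      + shiftDet f (Fin.cons x s : Fin (m + 1) → ℤ) *
        shiftDet f (Fin.snoc (Fin.snoc s y : Fin (m + 1) → ℤ) z : Fin (m + 2) → ℤ) = 0 := by
  have h := Matrix.det_snoc_plucker (fun (i : Fin m) (k : Fin (m + 2)) => f (s i - k))
    (fun k => f (x - k)) (fun k => f (y - k)) (fun k => f (z - k)) (Pi.single (Fin.last _) 1)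
    _ fun _ _ => rfl
  simp only [cons_row, snoc_row, Matrix.det_snoc_single_last] at h
  exact h

/-- The Plücker relation for rows of shifted values together with the first unit vector. -/
theorem shiftDet_plucker_zero (f : ℤ → ℂ) {m : ℕ} (s : Fin m → ℤ) (x y z : ℤ) :
    shiftDet f (Fin.snoc (Fin.cons x s : Fin (m + 1) → ℤ) y : Fin (m + 2) → ℤ) *
        shiftDet (fun j => f (j - 1)) (Fin.snoc s z : Fin (m + 1) → ℤ)
      - shiftDet f (Fin.snoc (Fin.cons x s : Fin (m + 1) → ℤ) z : Fin (m + 2) → ℤ) *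
        shiftDet (fun j => f (j - 1)) (Fin.snoc s y : Fin (m + 1) → ℤ)
      + shiftDet (fun j => f (j - 1)) (Fin.cons x s : Fin (m + 1) → ℤ) *
        shiftDet f (Fin.snoc (Fin.snoc s y : Fin (m + 1) → ℤ) z : Fin (m + 2) → ℤ) = 0 := by
  have h := Matrix.det_snoc_plucker (fun (i : Fin m) (k : Fin (m + 2)) => f (s i - k))
    (fun k => f (x - k)) (fun k => f (y - k)) (fun k => f (z - k)) (Pi.single 0 1)
    _ fun _ _ => rfl
  have e (g : Fin (m + 1) → ℤ) : (Matrix.of fun i k : Fin (m + 1) => f (g i - (k.succ : ℕ))).det =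
      shiftDet (fun j => f (j - 1)) g := by
    unfold shiftDet
    congr 1
    ext i k
    simp only [Matrix.of_apply, Fin.val_succ]
    congr 1
    push_cast
    ring
  simp only [cons_row, snoc_row, Matrix.det_snoc_single_zero, e] at h
  refine (mul_eq_zero.mp (Eq.trans ?_ h)).resolve_left
    (pow_ne_zero (m + 1) (neg_ne_zero.mpr (one_ne_zero (α := ℂ))))
  unfold shiftDet
  ring

theorem shiftDet_comp_sub_one (f : ℤ → ℂ) {N : ℕ} (g : Fin N → ℤ) :
    shiftDet (fun j => f (j - 1)) g = shiftDet f fun i => g i - 1 := by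
  unfold shiftDet
  congr 1
  ext i k
  simp only [Matrix.of_apply]
  congr 1
  ring

theorem shiftDet_snoc (f : ℤ → ℂ) {n : ℕ} (s : Fin n → ℤ) (x : ℤ) :
    shiftDet f (Fin.snoc s x : Fin (n + 1) → ℤ) =
      (-1) ^ n * shiftDet f (Fin.cons x s : Fin (n + 1) → ℤ) := by
  rw [← det_snoc_row, Matrix.det_snoc_eq_neg_one_pow_mul, cons_row]
  rfl

theorem shiftDet_cons_snoc (f : ℤ → ℂ) {n : ℕ} (s : Fin n → ℤ) (x y : ℤ) :
    shiftDet f (Fin.snoc (Fin.cons x s : Fin (n + 1) → ℤ) y : Fin (n + 2) → ℤ) =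
      (-1) ^ n * shiftDet f (Fin.cons x (Fin.cons y s : Fin (n + 1) → ℤ) : Fin (n + 2) → ℤ) := by
  rw [← det_snoc_row, ← cons_row, Matrix.det_cons_snoc, cons_row, cons_row]
  rfl

theorem shiftDet_snoc_snoc (f : ℤ → ℂ) {n : ℕ} (s : Fin n → ℤ) (x y : ℤ) :
    shiftDet f (Fin.snoc (Fin.snoc s x : Fin (n + 1) → ℤ) y : Fin (n + 2) → ℤ) =
      (-1) ^ n * shiftDet f (Fin.snoc (Fin.cons x s : Fin (n + 1) → ℤ) y : Fin (n + 2) → ℤ) := by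
  rw [shiftDet_cons_snoc, ← mul_assoc, ← mul_pow, ← det_snoc_row, ← snoc_row,
    Matrix.det_snoc_snoc, cons_row, cons_row]
  simp
  rfl

theorem stepDet_plucker_last (f : ℤ → ℂ) (a : ℤ) (m : ℕ) (z : ℤ) :
    stepDet f a (m + 1) (a - m - 1) * stepDet f (a - 1) m z
      - stepDet f a (m + 1) z * stepDet f (a - 1) m (a - m - 1)
      + stepDet f a m (a - m) * stepDet f (a - 1) (m + 1) z = 0 := by
  have h := shiftDet_plucker_last f (fun i : Fin m => a - 1 - i) a (a - m - 1) z
  rw [cons_sub_eq, ← stepDet_eq_shiftDet] at h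
  rw [show a - (m : ℤ) - 1 = a - 1 - m by ring] at h ⊢
  rw [snoc_sub_eq (a - 1) m] at h
  unfold stepDet at h ⊢
  rw [snoc_sub_eq (a - 1) m]
  exact h

theorem stepDet_plucker_zero (f : ℤ → ℂ) (a : ℤ) (m : ℕ) :
    stepDet f (a + 1) (m + 1) (a - m) * stepDet f (a - 1) m (a - m - 2)
      - stepDet f (a + 1) (m + 1) (a - m - 1) * stepDet f (a - 1) m (a - m - 1)
      + stepDet f a m (a - m) * stepDet f a (m + 1) (a - m - 1) = 0 := by
  have h := shiftDet_plucker_zero f (fun i : Fin m => a - i) (a + 1) (a - m) (a - m - 1)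
  have e (z : ℤ) : shiftDet (fun j => f (j - 1)) (Fin.snoc (fun i : Fin m => a - i) z :
      Fin (m + 1) → ℤ) = stepDet f (a - 1) m (z - 1) := by
    rw [shiftDet_comp_sub_one, stepDet]
    congr 1
    ext i
    refine Fin.lastCases ?_ (fun i => ?_) i
    · simp
    · simp
      ring
  have hc := cons_sub_eq (a + 1) m
  rw [add_sub_cancel_right] at hc
  have e' : shiftDet (fun j => f (j - 1)) (fun i : Fin (m + 1) => a + 1 - ((i : ℕ) : ℤ)) =
      stepDet f a m (a - m) := by
    rw [shiftDet_comp_sub_one, stepDet_eq_shiftDet]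
    congr 1
    ext i
    ring
  rw [e, e, hc, e', snoc_sub_eq, show a - (m : ℤ) - 1 - 1 = a - m - 2 by ring] at h
  exact h

theorem stepDet_plucker_raised (f : ℤ → ℂ) (a : ℤ) (m : ℕ) :
    stepDet f (a + 1) (m + 1) (a - m) * stepDet f (a - 1) m (a - m - 1)
      - raisedDet f a (m + 1) * stepDet f a m (a - m)
      + raisedDet f a m * stepDet f a (m + 1) (a - m - 1) = 0 := by
  have h := shiftDet_plucker_last f (fun i : Fin m => a - 1 - i) (a + 1) a (a - m - 1)
  have hs : (Fin.snoc (fun i : Fin m => a - 1 - i) (a - m - 1) : Fin (m + 1) → ℤ) =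
      fun i : Fin (m + 1) => a - 1 - ((i : ℕ) : ℤ) := by
    rw [← snoc_sub_eq (a - 1) m]
    congr 1
    ring
  have hc := cons_sub_eq (a + 1) (m + 1)
  have hr : shiftDet f (Fin.snoc (Fin.cons (a + 1) (fun i : Fin m => a - 1 - i) :
      Fin (m + 1) → ℤ) (a - m - 1) : Fin (m + 2) → ℤ) = raisedDet f a (m + 1) := by
    rw [← Fin.cons_snoc_eq_snoc_cons, hs, raisedDet]
  have hC : stepDet f (a + 1) (m + 1) (a - m) = shiftDet f (Fin.cons (a + 1)
      fun i : Fin (m + 1) => a - ((i : ℕ) : ℤ) : Fin (m + 2) → ℤ) := by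
    rw [add_sub_cancel_right] at hc
    rw [hc, ← stepDet_eq_shiftDet]
    congr 1
    push_cast
    ring
  have hB : stepDet f (a - 1) m (a - m - 1) =
      shiftDet f fun i : Fin (m + 1) => a - 1 - ((i : ℕ) : ℤ) := by
    rw [← stepDet_eq_shiftDet]
    congr 1
    ring
  rw [hr, shiftDet_snoc_snoc, shiftDet_cons_snoc, shiftDet_snoc f _ a, cons_sub_eq, hs, ← hC, ← hB,
    ← stepDet_eq_shiftDet] at h
  refine (mul_eq_zero.mp (Eq.trans ?_ h)).resolve_left
    (pow_ne_zero m (neg_ne_zero.mpr (one_ne_zero (α := ℂ))))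
  unfold raisedDet stepDet
  ring

/-- The Hankel determinants of a sequence with `F_j' = F_{j-1}` and
`F_{j-2} = t F_{j-1} - (ν + j) F_j` satisfy a closed system of bilinear relations. -/
theorem exists_hasDerivAt_and_bilinear {F : ℤ → ℝ → ℂ} {ν : ℂ}
    (hF : ∀ j t, HasDerivAt (F j) (F (j - 1) t) t)
    (hf : ∀ (j : ℤ) (t : ℝ), F (j - 2) t = t * F (j - 1) t - (ν + j) * F j t)
    (S : ℤ → ℕ → ℝ → ℂ)
    (hS : ∀ a N t, S a N t = shiftDet (fun j => F j t) fun i : Fin N => a - ((i : ℕ) : ℤ))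
    (n : ℕ) (t : ℝ) :
    ∃ A B X Y C : ℂ, HasDerivAt (S 0 n) A t ∧ HasDerivAt (S (-1) n) B t ∧
      HasDerivAt (S 0 (n + 1)) X t ∧ HasDerivAt (S (-1) (n + 1)) Y t ∧
      HasDerivAt (S 1 (n + 1)) C t ∧
      S 0 (n + 1) t * B - X * S (-1) n t + S 0 n t * S (-1) (n + 1) t = 0 ∧
      (ν + 1) * S 1 (n + 1) t * S (-1) n t =
        t * S 0 (n + 1) t * S 0 n t - X * S 0 n t + A * S 0 (n + 1) t ∧
      S 0 n t * Y - A * S (-1) (n + 1) t =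
        t * S 0 n t * S (-1) (n + 1) t - (ν - n) * S (-1) n t * S 0 (n + 1) t ∧
      S (-1) n t * C - B * S 1 (n + 1) t = S 0 (n + 1) t * S 0 n t := by
  cases n with
  | zero =>
    have h0 (a) : S a 0 = fun _ => 1 := by ext s; simp [hS, shiftDet]
    have h1 (a) : S a (0 + 1) = F a := by ext s; simp [hS, shiftDet]
    have e1 := hf 0 t
    have e2 := hf 1 t
    norm_num at e1 e2
    refine ⟨0, 0, F (-1) t, F (-2) t, F 0 t, ?_⟩
    simp only [h0, h1]
    refine ⟨hasDerivAt_const _ _, hasDerivAt_const _ _, hF 0 t, hF (-1) t, hF 1 t, ?_, ?_, ?_, ?_⟩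
    · ring
    · linear_combination e2
    · push_cast
      linear_combination e1
    · ring
  | succ m =>
    have hS1 (a) (k : ℕ) (z : ℤ) (hz : z = a - k) :
        S a (k + 1) = fun s => stepDet (fun j => F j s) a k z := by
      ext s
      rw [hS, hz, stepDet_eq_shiftDet]
    have hd (a) (k : ℕ) (z : ℤ) (hz : z = a - k) (s : ℝ) :
        HasDerivAt (S a (k + 1)) (stepDet (fun j => F j s) a k (z - 1)) s := by
      rw [hS1 a k z hz, hz]
      exact hasDerivAt_stepDet (fun j => hF j s) a k
    have hdd (a) (k : ℕ) (z : ℤ) (hz : z = a - k) := by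
      have := hasDerivAt_stepDet_sub_one (fun j => hF j t) (fun j => hf j t) a k
      rw [← hz] at this
      exact this
    have hB := hd (-1) m (-m - 1) (by ring)
    have hX := hd 0 (m + 1) (-m - 1) (by push_cast; ring)
    have hA := hd 0 m (-m) (by ring)
    have hY := hd (-1) (m + 1) (-m - 2) (by push_cast; ring)
    have hC := hd 1 (m + 1) (-m) (by push_cast; ring)
    have hB2 := hdd (-1) m (-m - 1) (by ring)
    have hX2 := hdd 0 (m + 1) (-m - 1) (by push_cast; ring)
    have eB := hS1 (-1) m (-m - 1) (by ring)
    have eX := hS1 0 (m + 1) (-m - 1) (by push_cast; ring)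
    have eA := hS1 0 m (-m) (by ring)
    have eY := hS1 (-1) (m + 1) (-m - 2) (by push_cast; ring)
    have eC := hS1 1 (m + 1) (-m) (by push_cast; ring)
    have p1 (s : ℝ) := stepDet_plucker_last (fun j => F j s) 0 m (-m - 2)
    have p2 := stepDet_plucker_last (fun j => F j t) 0 m (-m - 3)
    have p3 := stepDet_plucker_zero (fun j => F j t) 0 m
    have p4 := stepDet_plucker_raised (fun j => F j t) 0 m
    have r1 := raisedDet_eq (f := fun j => F j t) (fun j => hf j t) 0 m
    have r2 := raisedDet_eq (f := fun j => F j t) (fun j => hf j t) 0 (m + 1)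
    rw [show (0 : ℤ) - ((m + 1 : ℕ) : ℤ) = -m - 1 by push_cast; ring] at r2
    simp only [zero_sub, zero_add, Int.cast_zero, add_zero, Int.cast_neg, Int.cast_one,
      Nat.cast_add, Nat.cast_one] at *
    simp only [show -(m : ℤ) - 1 - 1 = -m - 2 by ring, show -(m : ℤ) - 1 - 2 = -m - 3 by ring,
      show -(m : ℤ) - 2 - 1 = -m - 3 by ring] at *
    refine ⟨_, _, _, _, _, hA t, hB t, hX t, hY t, hC t, ?_⟩
    have d1 : HasDerivAt (fun s => stepDet (fun j => F j s) 0 (m + 1) (-m - 1) *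
        stepDet (fun j => F j s) (-1) m (-m - 2) -
        stepDet (fun j => F j s) 0 (m + 1) (-m - 2) * stepDet (fun j => F j s) (-1) m (-m - 1) +
        stepDet (fun j => F j s) 0 m (-m) * stepDet (fun j => F j s) (-1) (m + 1) (-m - 2)) _ t :=
      (((eX ▸ hX t).fun_mul hB2).fun_sub (hX2.fun_mul (eB ▸ hB t))).fun_add
        ((eA ▸ hA t).fun_mul (eY ▸ hY t))
    simp_rw [p1] at d1
    have d0 := d1.unique (hasDerivAt_const t 0)
    simp only [eA, eB, eX, eY, eC]
    refine ⟨p1 t, ?_, ?_, ?_⟩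
    · linear_combination (ν + 1) * p4 + stepDet (fun j => F j t) 0 m (-m) * r2
        - stepDet (fun j => F j t) 0 (m + 1) (-m - 1) * r1
    · linear_combination 2 * p2 - d0 - t * p1 t
    · linear_combination -p3

theorem deriv_of_bilinear {ν : ℂ} {n : ℕ} {t : ℝ} {A B X Y C : ℝ → ℂ} {A' B' X' Y' C' : ℂ}
    (hA : HasDerivAt A A' t) (hB : HasDerivAt B B' t) (hX : HasDerivAt X X' t)
    (hY : HasDerivAt Y Y' t) (hC : HasDerivAt C C' t)
    (h1 : X t * B' - X' * B t + A t * Y t = 0)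
    (h2 : (ν + 1) * C t * B t = t * X t * A t - X' * A t + A' * X t)
    (h3 : A t * Y' - A' * Y t = t * A t * Y t - (ν - n) * B t * X t)
    (h4 : B t * C' - B' * C t = X t * A t)
    (hB0 : B t ≠ 0) (hX0 : X t ≠ 0) (hA0 : A t ≠ 0) (q p : ℝ → ℂ)
    (hq : ∀ t, q t = -(A t * Y t) / (B t * X t))
    (hp : ∀ t, p t = (ν + 1) * (B t * C t) / (X t * A t)) :
    deriv q t = 2 * q t * p t - ((q t) ^ 2 + (t : ℂ) * q t + (-ν + n)) ∧
      deriv p t = -((p t) ^ 2 - (2 * q t + (t : ℂ)) * p t + (-ν - 1)) := by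
  have eB' : B' = (X' * B t - A t * Y t) / X t := by field_simp; linear_combination h1
  have eA' : A' = ((ν + 1) * C t * B t - t * X t * A t + X' * A t) / X t := by
    field_simp; linear_combination -h2
  have eY' : Y' = (A' * Y t + t * A t * Y t - (ν - n) * B t * X t) / A t := by
    field_simp; linear_combination h3
  have eC' : C' = (B' * C t + X t * A t) / B t := by field_simp; linear_combination h4
  have dq := ((hA.fun_mul hY).fun_neg.fun_div (hB.fun_mul hX) (mul_ne_zero hB0 hX0)).deriv
  have dp := (((hB.fun_mul hC).const_mul (ν + 1)).fun_div (hX.fun_mul hA)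
    (mul_ne_zero hX0 hA0)).deriv
  rw [← funext hq] at dq
  rw [← funext hp] at dp
  rw [dq, dp, hq, hp, eC', eY', eA', eB']
  constructor
  · field_simp
    ring
  · field_simp
    ring

/-- Hankel determinants `τ_n^{ν+j}` built from a family of
parabolic-cylinder-type functions give classical transcendental solutions
`q = -τ_n^{ν}τ_{n+1}^{ν-1}/(τ_n^{ν-1}τ_{n+1}^{ν})`,
`p = (ν+1)τ_n^{ν-1}τ_{n+1}^{ν+1}/(τ_{n+1}^{ν}τ_n^{ν})` of the Hamiltonian
system S_IV with `κ₀ = -ν+n`, `θ∞ = -ν-1`. -/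
theorem pIV_det_solution_one
    (ν : ℂ) (hν : ν ∉ Set.range ((↑·) : ℤ → ℂ))
    (φ : ℤ → ℝ → ℂ)
    (hsmooth : ∀ j : ℤ, ContDiff ℝ (⊤ : ℕ∞) (φ j))
    (hdown : ∀ (j : ℤ) (t : ℝ), deriv (φ j) t = -((t : ℂ) / 2) * φ j t + φ (j - 1) t)
    (hup : ∀ (j : ℤ) (t : ℝ),
      deriv (φ j) t = ((t : ℂ) / 2) * φ j t - (ν + j + 1) * φ (j + 1) t)
    (τ : ℤ → ℤ → ℝ → ℂ)
    (hτ : ∀ (j m : ℤ) (t : ℝ), τ j m t =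
      if m < 0 then 0
      else Matrix.det (Matrix.of fun k l : Fin m.toNat =>
        deriv^[(k : ℕ) + (l : ℕ)] (fun s : ℝ => Complex.exp ((s : ℂ) ^ 2 / 4) * φ j s) t))
    (n : ℕ) (U : Set ℝ) (hU : IsOpen U)
    (hden1 : ∀ t ∈ U, τ (-1) n t ≠ 0)
    (hden2 : ∀ t ∈ U, τ 0 (n + 1) t ≠ 0)
    (hden3 : ∀ t ∈ U, τ 0 n t ≠ 0)
    (q p : ℝ → ℂ)
    (hq : ∀ t, q t = -(τ 0 n t * τ (-1) (n + 1) t) / (τ (-1) n t * τ 0 (n + 1) t))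
    (hp : ∀ t, p t = (ν + 1) * (τ (-1) n t * τ 1 (n + 1) t) / (τ 0 (n + 1) t * τ 0 n t)) :
    ∀ t ∈ U,
      deriv q t = 2 * q t * p t - ((q t) ^ 2 + (t : ℂ) * q t + (-ν + n)) ∧
      deriv p t = -((p t) ^ 2 - (2 * q t + (t : ℂ)) * p t + (-ν - 1)) := by
  intro t ht
  set F : ℤ → ℝ → ℂ := fun j s => Complex.exp ((s : ℂ) ^ 2 / 4) * φ j s with hFdef
  have hF (j : ℤ) (s : ℝ) : HasDerivAt (F j) (F (j - 1) s) s := by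
    have h1 : HasDerivAt (φ j) (deriv (φ j) s) s :=
      ((hsmooth j).differentiable (by simp)).differentiableAt.hasDerivAt
    have h2 : HasDerivAt (fun s : ℝ => (s : ℂ) ^ 2 / 4) (2 * (s : ℂ) / 4) s := by
      simpa using ((hasDerivAt_id s).ofReal_comp.fun_pow 2).div_const 4
    convert! h2.cexp.fun_mul h1 using 1
    rw [hdown]
    simp only [hFdef]
    ring
  have hf (j : ℤ) (s : ℝ) : F (j - 2) s = s * F (j - 1) s - (ν + j) * F j s := by
    have h1 := hdown (j - 1) s
    have h2 := hup (j - 1) s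
    rw [show j - 1 - 1 = j - 2 by ring] at h1
    rw [sub_add_cancel] at h2
    push_cast at h2
    simp only [hFdef]
    linear_combination Complex.exp ((s : ℂ) ^ 2 / 4) * (h2 - h1)
  have hiter (k : ℕ) (j : ℤ) : deriv^[k] (F j) = F (j - k) := by
    induction k with
    | zero => simp
    | succ k ih =>
      rw [Function.iterate_succ_apply', ih, funext fun s => (hF (j - k) s).deriv]
      congr 1
      push_cast
      ring
  have hS (a : ℤ) (N : ℕ) (s : ℝ) :
      τ a N s = shiftDet (fun j => F j s) fun i : Fin N => a - ((i : ℕ) : ℤ) := by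
    rw [hτ, if_neg (by simp)]
    change Matrix.det (Matrix.of fun k l : Fin N => deriv^[(k : ℕ) + (l : ℕ)] (F a) s) = _
    simp only [hiter, shiftDet]
    congr 1
    ext k l
    simp only [Matrix.of_apply]
    congr 1
    push_cast
    ring
  obtain ⟨A, B, X, Y, C, hA, hB, hX, hY, hC, h1, h2, h3, h4⟩ :=
    exists_hasDerivAt_and_bilinear hF hf (fun a N => τ a N) hS n t
  simp only [Nat.cast_add, Nat.cast_one] at *
  exact deriv_of_bilinear hA hB hX hY hC h1 h2 h3 h4 (hden1 t ht) (hden2 t ht) (hden3 t ht)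
    q p hq hp
end

section
/- With φ_{i,j} and τ_n^{i,j} as in the context, for every integer n ≥ 0 the pair q = −((c−a)/(c−a−1))^n τ_n^{0,0}τ_{n+1}^{1,1}/(τ_n^{1,0}τ_{n+1}^{0,1}) and p = (1−a)·((c−a−1)/(c−a))^n τ_n^{1,0}τ_{n+1}^{0,1}τ_{n+1}^{−1,−1}/((τ_{n+1}^{0,0})² τ_n^{0,0}) gives a solution of the Hamiltonian system S_V with parameters κ∞ = c−a, κ₀ = a+n, θ = c−n−2, on every open subinterval of (0,∞) on which none of the τ-functions appearing in the denominators vanishes. -/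
open scoped Real

/-- Kummer's confluent hypergeometric function `F(a,c;t)` as an everywhere
convergent power series. -/
noncomputable def kummerF (a c : ℂ) (t : ℝ) : ℂ :=
  ∑' n : ℕ, (Polynomial.eval a (ascPochhammer ℂ n) /
    (Polynomial.eval c (ascPochhammer ℂ n) * (n.factorial : ℂ))) * (t : ℂ) ^ n

/-- The seed functions `φ_{i,j}`. -/
noncomputable def phiV (a c c₁ c₂ : ℂ) (i j : ℤ) (t : ℝ) : ℂ :=
  c₁ * (Complex.Gamma (a + i) * Complex.Gamma (c - a - i + j) / Complex.Gamma (c + j)) *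
      kummerF (a + i) (c + j) t
  + c₂ * (1 / (Complex.sin ((π : ℂ) * (c - a - i + j)) * Complex.Gamma (2 - c - j))) *
      ((t : ℂ) ^ (1 - c - (j : ℂ)) * kummerF (a - c + 1 + i - j) (2 - c - j) t)

/-- The Euler derivation `δ = t d/dt`. -/
noncomputable def eulerD (f : ℝ → ℂ) : ℝ → ℂ := fun t => (t : ℂ) * deriv f t

/-- The Hankel determinants `τ_n^{i,j} = det((t d/dt)^{k+l} φ_{i,j})_{0≤k,l≤n-1}`,
extended by `0` to negative indices `n`. -/
noncomputable def tauV (a c c₁ c₂ : ℂ) (i j : ℤ) (m : ℤ) (t : ℝ) : ℂ :=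
  if m < 0 then 0
  else Matrix.det (Matrix.of fun k l : Fin m.toNat =>
    eulerD^[(k : ℕ) + (l : ℕ)] (phiV a c c₁ c₂ i j) t)


namespace PainleveV

open Polynomial Matrix Filter Topology
open scoped ContDiff

/-- The Hankel determinant of order `m` of a moment functional. -/
noncomputable def hankelDet (L : ℂ[X] →ₗ[ℂ] ℂ) (m : ℕ) : ℂ :=
  det (Matrix.of fun i j : Fin m => L (X ^ (i : ℕ) * X ^ (j : ℕ)))

/-- The matrix of the first `m` coefficients of a family of polynomials. -/
noncomputable def coeffMatrix {m : ℕ} (p : Fin m → ℂ[X]) : Matrix (Fin m) (Fin m) ℂ :=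
  Matrix.of fun i k => (p i).coeff k

theorem mem_degreeLT_iff_coeff {m : ℕ} {f : ℂ[X]} :
    f ∈ degreeLT ℂ m ↔ ∀ k, m ≤ k → f.coeff k = 0 := by
  rw [mem_degreeLT, degree_lt_iff_coeff_zero]

theorem X_pow_mem_degreeLT {i m : ℕ} (h : i < m) : (X ^ i : ℂ[X]) ∈ degreeLT ℂ m := by
  rw [mem_degreeLT_iff_coeff]
  intro k hk
  rw [coeff_X_pow, if_neg (by omega)]

theorem mem_degreeLT_of_natDegree_lt {m : ℕ} {f : ℂ[X]} (h : f.natDegree < m) :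
    f ∈ degreeLT ℂ m :=
  mem_degreeLT.2 (lt_of_le_of_lt degree_le_natDegree (by exact_mod_cast h))

theorem mul_mem_degreeLT {d m : ℕ} {g f : ℂ[X]} (hg : g.natDegree ≤ d) (hf : f ∈ degreeLT ℂ m) :
    g * f ∈ degreeLT ℂ (m + d) := by
  rcases eq_or_ne f 0 with rfl | h0
  · simp
  · refine mem_degreeLT_of_natDegree_lt (lt_of_le_of_lt natDegree_mul_le ?_)
    have := (natDegree_lt_iff_degree_lt h0).2 (mem_degreeLT.1 hf)
    omega

theorem comp_X_add_C_mem_degreeLT {m : ℕ} {f : ℂ[X]} (x : ℂ) (hf : f ∈ degreeLT ℂ m) :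
    f.comp (X + C x) ∈ degreeLT ℂ m := by
  rcases eq_or_ne f 0 with rfl | h0
  · simp
  · refine mem_degreeLT_of_natDegree_lt ?_
    rw [natDegree_comp, natDegree_X_add_C, mul_one]
    exact (natDegree_lt_iff_degree_lt h0).2 (mem_degreeLT.1 hf)

theorem eq_sum_of_mem_degreeLT {m : ℕ} {f : ℂ[X]} (hf : f ∈ degreeLT ℂ m) :
    f = ∑ k : Fin m, f.coeff k • X ^ (k : ℕ) := by
  ext d
  simp only [finsetSum_coeff, coeff_smul, coeff_X_pow, smul_eq_mul, mul_ite, mul_one, mul_zero]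
  by_cases hd : d < m
  · rw [Finset.sum_eq_single ⟨d, hd⟩]
    · simp
    · intro b _ hb
      exact if_neg fun h => hb (Fin.ext h.symm)
    · simp
  · rw [mem_degreeLT_iff_coeff.1 hf d (by omega), Finset.sum_eq_zero]
    intro b _
    exact if_neg (by omega)

theorem map_mul_eq_zero_of_mem_degreeLT {L : ℂ[X] →ₗ[ℂ] ℂ} {f g : ℂ[X]} {m : ℕ}
    (h : ∀ i < m, L (f * X ^ i) = 0) (hg : g ∈ degreeLT ℂ m) : L (f * g) = 0 := by
  rw [eq_sum_of_mem_degreeLT hg, Finset.mul_sum, map_sum]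
  refine Finset.sum_eq_zero fun i _ => ?_
  rw [mul_smul_comm, map_smul, h i i.2, smul_zero]

/-- A functional whose top moment against `f` is `1` and lower moments vanish reads off the
leading coefficient. -/
theorem map_mul_eq_coeff_of_mem_degreeLT {L : ℂ[X] →ₗ[ℂ] ℂ} {f g : ℂ[X]} {m : ℕ}
    (h : ∀ i < m, L (f * X ^ i) = 0) (hm : L (f * X ^ m) = 1) (hg : g ∈ degreeLT ℂ (m + 1)) :
    L (f * g) = g.coeff m := by
  have h1 : g - g.coeff m • X ^ m ∈ degreeLT ℂ m := by
    rw [mem_degreeLT_iff_coeff] at hg ⊢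
    intro k hk
    rw [coeff_sub, coeff_smul, coeff_X_pow]
    split_ifs with hkm
    · simp [hkm]
    · simp [hg k (by omega)]
  have h2 := map_mul_eq_zero_of_mem_degreeLT h h1
  rw [mul_sub, map_sub, mul_smul_comm, map_smul, hm, sub_eq_zero] at h2
  simpa using h2

theorem eq_zero_of_hankelDet_ne_zero {L : ℂ[X] →ₗ[ℂ] ℂ} {m : ℕ} (hL : hankelDet L m ≠ 0)
    {f : ℂ[X]} (hf : f ∈ degreeLT ℂ m) (h : ∀ i < m, L (f * X ^ i) = 0) : f = 0 := by
  have hv : (fun k : Fin m => f.coeff k) = 0 := by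
    refine eq_zero_of_mulVec_eq_zero hL ?_
    funext i
    have h1 := h i i.2
    rw [eq_sum_of_mem_degreeLT hf, Finset.sum_mul, map_sum] at h1
    rw [Pi.zero_apply, ← h1, mulVec, dotProduct]
    refine Finset.sum_congr rfl fun k _ => ?_
    rw [smul_mul_assoc, map_smul, of_apply, smul_eq_mul, mul_comm, mul_comm (X ^ (i : ℕ))]
  rw [eq_sum_of_mem_degreeLT hf]
  exact Finset.sum_eq_zero fun k _ => by rw [show f.coeff k = 0 from congrFun hv k, zero_smul]

theorem det_map_mul {L : ℂ[X] →ₗ[ℂ] ℂ} {m : ℕ} {p q : Fin m → ℂ[X]}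
    (hp : ∀ i, p i ∈ degreeLT ℂ m) (hq : ∀ i, q i ∈ degreeLT ℂ m) :
    det (Matrix.of fun i j => L (p i * q j)) =
      det (coeffMatrix p) * hankelDet L m * det (coeffMatrix q) := by
  have : (Matrix.of fun i j => L (p i * q j)) = coeffMatrix p *
      (Matrix.of fun i j : Fin m => L (X ^ (i : ℕ) * X ^ (j : ℕ))) * (coeffMatrix q)ᵀ := by
    ext i j
    simp only [mul_apply, of_apply, transpose_apply, coeffMatrix]
    conv_lhs => rw [eq_sum_of_mem_degreeLT (hp i), eq_sum_of_mem_degreeLT (hq j)]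
    rw [Finset.mul_sum, map_sum]
    refine Finset.sum_congr rfl fun k _ => ?_
    rw [Finset.sum_mul, map_sum, Finset.sum_mul]
    refine Finset.sum_congr rfl fun l _ => ?_
    rw [smul_mul_smul_comm, map_smul, smul_eq_mul]
    ring
  rw [this, det_mul, det_mul, det_transpose, hankelDet]

theorem det_coeffMatrix_of_monic {m : ℕ} {p : Fin m → ℂ[X]} (hd : ∀ i, (p i).natDegree = i)
    (hm : ∀ i, (p i).Monic) : det (coeffMatrix p) = 1 := by
  rw [← det_transpose]
  exact det_matrixOfPolynomials p hd hm

theorem det_coeffMatrix_of_last {n : ℕ} {q : Fin (n + 1) → ℂ[X]}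
    (hq : ∀ i : Fin n, q i.castSucc = X ^ (i : ℕ)) :
    det (coeffMatrix q) = (q (Fin.last n)).coeff n := by
  rw [det_of_isLowerTriangular, Fin.prod_univ_castSucc]
  · simp [coeffMatrix, hq]
  · intro i j hij
    obtain ⟨i', rfl⟩ | rfl := i.eq_castSucc_or_eq_last
    · have : (j : ℕ) ≠ i' := by
        have := Fin.lt_def.1 (show i'.castSucc < j from hij)
        simp at this
        omega
      simp [coeffMatrix, hq, coeff_X_pow, this]
    · exact absurd (show Fin.last n < j from hij) (not_lt.2 (Fin.le_last j))

theorem det_coeffMatrix_of_root {n : ℕ} {p : Fin (n + 1) → ℂ[X]} (y : ℂ)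
    (hp : ∀ i : Fin n, p i.castSucc = (X - C y) * X ^ (i : ℕ))
    (hl : p (Fin.last n) ∈ degreeLT ℂ (n + 1)) :
    det (coeffMatrix p) = (-1) ^ n * (p (Fin.last n)).eval y := by
  have hmem : ∀ i, p i ∈ degreeLT ℂ (n + 1) := by
    intro i
    obtain ⟨i', rfl⟩ | rfl := i.eq_castSucc_or_eq_last
    · rw [hp]
      exact mul_mem_degreeLT (by simp) (X_pow_mem_degreeLT i'.2)
    · exact hl
  let V : Matrix (Fin (n + 1)) (Fin (n + 1)) ℂ :=
    Matrix.of fun k j => if j = 0 then y ^ (k : ℕ) else if k = j then 1 else 0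
  have hV : det V = 1 := by
    rw [det_of_isLowerTriangular]
    · refine Finset.prod_eq_one fun i _ => ?_
      rcases eq_or_ne i 0 with rfl | h
      · simp [V]
      · simp [V, h]
    · intro i j hij
      have h : i < j := hij
      have : j ≠ 0 := (lt_of_le_of_lt (Fin.zero_le i) h).ne'
      simp [V, this, h.ne]
  have h0 : ∀ i, (coeffMatrix p * V) i 0 = (p i).eval y := by
    intro i
    conv_rhs => rw [eq_sum_of_mem_degreeLT (hmem i)]
    simp [mul_apply, coeffMatrix, V, eval_finsetSum]
  have hs : ∀ i (j : Fin n), (coeffMatrix p * V) i j.succ = (p i).coeff (j + 1) := by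
    intro i j
    simp [mul_apply, coeffMatrix, V]
  have h1 : det (coeffMatrix p) = det (coeffMatrix p * V) := by rw [det_mul, hV, mul_one]
  rw [h1, det_succ_column_zero, Finset.sum_eq_single (Fin.last n)]
  · rw [h0, Fin.val_last]
    suffices h : det ((coeffMatrix p * V).submatrix (Fin.last n).succAbove Fin.succ) = 1 by
      rw [h, mul_one]
    rw [det_of_isLowerTriangular]
    · refine Finset.prod_eq_one fun i _ => ?_
      rw [submatrix_apply, hs, Fin.succAbove_last, hp, sub_mul, coeff_sub, coeff_X_mul,
        coeff_C_mul]
      simp [coeff_X_pow]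
    · intro i j hij
      have h : (i : ℕ) < j := hij
      rw [submatrix_apply, hs, Fin.succAbove_last, hp, sub_mul, coeff_sub, coeff_X_mul,
        coeff_C_mul]
      simp only [coeff_X_pow]
      rw [if_neg (by omega), if_neg (by omega)]
      simp
  · intro i _ hi
    obtain ⟨i', rfl⟩ | rfl := i.eq_castSucc_or_eq_last
    · rw [h0, hp]
      simp
    · exact absurd rfl hi
  · simp

theorem det_of_last_column_eq_zero {n : ℕ} (A : Matrix (Fin (n + 1)) (Fin (n + 1)) ℂ)
    (h : ∀ i : Fin n, A i.castSucc (Fin.last n) = 0) :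
    det A = det (A.submatrix Fin.castSucc Fin.castSucc) * A (Fin.last n) (Fin.last n) := by
  rw [det_succ_column A (Fin.last n), Finset.sum_eq_single (Fin.last n)]
  · rw [Fin.succAbove_last, Even.neg_one_pow ⟨_, rfl⟩]
    ring
  · intro i _ hi
    obtain ⟨i', rfl⟩ | rfl := i.eq_castSucc_or_eq_last
    · rw [h]
      ring
    · exact absurd rfl hi
  · simp

/-- Translation invariance of Hankel determinants. -/
theorem det_map_mul_X_add_C_pow (L : ℂ[X] →ₗ[ℂ] ℂ) (x : ℂ) (m : ℕ) :
    det (Matrix.of fun i j : Fin m => L ((X + C x) ^ (i : ℕ) * (X + C x) ^ (j : ℕ))) =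
      hankelDet L m := by
  have hdeg : ∀ i : Fin m, ((X + C x : ℂ[X]) ^ (i : ℕ)).natDegree = i := fun i => by
    simp
  have hmem : ∀ i : Fin m, ((X + C x : ℂ[X]) ^ (i : ℕ)) ∈ degreeLT ℂ m := fun i =>
    mem_degreeLT_of_natDegree_lt (by rw [hdeg]; exact i.2)
  rw [det_map_mul hmem hmem, det_coeffMatrix_of_monic hdeg fun i => (monic_X_add_C x).pow _]
  ring

/-- Christoffel's formula: multiplying a functional by a linear factor. -/
theorem det_map_X_sub_C_mul {L : ℂ[X] →ₗ[ℂ] ℂ} {m : ℕ} {Q : ℂ[X]}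
    (hQ : Q - X ^ m ∈ degreeLT ℂ m) (h : ∀ i < m, L (Q * X ^ i) = 0) (y : ℂ) :
    det (Matrix.of fun i j : Fin m => L (X ^ (i : ℕ) * ((X - C y) * X ^ (j : ℕ)))) =
      (-1) ^ m * Q.eval y * hankelDet L m := by
  rcases m with _ | n
  · have : Q = 1 := by
      have := mem_degreeLT_iff_coeff.1 hQ
      have h0 : Q - X ^ 0 = 0 := by
        ext k
        simpa using this k (Nat.zero_le k)
      simpa [sub_eq_zero] using h0
    simp [this, hankelDet]
  · let q : Fin (n + 1) → ℂ[X] := fun j =>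
      if j = Fin.last n then (X - C y) * X ^ n - Q else (X - C y) * X ^ (j : ℕ)
    have hl : (X - C y) * X ^ n - Q ∈ degreeLT ℂ (n + 1) := by
      have h1 : (X - C y) * X ^ n - Q = -(C y * X ^ n) - (Q - X ^ (n + 1)) := by ring
      rw [h1]
      refine Submodule.sub_mem _ (Submodule.neg_mem _ ?_) hQ
      have := mul_mem_degreeLT (d := 0) (g := C y) (by simp) (X_pow_mem_degreeLT n.lt_succ_self)
      simpa using this
    have hq : ∀ j : Fin n, q j.castSucc = (X - C y) * X ^ (j : ℕ) := fun j => by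
      simp [q, (Fin.castSucc_lt_last j).ne]
    have hmem : ∀ j, q j ∈ degreeLT ℂ (n + 1) := by
      intro i
      obtain ⟨i', rfl⟩ | rfl := i.eq_castSucc_or_eq_last
      · rw [hq]
        exact mul_mem_degreeLT (by simp) (X_pow_mem_degreeLT i'.2)
      · simpa [q] using hl
    have hM : (Matrix.of fun i j : Fin (n + 1) => L (X ^ (i : ℕ) * ((X - C y) * X ^ (j : ℕ)))) =
        Matrix.of fun i j : Fin (n + 1) => L (X ^ (i : ℕ) * q j) := by
      ext i j
      simp only [of_apply]
      obtain ⟨i', rfl⟩ | rfl := j.eq_castSucc_or_eq_last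
      · rw [hq]
        rfl
      · have := h i i.2
        simp only [q, if_true, Fin.val_last]
        rw [mul_sub, map_sub, mul_comm _ Q, this, sub_zero]
    rw [hM, det_map_mul (fun i => X_pow_mem_degreeLT i.2) hmem,
      det_coeffMatrix_of_monic (by simp) (fun i => monic_X_pow _),
      det_coeffMatrix_of_root y hq (by simpa [q] using hl)]
    simp only [q, if_true, eval_sub, eval_mul, eval_X, eval_C]
    ring

/-- The double Christoffel formula, in terms of the reproducing kernel `K` at `x`. -/
theorem det_map_X_sub_C_mul_X_sub_C_mul {L : ℂ[X] →ₗ[ℂ] ℂ} {n : ℕ} {K : ℂ[X]} (x y : ℂ)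
    (hK : K ∈ degreeLT ℂ (n + 1)) (h1 : L K = 1)
    (h : ∀ i < n, L ((X - C x) * X ^ i * K) = 0) :
    det (Matrix.of fun i j : Fin n =>
      L ((X - C x) * X ^ (i : ℕ) * ((X - C y) * X ^ (j : ℕ)))) =
      K.eval y * hankelDet L (n + 1) := by
  let p : Fin (n + 1) → ℂ[X] := Fin.snoc (fun i : Fin n => (X - C x) * X ^ (i : ℕ)) 1
  let q : Fin (n + 1) → ℂ[X] := Fin.snoc (fun i : Fin n => (X - C y) * X ^ (i : ℕ)) K
  have hp : ∀ i : Fin n, p i.castSucc = (X - C x) * X ^ (i : ℕ) := fun i => by simp [p]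
  have hq : ∀ i : Fin n, q i.castSucc = (X - C y) * X ^ (i : ℕ) := fun i => by simp [q]
  have hpl : p (Fin.last n) = 1 := by simp [p]
  have hql : q (Fin.last n) = K := by simp [q]
  have hone : (1 : ℂ[X]) ∈ degreeLT ℂ (n + 1) := by
    simpa using X_pow_mem_degreeLT (Nat.succ_pos n)
  have hpm : ∀ i, p i ∈ degreeLT ℂ (n + 1) := by
    intro i
    obtain ⟨i', rfl⟩ | rfl := i.eq_castSucc_or_eq_last
    · rw [hp]
      exact mul_mem_degreeLT (by simp) (X_pow_mem_degreeLT i'.2)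
    · rwa [hpl]
  have hqm : ∀ i, q i ∈ degreeLT ℂ (n + 1) := by
    intro i
    obtain ⟨i', rfl⟩ | rfl := i.eq_castSucc_or_eq_last
    · rw [hq]
      exact mul_mem_degreeLT (by simp) (X_pow_mem_degreeLT i'.2)
    · rwa [hql]
  have e1 := det_map_mul (L := L) hpm hqm
  rw [det_coeffMatrix_of_root x hp (by rwa [hpl]), det_coeffMatrix_of_root y hq (by rwa [hql]),
    det_of_last_column_eq_zero, hpl, hql] at e1
  · have e2 : ((Matrix.of fun i j => L (p i * q j)).submatrix Fin.castSucc Fin.castSucc) =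
        Matrix.of fun i j : Fin n =>
          L ((X - C x) * X ^ (i : ℕ) * ((X - C y) * X ^ (j : ℕ))) := by
      ext i j
      simp [hp, hq]
    rw [e2, of_apply, hpl, hql, one_mul, h1, mul_one, eval_one] at e1
    rw [e1]
    have : ((-1 : ℂ) ^ n) * (-1) ^ n = 1 := by rw [← mul_pow]; simp
    linear_combination (K.eval y * hankelDet L (n + 1)) * this
  · intro i
    rw [of_apply, hp, hql, h i i.2]

/-- Geronimus' formula: dividing a functional by a linear factor. -/
theorem hankelDet_mul_coeff {L M : ℂ[X] →ₗ[ℂ] ℂ} {n : ℕ} {R : ℂ[X]} (y κ : ℂ)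
    (hR : R ∈ degreeLT ℂ (n + 1)) (h : ∀ i < n, L (R * X ^ i) = 0)
    (hM : ∀ f, M ((X - C y) * f) = κ * L f) :
    hankelDet M (n + 1) * R.coeff n = (-1) ^ n * κ ^ n * hankelDet L n * M R := by
  let p : Fin (n + 1) → ℂ[X] := Fin.snoc (fun i : Fin n => (X - C y) * X ^ (i : ℕ)) 1
  let q : Fin (n + 1) → ℂ[X] := Fin.snoc (fun i : Fin n => X ^ (i : ℕ)) R
  have hp : ∀ i : Fin n, p i.castSucc = (X - C y) * X ^ (i : ℕ) := fun i => by simp [p]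
  have hq : ∀ i : Fin n, q i.castSucc = X ^ (i : ℕ) := fun i => by simp [q]
  have hpl : p (Fin.last n) = 1 := by simp [p]
  have hql : q (Fin.last n) = R := by simp [q]
  have hone : (1 : ℂ[X]) ∈ degreeLT ℂ (n + 1) := by
    simpa using X_pow_mem_degreeLT (Nat.succ_pos n)
  have hpm : ∀ i, p i ∈ degreeLT ℂ (n + 1) := by
    intro i
    obtain ⟨i', rfl⟩ | rfl := i.eq_castSucc_or_eq_last
    · rw [hp]
      exact mul_mem_degreeLT (by simp) (X_pow_mem_degreeLT i'.2)
    · rwa [hpl]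
  have hqm : ∀ i, q i ∈ degreeLT ℂ (n + 1) := by
    intro i
    obtain ⟨i', rfl⟩ | rfl := i.eq_castSucc_or_eq_last
    · rw [hq]
      exact X_pow_mem_degreeLT (by omega)
    · rwa [hql]
  have e1 := det_map_mul (L := M) hpm hqm
  rw [det_coeffMatrix_of_root y hp (by rwa [hpl]), det_coeffMatrix_of_last hq,
    det_of_last_column_eq_zero, hpl, hql] at e1
  · have e2 : ((Matrix.of fun i j => M (p i * q j)).submatrix Fin.castSucc Fin.castSucc) =
        κ • Matrix.of fun i j : Fin n => L (X ^ (i : ℕ) * X ^ (j : ℕ)) := by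
      ext i j
      simp [hp, hq, mul_assoc, hM]
    rw [e2, of_apply, hpl, hql, one_mul, eval_one, mul_one, det_smul, Fintype.card_fin] at e1
    have : ((-1 : ℂ) ^ n) * (-1) ^ n = 1 := by rw [← mul_pow]; simp
    rw [← hankelDet] at e1
    linear_combination (-(-1 : ℂ) ^ n) * e1 - hankelDet M (n + 1) * R.coeff n * this
  · intro i
    rw [of_apply, hp, hql, mul_assoc, hM, mul_comm _ R, h i i.2, mul_zero]

theorem coeff_mul_hankelDet_succ {L : ℂ[X] →ₗ[ℂ] ℂ} {n : ℕ} {R : ℂ[X]}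
    (hR : R ∈ degreeLT ℂ (n + 1)) (h : ∀ i < n, L (R * X ^ i) = 0) (hn : L (R * X ^ n) = 1) :
    R.coeff n * hankelDet L (n + 1) = hankelDet L n := by
  let q : Fin (n + 1) → ℂ[X] := Fin.snoc (fun i : Fin n => X ^ (i : ℕ)) R
  have hq : ∀ i : Fin n, q i.castSucc = X ^ (i : ℕ) := fun i => by simp [q]
  have hql : q (Fin.last n) = R := by simp [q]
  have hqm : ∀ i, q i ∈ degreeLT ℂ (n + 1) := by
    intro i
    obtain ⟨i', rfl⟩ | rfl := i.eq_castSucc_or_eq_last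
    · rw [hq]
      exact X_pow_mem_degreeLT (by omega)
    · rwa [hql]
  have e1 := det_map_mul (L := L) (p := fun i : Fin (n + 1) => X ^ (i : ℕ))
    (fun i => X_pow_mem_degreeLT i.2) hqm
  rw [det_coeffMatrix_of_monic (by simp) (fun i => monic_X_pow _), det_coeffMatrix_of_last hq,
    det_of_last_column_eq_zero, hql] at e1
  · have e2 : ((Matrix.of fun i j : Fin (n + 1) => L (X ^ (i : ℕ) * q j)).submatrix
        Fin.castSucc Fin.castSucc) =
        Matrix.of fun i j : Fin n => L (X ^ (i : ℕ) * X ^ (j : ℕ)) := by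
      ext i j
      simp [hq]
    rw [e2, of_apply, hql, Fin.val_last, mul_comm _ R, hn, ← hankelDet] at e1
    linear_combination -e1
  · intro i
    rw [of_apply, hql, mul_comm _ R, Fin.val_castSucc, h i i.2]

theorem map_C_mul (L : ℂ[X] →ₗ[ℂ] ℂ) (x : ℂ) (p : ℂ[X]) : L (C x * p) = x * L p := by
  rw [← smul_eq_C_mul, map_smul, smul_eq_mul]

theorem C_mul_mem_degreeLT {m : ℕ} {f : ℂ[X]} (x : ℂ) (hf : f ∈ degreeLT ℂ m) :
    C x * f ∈ degreeLT ℂ m := by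
  rw [← smul_eq_C_mul]
  exact Submodule.smul_mem _ _ hf

theorem degreeLT_le_succ {m : ℕ} {f : ℂ[X]} (hf : f ∈ degreeLT ℂ m) :
    f ∈ degreeLT ℂ (m + 1) :=
  degreeLT_mono (Nat.le_succ m) hf

theorem X_mul_mem_degreeLT {m : ℕ} {f : ℂ[X]} (hf : f ∈ degreeLT ℂ m) :
    X * f ∈ degreeLT ℂ (m + 1) :=
  mul_mem_degreeLT natDegree_X_le hf

theorem sub_leading_mem_degreeLT {m : ℕ} {f : ℂ[X]} (hf : f ∈ degreeLT ℂ (m + 1)) :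
    f - C (f.coeff m) * X ^ m ∈ degreeLT ℂ m := by
  rw [mem_degreeLT_iff_coeff] at hf ⊢
  intro k hk
  rw [coeff_sub, coeff_C_mul, coeff_X_pow]
  split_ifs with hkm
  · simp [hkm]
  · simp [hf k (by omega)]

theorem X_mul_X_add_C_pow_sub_mem_degreeLT (x : ℂ) (m : ℕ) :
    X * (X + C x) ^ m - X ^ (m + 1) - C (m * x) * X ^ m ∈ degreeLT ℂ m := by
  induction m with
  | zero => simp
  | succ m ih =>
    have h1 : X * (X + C x) ^ (m + 1) - X ^ (m + 1 + 1) - C ((m + 1 : ℕ) * x) * X ^ (m + 1) =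
        (X + C x) * (X * (X + C x) ^ m - X ^ (m + 1) - C (m * x) * X ^ m) +
          C (m * x * x) * X ^ m := by
      simp only [Nat.cast_add, Nat.cast_one, map_mul, map_add, map_one, map_natCast]
      ring
    rw [h1]
    exact Submodule.add_mem _ (mul_mem_degreeLT (by simp) ih)
      (C_mul_mem_degreeLT _ (X_pow_mem_degreeLT m.lt_succ_self))

/-- The two leading coefficients of a translated polynomial. -/
theorem X_mul_comp_X_add_C_sub_mem_degreeLT {m : ℕ} {f : ℂ[X]} (x : ℂ)
    (hf : f ∈ degreeLT ℂ (m + 1)) :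
    X * f.comp (X + C x) - C (f.coeff m) * X ^ (m + 1) -
      C ((X * f).coeff m + m * x * f.coeff m) * X ^ m ∈ degreeLT ℂ m := by
  rcases m with _ | m
  · have h := sub_leading_mem_degreeLT hf
    have h0 : f - C (f.coeff 0) * X ^ 0 = 0 := by
      ext k
      exact mem_degreeLT_iff_coeff.1 h k (Nat.zero_le k)
    rw [pow_zero, mul_one, sub_eq_zero] at h0
    obtain ⟨b, rfl⟩ : ∃ b, f = C b := ⟨_, h0⟩
    simp [mul_comm X (C b)]
  · have h := sub_leading_mem_degreeLT hf
    set f₁ := f - C (f.coeff (m + 1)) * X ^ (m + 1) with hf₁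
    have h2 := sub_leading_mem_degreeLT h
    set f₂ := f₁ - C (f₁.coeff m) * X ^ m with hf₂
    have e1 : f₁.coeff m = f.coeff m := by
      rw [hf₁, coeff_sub, coeff_C_mul, coeff_X_pow, if_neg (by omega)]
      simp
    have e2 : f = C (f.coeff (m + 1)) * X ^ (m + 1) + C (f.coeff m) * X ^ m + f₂ := by
      rw [hf₂, e1, hf₁]
      ring
    have e3 : f.comp (X + C x) = C (f.coeff (m + 1)) * (X + C x) ^ (m + 1) +
        C (f.coeff m) * (X + C x) ^ m + f₂.comp (X + C x) := by
      conv_lhs => rw [e2]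
      simp
    have e4 : X * f.comp (X + C x) - C (f.coeff (m + 1)) * X ^ (m + 1 + 1) -
        C ((X * f).coeff (m + 1) + (m + 1 : ℕ) * x * f.coeff (m + 1)) * X ^ (m + 1) =
        C (f.coeff (m + 1)) * (X * (X + C x) ^ (m + 1) - X ^ (m + 1 + 1) -
          C ((m + 1 : ℕ) * x) * X ^ (m + 1)) +
        C (f.coeff m) * (X * (X + C x) ^ m - X ^ (m + 1) - C (m * x) * X ^ m) +
        C (f.coeff m * (m * x)) * X ^ m + X * f₂.comp (X + C x) := by
      rw [e3, coeff_X_mul]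
      simp only [map_mul, map_add]
      ring
    rw [e4]
    refine Submodule.add_mem _ (Submodule.add_mem _ (Submodule.add_mem _ ?_ ?_) ?_) ?_
    · exact C_mul_mem_degreeLT _ (X_mul_X_add_C_pow_sub_mem_degreeLT x (m + 1))
    · exact degreeLT_le_succ (C_mul_mem_degreeLT _ (X_mul_X_add_C_pow_sub_mem_degreeLT x m))
    · exact C_mul_mem_degreeLT _ (X_pow_mem_degreeLT m.lt_succ_self)
    · exact X_mul_mem_degreeLT (comp_X_add_C_mem_degreeLT x h2)

/-- The quotient of a polynomial by `X - ξ` drops the degree by one. -/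
theorem exists_eq_C_add_mul {m : ℕ} {f : ℂ[X]} (ξ : ℂ) (hf : f ∈ degreeLT ℂ (m + 1)) :
    ∃ g ∈ degreeLT ℂ m, f = C (f.eval ξ) + (X - C ξ) * g := by
  refine ⟨f /ₘ (X - C ξ), ?_, ?_⟩
  · rcases eq_or_ne f 0 with rfl | h0
    · simp
    · rcases eq_or_ne (f /ₘ (X - C ξ)) 0 with h1 | h1
      · rw [h1]
        exact Submodule.zero_mem _
      · have h2 := (natDegree_lt_iff_degree_lt h0).2 (mem_degreeLT.1 hf)
        have h3 := natDegree_divByMonic f (monic_X_sub_C ξ)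
        rw [natDegree_X_sub_C] at h3
        refine mem_degreeLT_of_natDegree_lt ?_
        by_contra hc
        have h4 : f.natDegree = 0 ∧ m = 0 := by omega
        apply h1
        rw [divByMonic_eq_zero_iff (monic_X_sub_C ξ), degree_X_sub_C,
          degree_eq_natDegree h0, h4.1]
        norm_num
  · rw [add_comm]
    conv_lhs => rw [← modByMonic_add_div f (X - C ξ)]
    rw [modByMonic_X_sub_C_eq_C_eval, add_comm]

/-- The monic orthogonal polynomial of degree `n + 1` and the normalised one of degree `n`. -/
structure OrthogonalPair (L : ℂ[X] →ₗ[ℂ] ℂ) (n : ℕ) (P R : ℂ[X]) : Prop where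
  hankelDet_ne_zero : hankelDet L (n + 1) ≠ 0
  hankelDet_ne_zero' : hankelDet L n ≠ 0
  P_mem : P - X ^ (n + 1) ∈ degreeLT ℂ (n + 1)
  P_orth : ∀ i < n + 1, L (P * X ^ i) = 0
  R_mem : R ∈ degreeLT ℂ (n + 1)
  R_orth : ∀ i < n, L (R * X ^ i) = 0
  R_norm : L (R * X ^ n) = 1

namespace OrthogonalPair

variable {L : ℂ[X] →ₗ[ℂ] ℂ} {n : ℕ} {P R : ℂ[X]}

theorem P_mem' (h : OrthogonalPair L n P R) : P ∈ degreeLT ℂ (n + 1 + 1) := by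
  have := Submodule.add_mem _ (degreeLT_le_succ h.P_mem) (X_pow_mem_degreeLT (n + 1).lt_succ_self)
  simpa using this

theorem P_coeff (h : OrthogonalPair L n P R) : P.coeff (n + 1) = 1 := by
  have := mem_degreeLT_iff_coeff.1 h.P_mem (n + 1) le_rfl
  rw [coeff_sub, coeff_X_pow, if_pos rfl, sub_eq_zero] at this
  exact this

theorem map_P_mul (h : OrthogonalPair L n P R) {g : ℂ[X]} (hg : g ∈ degreeLT ℂ (n + 1)) :
    L (P * g) = 0 :=
  map_mul_eq_zero_of_mem_degreeLT h.P_orth hg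

theorem map_R_mul (h : OrthogonalPair L n P R) {g : ℂ[X]} (hg : g ∈ degreeLT ℂ n) :
    L (R * g) = 0 :=
  map_mul_eq_zero_of_mem_degreeLT h.R_orth hg

theorem map_R_mul_eq_coeff (h : OrthogonalPair L n P R) {g : ℂ[X]}
    (hg : g ∈ degreeLT ℂ (n + 1)) : L (R * g) = g.coeff n :=
  map_mul_eq_coeff_of_mem_degreeLT h.R_orth h.R_norm hg

theorem coeff_mul (h : OrthogonalPair L n P R) :
    R.coeff n * hankelDet L (n + 1) = hankelDet L n :=
  coeff_mul_hankelDet_succ h.R_mem h.R_orth h.R_norm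

theorem coeff_ne_zero (h : OrthogonalPair L n P R) : R.coeff n ≠ 0 := by
  intro h0
  have := h.coeff_mul
  rw [h0, zero_mul] at this
  exact h.hankelDet_ne_zero' this.symm

/-- `P` and `R` have no common root. -/
theorem eval_ne_zero (h : OrthogonalPair L n P R) (ξ : ℂ) (hP : P.eval ξ = 0) :
    R.eval ξ ≠ 0 := by
  intro hR
  obtain ⟨P', hP', eP⟩ := exists_eq_C_add_mul ξ h.P_mem'
  obtain ⟨R', hR', eR⟩ := exists_eq_C_add_mul ξ h.R_mem
  rw [hP, C_0, zero_add] at eP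
  rw [hR, C_0, zero_add] at eR
  have h1 : L (R * P') = P'.coeff n := h.map_R_mul_eq_coeff hP'
  have h2 : P'.coeff n = 1 := by
    have h3 := h.P_coeff
    rw [eP, sub_mul, coeff_sub, coeff_X_mul, coeff_C_mul,
      mem_degreeLT_iff_coeff.1 hP' (n + 1) le_rfl] at h3
    simpa using h3
  have h4 : R * P' = P * R' := by
    rw [eR, eP]
    ring
  rw [h2, h4, h.map_P_mul (degreeLT_le_succ hR')] at h1
  exact zero_ne_one h1

/-- The Christoffel–Darboux kernel at the origin. -/
theorem exists_kernel (h : OrthogonalPair L n P R) :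
    ∃ E ∈ degreeLT ℂ (n + 1), X * E = C (R.eval 0) * P - C (P.eval 0) * R ∧
      E.coeff n = R.eval 0 ∧ L E = 1 := by
  obtain ⟨P', hP', eP⟩ := exists_eq_C_add_mul 0 h.P_mem'
  obtain ⟨R', hR', eR⟩ := exists_eq_C_add_mul 0 h.R_mem
  rw [C_0, sub_zero] at eP eR
  have hc : P'.coeff n = 1 := by
    have h3 := h.P_coeff
    rw [eP, coeff_add, coeff_X_mul, coeff_C, if_neg (by omega), zero_add] at h3
    exact h3
  have hE : C (R.eval 0) * P' - C (P.eval 0) * R' ∈ degreeLT ℂ (n + 1) :=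
    Submodule.sub_mem _ (C_mul_mem_degreeLT _ hP') (C_mul_mem_degreeLT _ (degreeLT_le_succ hR'))
  have hX : X * (C (R.eval 0) * P' - C (P.eval 0) * R') =
      C (R.eval 0) * P - C (P.eval 0) * R := by
    linear_combination -C (R.eval 0) * eP + C (P.eval 0) * eR
  have hEn : (C (R.eval 0) * P' - C (P.eval 0) * R').coeff n = R.eval 0 := by
    rw [coeff_sub, coeff_C_mul, coeff_C_mul, hc, mem_degreeLT_iff_coeff.1 hR' n le_rfl]
    ring
  refine ⟨_, hE, hX, hEn, ?_⟩
  set E := C (R.eval 0) * P' - C (P.eval 0) * R' with hEdef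
  have e1 : R.eval 0 * L E = R.eval 0 := by
    have : C (R.eval 0) * E = R * E - (C (R.eval 0) * (P * R') - C (P.eval 0) * (R * R')) := by
      linear_combination -E * eR - R' * hX
    rw [← map_C_mul, this, map_sub, map_sub, map_C_mul, map_C_mul, h.map_R_mul_eq_coeff hE,
      h.map_P_mul (degreeLT_le_succ hR'), h.map_R_mul hR', hEn]
    ring
  have e2 : P.eval 0 * L E = P.eval 0 := by
    have : C (P.eval 0) * E = P * E - (C (R.eval 0) * (P * P') - C (P.eval 0) * (R * P')) := by
      linear_combination -E * eP - P' * hX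
    rw [← map_C_mul, this, map_sub, map_sub, map_C_mul, map_C_mul, h.map_R_mul_eq_coeff hP',
      h.map_P_mul hE, h.map_P_mul hP', hc]
    ring
  by_cases hP0 : P.eval 0 = 0
  · exact mul_left_cancel₀ (h.eval_ne_zero 0 hP0) (e1.trans (mul_one _).symm)
  · exact mul_left_cancel₀ hP0 (e2.trans (mul_one _).symm)

end OrthogonalPair

/-- The contiguity relations between the moment functionals of the seed functions
`φ_{0,0}`, `φ_{0,1}`, `φ_{1,0}`, `φ_{1,1}` and `φ_{-1,-1}`. -/
structure ContiguityRelations (a c t : ℂ) (L L01 L10 L11 Lm : ℂ[X] →ₗ[ℂ] ℂ) : Prop where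
  t_ne_zero : t ≠ 0
  ca_ne_zero : c - a ≠ 0
  ca_one_ne_zero : c - a - 1 ≠ 0
  a_one_ne_zero : a - 1 ≠ 0
  map_11 : ∀ p, L (X * p) = t * L11 (p.comp (X + C 1))
  map_m : ∀ p, Lm (X * p) = t * L (p.comp (X + C 1))
  map_10 : ∀ p, L ((X + C a) * p) = (c - a - 1) * L10 p
  map_01 : ∀ p, L01 ((X + C c) * p) = (c - a) * L p
  map_01' : ∀ p, L01 ((X + C a) * p) = (c - a) * L11 p
  map_m' : ∀ p, (a - 1) * Lm p = L ((X + C (c - 1)) * p) - t * L (p.comp (X + C 1))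

theorem comp_sub_one_comp_add_one (p : ℂ[X]) : (p.comp (X + C (-1))).comp (X + C 1) = p := by
  rw [comp_assoc]
  simp

namespace ContiguityRelations

variable {a c t : ℂ} {L L01 L10 L11 Lm : ℂ[X] →ₗ[ℂ] ℂ}

theorem map_11' (H : ContiguityRelations a c t L L01 L10 L11 Lm) (p : ℂ[X]) :
    t * L11 p = L (X * p.comp (X + C (-1))) := by
  rw [H.map_11, comp_sub_one_comp_add_one]

/-- Pearson's equation for the moment functional of `φ_{0,0}`. -/
theorem pearson (H : ContiguityRelations a c t L L01 L10 L11 Lm) (p : ℂ[X]) :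
    L (X * (X + C (c - 1)) * p) = t * L ((X + C a) * p.comp (X + C 1)) := by
  have h1 := H.map_m' (X * p)
  rw [H.map_m] at h1
  have h2 : (X * p).comp (X + C 1) = X * p.comp (X + C 1) + p.comp (X + C 1) := by
    simp [add_mul]
  have h3 : (X + C (c - 1)) * (X * p) = X * (X + C (c - 1)) * p := by ring
  have h4 : (X + C a) * p.comp (X + C 1) = X * p.comp (X + C 1) + C a * p.comp (X + C 1) := by
    ring
  rw [h2, h3, map_add] at h1
  rw [h4, map_add, map_C_mul]
  linear_combination -h1

theorem pearson_comp (H : ContiguityRelations a c t L L01 L10 L11 Lm) (p q : ℂ[X]) :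
    L (X * (X + C (c - 1)) * p.comp (X + C (-1)) * q) =
      t * L (p * ((X + C a) * q.comp (X + C 1))) := by
  have h := H.pearson (p.comp (X + C (-1)) * q)
  rw [mul_comp, comp_sub_one_comp_add_one] at h
  rw [mul_assoc, h]
  congr 2
  ring

variable {n : ℕ} {P R : ℂ[X]}

/-- The first order difference equation satisfied by the orthogonal polynomials. -/
theorem difference_equation (H : ContiguityRelations a c t L L01 L10 L11 Lm)
    (h : OrthogonalPair L n P R) {k y : ℂ}
    (hk : R.coeff n * k = (X * R).coeff n - R.coeff n * P.coeff n + R.coeff n * (c - n - 1 - t))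
    (hy : y = t * (a + n) - L (P * X ^ (n + 1)) * R.coeff n) :
    X * (X + C (c - 1)) * R.comp (X + C (-1)) =
      C (R.coeff n) * (X + C k) * P + (C t * X + C y) * R := by
  set ρ := R.coeff n with hρ
  set D := X * (X + C (c - 1)) * R.comp (X + C (-1)) -
    (C ρ * (X + C k) * P + (C t * X + C y) * R) with hD
  have hmem : D ∈ degreeLT ℂ (n + 1) := by
    have m1 := X_mul_comp_X_add_C_sub_mem_degreeLT (-1) h.R_mem
    have m2 := X_mul_comp_X_add_C_sub_mem_degreeLT 0 h.R_mem
    have m3 := sub_leading_mem_degreeLT h.P_mem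
    rw [C_0, add_zero, comp_X] at m2
    rw [coeff_sub, coeff_X_pow, if_neg (by omega), sub_zero] at m3
    rw [← hρ] at m1 m2
    set f₁ := X * R.comp (X + C (-1)) - C ρ * X ^ (n + 1) -
      C ((X * R).coeff n + n * (-1) * ρ) * X ^ n with hf₁
    set f₂ := X * R - C ρ * X ^ (n + 1) - C ((X * R).coeff n + n * 0 * ρ) * X ^ n with hf₂
    set f₃ := P - X ^ (n + 1) - C (P.coeff n) * X ^ n with hf₃
    have e : D = (X + C (c - 1)) * f₁ - C ρ * ((X + C k) * f₃) - C t * f₂ - C y * R +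
        C ((c - 1) * ((X * R).coeff n - n * ρ) - ρ * k * P.coeff n - t * (X * R).coeff n) *
          X ^ n := by
      have hC : C ρ * C k = C ((X * R).coeff n) - C ρ * C (P.coeff n) +
          C ρ * (C c - C (n : ℂ) - 1 - C t) := by
        rw [← C_mul, hk]
        simp only [map_sub, map_add, map_mul, map_one]
      rw [hD, hf₁, hf₂, hf₃]
      simp only [map_sub, map_add, map_mul, map_one, map_neg, map_zero]
      linear_combination -X ^ (n + 1) * hC
    rw [e]
    refine Submodule.add_mem _ (Submodule.sub_mem _ (Submodule.sub_mem _ (Submodule.sub_mem _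
      ?_ ?_) ?_) ?_) ?_
    · exact mul_mem_degreeLT (natDegree_X_add_C _).le m1
    · exact C_mul_mem_degreeLT _ (mul_mem_degreeLT (by simp) m3)
    · exact degreeLT_le_succ (C_mul_mem_degreeLT _ m2)
    · exact C_mul_mem_degreeLT _ h.R_mem
    · exact C_mul_mem_degreeLT _ (X_pow_mem_degreeLT n.lt_succ_self)
  refine sub_eq_zero.1 (eq_zero_of_hankelDet_ne_zero h.hankelDet_ne_zero hmem ?_)
  intro i hi
  have e1 : D * X ^ i = X * (X + C (c - 1)) * R.comp (X + C (-1)) * X ^ i -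
      (C ρ * (P * X ^ (i + 1)) + C (ρ * k) * (P * X ^ i) + C t * (R * X ^ (i + 1)) +
        C y * (R * X ^ i)) := by
    rw [hD, C_mul]
    ring
  have hg : (X + C a) * (X + C 1) ^ i - X ^ (i + 1) - C (a + i) * X ^ i ∈ degreeLT ℂ i := by
    have m := X_mul_X_add_C_pow_sub_mem_degreeLT 1 i
    have m2 : (X + C (1 : ℂ)) ^ i - X ^ i ∈ degreeLT ℂ i := by
      have m3 := comp_X_add_C_mem_degreeLT (1 : ℂ) (X_pow_mem_degreeLT i.lt_succ_self)
      have m4 := sub_leading_mem_degreeLT m3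
      rw [X_pow_comp] at m4
      have : ((X + C (1 : ℂ)) ^ i).coeff i = 1 := by
        have := (monic_X_add_C (1 : ℂ)).pow i
        rw [Monic, leadingCoeff, natDegree_pow, natDegree_X_add_C, mul_one] at this
        exact this
      rwa [this, C_1, one_mul] at m4
    have e : (X + C a) * (X + C (1 : ℂ)) ^ i - X ^ (i + 1) - C (a + i) * X ^ i =
        (X * (X + C (1 : ℂ)) ^ i - X ^ (i + 1) - C (i * (1 : ℂ)) * X ^ i) +
          C a * ((X + C (1 : ℂ)) ^ i - X ^ i) := by
      simp only [map_add, map_mul, map_one]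
      ring
    rw [e]
    exact Submodule.add_mem _ m (C_mul_mem_degreeLT _ m2)
  have e2 : R * ((X + C a) * (X ^ i : ℂ[X]).comp (X + C 1)) = R * X ^ (i + 1) +
      C (a + i) * (R * X ^ i) +
      R * ((X + C a) * (X + C 1) ^ i - X ^ (i + 1) - C (a + i) * X ^ i) := by
    rw [X_pow_comp]
    ring
  have hg' : L (R * ((X + C a) * (X + C 1) ^ i - X ^ (i + 1) - C (a + i) * X ^ i)) = 0 :=
    h.map_R_mul (degreeLT_mono (by omega) hg)
  rw [e1, map_sub, H.pearson_comp, e2]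
  simp only [map_add L, map_C_mul, hg', h.P_orth i hi]
  rcases Nat.lt_succ_iff_lt_or_eq.1 hi with hin | rfl
  · rw [h.P_orth (i + 1) (by omega), h.R_orth i hin]
    ring
  · rw [h.R_norm, hy]
    ring

theorem eval_zero (H : ContiguityRelations a c t L L01 L10 L11 Lm)
    (h : OrthogonalPair L n P R) {k y : ℂ}
    (hk : R.coeff n * k = (X * R).coeff n - R.coeff n * P.coeff n + R.coeff n * (c - n - 1 - t))
    (hy : y = t * (a + n) - L (P * X ^ (n + 1)) * R.coeff n) :
    R.coeff n * k * P.eval 0 + y * R.eval 0 = 0 := by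
  have := congrArg (eval 0) (H.difference_equation h hk hy)
  simp only [eval_mul, eval_add, eval_X, eval_C] at this
  linear_combination -this

theorem eval_one_sub (H : ContiguityRelations a c t L L01 L10 L11 Lm)
    (h : OrthogonalPair L n P R) {k y : ℂ}
    (hk : R.coeff n * k = (X * R).coeff n - R.coeff n * P.coeff n + R.coeff n * (c - n - 1 - t))
    (hy : y = t * (a + n) - L (P * X ^ (n + 1)) * R.coeff n) :
    R.coeff n * (1 - c + k) * P.eval (1 - c) + (t * (1 - c) + y) * R.eval (1 - c) = 0 := by
  have := congrArg (eval (1 - c)) (H.difference_equation h hk hy)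
  simp only [eval_mul, eval_add, eval_X, eval_C] at this
  linear_combination -this

theorem map_m_comp (H : ContiguityRelations a c t L L01 L10 L11 Lm) (p : ℂ[X]) :
    (a - 1) * Lm (p.comp (X + C (-1))) = L ((X + C (c - 1)) * p.comp (X + C (-1))) - t * L p := by
  rw [H.map_m', comp_sub_one_comp_add_one]

theorem map_m_mul_eval_zero (H : ContiguityRelations a c t L L01 L10 L11 Lm)
    (h : OrthogonalPair L n P R) {k y : ℂ}
    (hk : R.coeff n * k = (X * R).coeff n - R.coeff n * P.coeff n + R.coeff n * (c - n - 1 - t))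
    (hy : y = t * (a + n) - L (P * X ^ (n + 1)) * R.coeff n) :
    (a - 1) * Lm (R.comp (X + C (-1))) * R.eval 0 = R.coeff n * k ∧
      (1 - a) * Lm (R.comp (X + C (-1))) * P.eval 0 = y := by
  have hB := H.difference_equation h hk hy
  have h0 := H.eval_zero h hk hy
  obtain ⟨E, hE, hX, -, hLE⟩ := h.exists_kernel
  have hP1 : L P = 0 := by simpa using h.P_orth 0 n.succ_pos
  set ρ := R.coeff n
  have h0' : C ρ * C k * C (P.eval 0) + C y * C (R.eval 0) = 0 := by
    rw [← C_mul, ← C_mul, ← C_mul, ← C_add, h0, C_0]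
  set W := (X + C (c - 1)) * R.comp (X + C (-1)) - C t * R - C ρ * P with hW
  have hXW : X * W = C ρ * C k * P + C y * R := by
    rw [hW]
    linear_combination hB
  have hLW : (a - 1) * Lm (R.comp (X + C (-1))) = L W := by
    rw [H.map_m_comp, hW, map_sub L, map_sub L, map_C_mul, map_C_mul, hP1]
    ring
  rw [show (1 - a) * Lm (R.comp (X + C (-1))) = -L W by rw [← hLW]; ring, hLW]
  have k1 : C (R.eval 0) * W = C (ρ * k) * E := by
    refine mul_left_cancel₀ X_ne_zero ?_
    rw [C_mul]
    linear_combination C (R.eval 0) * hXW - C ρ * C k * hX + R * h0'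
  have k2 : C (P.eval 0) * W = C (-y) * E := by
    refine mul_left_cancel₀ X_ne_zero ?_
    rw [C_neg]
    linear_combination C (P.eval 0) * hXW + C y * hX + P * h0'
  have k3 := congrArg L k1
  have k4 := congrArg L k2
  rw [map_C_mul, map_C_mul, hLE] at k3 k4
  constructor
  · linear_combination k3
  · linear_combination -k4

theorem kernel_eval (H : ContiguityRelations a c t L L01 L10 L11 Lm)
    (h : OrthogonalPair L n P R) {E : ℂ[X]} (hE : E ∈ degreeLT ℂ (n + 1))
    (hX : X * E = C (R.eval 0) * P - C (P.eval 0) * R) (hLE : L E = 1) :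
    E.eval (1 - c) = (-t) ^ n * R.eval (-a) := by
  have hρ := h.coeff_ne_zero
  have hρτ := h.coeff_mul
  set ρ := R.coeff n with hρdef
  have d1 := det_map_X_sub_C_mul_X_sub_C_mul 0 (1 - c) hE hLE (fun i hi => by
    have : (X - C 0) * X ^ i * E = C (R.eval 0) * (P * X ^ i) - C (P.eval 0) * (R * X ^ i) := by
      rw [C_0, sub_zero]
      linear_combination X ^ i * hX
    rw [this, map_sub, map_C_mul, map_C_mul, h.P_orth i (by omega), h.R_orth i hi]
    ring)
  let L' : ℂ[X] →ₗ[ℂ] ℂ := L ∘ₗ LinearMap.mulLeft ℂ (X + C a)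
  have hL' : ∀ p, L' p = L ((X + C a) * p) := fun p => rfl
  have d2 : (Matrix.of fun i j : Fin n =>
      L ((X - C 0) * X ^ (i : ℕ) * ((X - C (1 - c)) * X ^ (j : ℕ)))) =
      t • Matrix.of fun i j : Fin n => L' ((X + C 1) ^ (i : ℕ) * (X + C 1) ^ (j : ℕ)) := by
    ext i j
    have := H.pearson (X ^ (i : ℕ) * X ^ (j : ℕ))
    rw [Matrix.smul_apply, of_apply, of_apply, smul_eq_mul, hL']
    rw [mul_comp, X_pow_comp, X_pow_comp] at this
    rw [← this]
    congr 1
    simp only [map_sub, map_one, map_zero]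
    ring
  rw [d2, det_smul, Fintype.card_fin, det_map_mul_X_add_C_pow] at d1
  have hQ : C ρ⁻¹ * R - X ^ n ∈ degreeLT ℂ n := by
    have := C_mul_mem_degreeLT ρ⁻¹ (sub_leading_mem_degreeLT h.R_mem)
    rwa [mul_sub, ← mul_assoc, ← C_mul, ← hρdef, inv_mul_cancel₀ hρ, C_1, one_mul] at this
  have d3 := det_map_X_sub_C_mul hQ (fun i hi => by
    rw [mul_assoc, map_C_mul, h.R_orth i hi, mul_zero]) (-a)
  have d4 : hankelDet L' n = det (Matrix.of fun i j : Fin n =>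
      L (X ^ (i : ℕ) * ((X - C (-a)) * X ^ (j : ℕ)))) := by
    rw [hankelDet]
    congr 1
    ext i j
    rw [of_apply, of_apply, hL']
    congr 1
    rw [C_neg]
    ring
  rw [d4, d3, eval_mul, eval_C, ← hρτ] at d1
  refine mul_right_cancel₀ h.hankelDet_ne_zero (d1.symm.trans ?_)
  rw [neg_pow t]
  field_simp

/-- The denominator of the Painlevé solution. -/
theorem eval_zero_combination (H : ContiguityRelations a c t L L01 L10 L11 Lm)
    (h : OrthogonalPair L n P R) :
    R.coeff n * P.eval 0 + t * R.eval 0 = t * (-t) ^ n * R.eval (-a) * L01 R := by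
  obtain ⟨E, hE, hX, hEn, hLE⟩ := h.exists_kernel
  have hρ := h.coeff_ne_zero
  rw [mul_assoc t, ← H.kernel_eval h hE hX hLE]
  set ρ := R.coeff n with hρdef
  have hR' := comp_X_add_C_mem_degreeLT (-1) h.R_mem
  have hR'n : (R.comp (X + C (-1))).coeff n = ρ := by
    have m := X_mul_comp_X_add_C_sub_mem_degreeLT (-1) h.R_mem
    have := mem_degreeLT_iff_coeff.1 m (n + 1) (by omega)
    rw [coeff_sub, coeff_sub, coeff_X_mul, coeff_C_mul, coeff_C_mul, coeff_X_pow, coeff_X_pow,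
      if_pos rfl, if_neg (by omega)] at this
    linear_combination this
  have hE' := comp_X_add_C_mem_degreeLT 1 hE
  have hE'n : (E.comp (X + C 1)).coeff n = R.eval 0 := by
    have m := X_mul_comp_X_add_C_sub_mem_degreeLT 1 hE
    have := mem_degreeLT_iff_coeff.1 m (n + 1) (by omega)
    rw [coeff_sub, coeff_sub, coeff_X_mul, coeff_C_mul, coeff_C_mul, coeff_X_pow, coeff_X_pow,
      if_pos rfl, if_neg (by omega), hEn] at this
    linear_combination this
  set Z := C (R.eval 0) * ((X + C c) * R) - C ρ * ((X + C a) * E.comp (X + C 1)) with hZ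
  have hZm : Z ∈ degreeLT ℂ (n + 1) := by
    have m1 := sub_leading_mem_degreeLT h.R_mem
    have m2 := sub_leading_mem_degreeLT hE'
    rw [hE'n] at m2
    have : Z = C (R.eval 0) * ((X + C c) * (R - C ρ * X ^ n)) -
        C ρ * ((X + C a) * (E.comp (X + C 1) - C (R.eval 0) * X ^ n)) +
        C (R.eval 0 * ρ * (c - a)) * X ^ n := by
      rw [hZ]
      simp only [C_mul, C_sub]
      ring
    rw [this]
    exact Submodule.add_mem _ (Submodule.sub_mem _
      (C_mul_mem_degreeLT _ (mul_mem_degreeLT (by simp) m1))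
      (C_mul_mem_degreeLT _ (mul_mem_degreeLT (by simp) m2)))
      (C_mul_mem_degreeLT _ (X_pow_mem_degreeLT n.lt_succ_self))
  have hZc : Z.eval (-c) = ρ * (c - a) * E.eval (1 - c) := by
    rw [hZ]
    simp only [eval_sub, eval_mul, eval_add, eval_X, eval_C, eval_comp]
    rw [show -c + 1 = 1 - c by ring]
    ring
  obtain ⟨Z', hZ', eZ⟩ := exists_eq_C_add_mul (-c) hZm
  have k1 : L01 (Z * R) = Z.eval (-c) * L01 R := by
    have : Z * R = C (Z.eval (-c)) * R + (X + C c) * (R * Z') := by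
      conv_lhs => rw [eZ]
      rw [C_neg]
      ring
    rw [this, map_add, map_C_mul, H.map_01, h.map_R_mul hZ']
    ring
  have k2 : t * L01 (Z * R) = (c - a) * ρ * (ρ * P.eval 0 + t * R.eval 0) := by
    have e1 : Z * R = C (R.eval 0) * ((X + C c) * (R * R)) -
        C ρ * ((X + C a) * (E.comp (X + C 1) * R)) := by
      rw [hZ]
      ring
    have e2 : X * (E.comp (X + C 1) * R).comp (X + C (-1)) =
        C (R.eval 0) * (P * R.comp (X + C (-1))) - C (P.eval 0) * (R * R.comp (X + C (-1))) := by
      have : (E.comp (X + C 1)).comp (X + C (-1)) = E := by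
        rw [comp_assoc]
        simp
      rw [mul_comp, this]
      linear_combination R.comp (X + C (-1)) * hX
    have e3 := H.map_11' (E.comp (X + C 1) * R)
    rw [e2, map_sub, map_C_mul, map_C_mul, h.map_P_mul hR', h.map_R_mul_eq_coeff hR',
      hR'n] at e3
    rw [e1, map_sub, map_C_mul, map_C_mul, H.map_01, H.map_01', h.map_R_mul_eq_coeff h.R_mem]
    linear_combination (-ρ * (c - a)) * e3
  refine mul_left_cancel₀ (mul_ne_zero H.ca_ne_zero hρ) ?_
  rw [← k2, k1, hZc]
  ring

theorem hankelDet_11 (H : ContiguityRelations a c t L L01 L10 L11 Lm)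
    (h : OrthogonalPair L n P R) :
    t ^ (n + 1) * hankelDet L11 (n + 1) = (-1) ^ (n + 1) * P.eval 0 * hankelDet L (n + 1) := by
  have d := det_map_X_sub_C_mul h.P_mem h.P_orth 0
  rw [← d, ← det_map_mul_X_add_C_pow L11 1]
  nth_rewrite 1 [← Fintype.card_fin (n + 1)]
  rw [← det_smul]
  congr 1
  ext i j
  rw [Matrix.smul_apply, of_apply, of_apply, smul_eq_mul]
  have := H.map_11 (X ^ (i : ℕ) * X ^ (j : ℕ))
  rw [mul_comp, X_pow_comp, X_pow_comp] at this
  rw [← this, C_0]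
  congr 1
  ring

theorem hankelDet_10 (H : ContiguityRelations a c t L L01 L10 L11 Lm)
    (h : OrthogonalPair L n P R) :
    (c - a - 1) ^ n * hankelDet L10 n = (-1) ^ n * R.eval (-a) * hankelDet L (n + 1) := by
  have hρ := h.coeff_ne_zero
  have hρτ := h.coeff_mul
  set ρ := R.coeff n with hρdef
  have hQ : C ρ⁻¹ * R - X ^ n ∈ degreeLT ℂ n := by
    have := C_mul_mem_degreeLT ρ⁻¹ (sub_leading_mem_degreeLT h.R_mem)
    rwa [mul_sub, ← mul_assoc, ← C_mul, ← hρdef, inv_mul_cancel₀ hρ, C_1, one_mul] at this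
  have d3 := det_map_X_sub_C_mul hQ (fun i hi => by
    rw [mul_assoc, map_C_mul, h.R_orth i hi, mul_zero]) (-a)
  have d4 : (c - a - 1) ^ n * hankelDet L10 n = det (Matrix.of fun i j : Fin n =>
      L (X ^ (i : ℕ) * ((X - C (-a)) * X ^ (j : ℕ)))) := by
    rw [hankelDet]
    nth_rewrite 1 [← Fintype.card_fin n]
    rw [← det_smul]
    congr 1
    ext i j
    rw [Matrix.smul_apply, of_apply, of_apply, smul_eq_mul, ← H.map_10]
    congr 1
    rw [C_neg]
    ring
  rw [d4, d3, eval_mul, eval_C, ← hρτ]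
  field_simp

theorem hankelDet_01 (H : ContiguityRelations a c t L L01 L10 L11 Lm)
    (h : OrthogonalPair L n P R) :
    hankelDet L01 (n + 1) = (-1) ^ n * (c - a) ^ n * hankelDet L (n + 1) * L01 R := by
  have := hankelDet_mul_coeff (-c) (c - a) h.R_mem h.R_orth (M := L01) (fun f => by
    rw [← H.map_01, C_neg, sub_neg_eq_add])
  rw [← h.coeff_mul] at this
  refine mul_right_cancel₀ h.coeff_ne_zero (this.trans ?_)
  ring

theorem hankelDet_m (H : ContiguityRelations a c t L L01 L10 L11 Lm)
    (h : OrthogonalPair L n P R) :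
    hankelDet Lm (n + 1) =
      (-1) ^ n * t ^ n * hankelDet L (n + 1) * Lm (R.comp (X + C (-1))) := by
  let N : ℂ[X] →ₗ[ℂ] ℂ := Lm ∘ₗ taylor (-1)
  have hN : ∀ p, N p = Lm (p.comp (X + C (-1))) := fun p => rfl
  have d := hankelDet_mul_coeff (-1) t h.R_mem h.R_orth (M := N) (fun f => by
    have : ((X - C (-1)) * f).comp (X + C (-1)) = X * f.comp (X + C (-1)) := by
      rw [mul_comp, C_neg, sub_neg_eq_add, add_comp, X_comp, C_comp]
      ring
    rw [hN, this, H.map_m, comp_sub_one_comp_add_one])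
  have e : hankelDet N (n + 1) = hankelDet Lm (n + 1) := by
    rw [← det_map_mul_X_add_C_pow Lm (-1), hankelDet]
    congr 1
    ext i j
    rw [of_apply, of_apply, hN, mul_comp, X_pow_comp, X_pow_comp]
  rw [e, ← h.coeff_mul, hN] at d
  refine mul_right_cancel₀ h.coeff_ne_zero (d.trans ?_)
  ring

end ContiguityRelations

theorem derivative_eq_zero_of_eventually {f : ℝ → ℂ} {f' x : ℂ} {t : ℝ} (hf : HasDerivAt f f' t)
    (h : ∀ᶠ s in 𝓝 t, f s = x) : f' = 0 :=
  hf.unique ((hasDerivAt_const t x).congr_of_eventuallyEq h)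

/-- The compatibility condition obtained by differentiating the difference equation at a point
`ξ`. -/
theorem compatibility {b α : ℂ} {ρ k y P R : ℝ → ℂ} {K Y ξ : ℂ} {t : ℝ} (ht : (t : ℂ) ≠ 0)
    (hρ0 : ρ t ≠ 0)
    (dρ : HasDerivAt ρ (-b * ρ t / t) t) (dk : HasDerivAt k (K / t) t)
    (dy : HasDerivAt y (Y / t) t)
    (dP : HasDerivAt P (-(α / ρ t) * R t / t) t)
    (dR : HasDerivAt R ((ρ t * P t - ξ * R t) / t) t)
    (h : ∀ᶠ s in 𝓝 t, ρ s * (ξ + k s) * P s + ((s : ℂ) * ξ + y s) * R s = 0)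
    (hPR : P t = 0 → R t ≠ 0) :
    (t * ξ + y t) * (-b * (ξ + k t) + K + t * ξ + y t) +
      (ξ + k t) * (α * (ξ + k t) - t * ξ - Y + ξ * (t * ξ + y t)) = 0 := by
  have ds : HasDerivAt (fun s : ℝ => (s : ℂ)) 1 t := Complex.ofRealCLM.hasDerivAt
  have d := derivative_eq_zero_of_eventually
    (((dρ.mul (dk.const_add ξ)).mul dP).add (((ds.mul_const ξ).add dy).mul dR)) h
  have h0 := h.self_of_nhds
  simp only [Pi.mul_apply, Pi.add_apply] at d
  field_simp at d
  set A₁ := ρ t * (ξ + k t)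
  set B₁ := (t : ℂ) * ξ + y t
  have d' : ρ t * (-b * (ξ + k t) + K + t * ξ + y t) * P t +
      (-α * (ξ + k t) + t * ξ + Y - ξ * (t * ξ + y t)) * R t = 0 := by
    linear_combination d
  have e1 : ((t * ξ + y t) * (-b * (ξ + k t) + K + t * ξ + y t) +
      (ξ + k t) * (α * (ξ + k t) - t * ξ - Y + ξ * (t * ξ + y t))) * ρ t * P t = 0 := by
    linear_combination (t * ξ + y t) * d' -
      (-α * (ξ + k t) + t * ξ + Y - ξ * (t * ξ + y t)) * h0
  have e2 : ((t * ξ + y t) * (-b * (ξ + k t) + K + t * ξ + y t) +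
      (ξ + k t) * (α * (ξ + k t) - t * ξ - Y + ξ * (t * ξ + y t))) * ρ t * R t = 0 := by
    linear_combination ρ t * (-b * (ξ + k t) + K + t * ξ + y t) * h0 - ρ t * (ξ + k t) * d'
  by_cases hP : P t = 0
  · simpa [hPR hP, hρ0] using e2
  · simpa [hP, hρ0] using e1

/-- The rational reduction of the Hamiltonian system to the recurrence data of the orthogonal
polynomials. -/
theorem hamiltonian_of_recurrence {a c : ℂ} {n : ℕ} (ha : a ≠ 1) (hc : c ≠ 1)
    {ρ k y P₀ R₀ P₁ R₁ v q p : ℝ → ℂ}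
    {K Y w : ℂ} {t : ℝ} (ht : (t : ℂ) ≠ 0) (hρ0 : ρ t ≠ 0)
    (dρ : HasDerivAt ρ (-(k t - c + n + 1 + t) * ρ t / t) t) (dk : HasDerivAt k (K / t) t)
    (dy : HasDerivAt y (Y / t) t)
    (dP₀ : HasDerivAt P₀ (-((t * (a + n) - y t) / ρ t) * R₀ t / t) t)
    (dR₀ : HasDerivAt R₀ ((ρ t * P₀ t) / t) t)
    (dP₁ : HasDerivAt P₁ (-((t * (a + n) - y t) / ρ t) * R₁ t / t) t)
    (dR₁ : HasDerivAt R₁ ((ρ t * P₁ t - (1 - c) * R₁ t) / t) t)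
    (dv : HasDerivAt v ((ρ t * w + v t) / t) t)
    (h₀ : ∀ᶠ s in 𝓝 t, ρ s * k s * P₀ s + y s * R₀ s = 0)
    (h₁ : ∀ᶠ s in 𝓝 t, ρ s * (1 - c + k s) * P₁ s + ((s : ℂ) * (1 - c) + y s) * R₁ s = 0)
    (hv₀ : ∀ᶠ s in 𝓝 t, (a - 1) * v s * R₀ s = ρ s * k s)
    (hv₁ : ∀ᶠ s in 𝓝 t, (1 - a) * v s * P₀ s = y s)
    (hPR₀ : P₀ t = 0 → R₀ t ≠ 0) (hPR₁ : P₁ t = 0 → R₁ t ≠ 0)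
    (hT : ρ t * P₀ t + t * R₀ t ≠ 0)
    (hq : ∀ᶠ s in 𝓝 t, q s = ρ s * P₀ s / (ρ s * P₀ s + s * R₀ s))
    (hp : ∀ᶠ s in 𝓝 t, p s = (1 - a) * (ρ s * P₀ s + s * R₀ s) * v s / (s * ρ s)) :
    (t : ℂ) * deriv q t =
        2 * q t * (q t - 1) ^ 2 * p t
          - ((a + n) * (q t - 1) ^ 2 + (c - n - 2) * q t * (q t - 1) + (t : ℂ) * q t) ∧
      (t : ℂ) * deriv p t =
        -(((q t - 1) ^ 2 + 2 * q t * (q t - 1)) * (p t) ^ 2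
            - (2 * (a + n) * (q t - 1) + (c - n - 2) * (2 * q t - 1) + (t : ℂ)) * p t
            + ((1 / 4) * ((a + n) + (c - n - 2)) ^ 2 - (1 / 4) * (c - a) ^ 2)) := by
  have ds : HasDerivAt (fun s : ℝ => (s : ℂ)) 1 t := Complex.ofRealCLM.hasDerivAt
  have B₀ := compatibility (ξ := 0) ht hρ0 dρ dk dy dP₀ (by simpa using dR₀)
    (by simpa using h₀) hPR₀
  have B₁ := compatibility ht hρ0 dρ dk dy dP₁ dR₁ h₁ hPR₁
  have hc' : (1 - c : ℂ) ≠ 0 := sub_ne_zero.2 hc.symm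
  have hβ : t * (K + y t - (1 + (k t - c + n + 1 + t)) * k t) + y t * (c - n - 2) +
      2 * (t * (a + n) - y t) * k t + y t - Y = t * (c - 1) * (a - 1) := by
    refine mul_left_cancel₀ hc' ?_
    linear_combination B₁ - B₀
  have e₀ := derivative_eq_zero_of_eventually (x := 0)
    (((dv.const_mul (a - 1)).mul dR₀).sub (dρ.mul dk))
    (hv₀.mono fun s hs => sub_eq_zero.2 hs)
  have e₁ := derivative_eq_zero_of_eventually (x := 0)
    (((dv.const_mul (1 - a)).mul dP₀).sub dy) (hv₁.mono fun s hs => sub_eq_zero.2 hs)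
  have i₀ := hv₀.self_of_nhds
  have i₁ := hv₁.self_of_nhds
  have qt := hq.self_of_nhds
  have pt := hp.self_of_nhds
  have dT := (dρ.mul dP₀).add (ds.mul dR₀)
  have dq := (((dρ.mul dP₀).div dT hT).congr_of_eventuallyEq hq).deriv
  have dp := ((((dT.const_mul (1 - a)).mul dv).div (ds.mul dρ) (mul_ne_zero ht hρ0)
    ).congr_of_eventuallyEq hp).deriv
  simp only [Pi.mul_apply, Pi.add_apply] at e₀ e₁ dq dp hT
  set T := ρ t * P₀ t + t * R₀ t with hTdef
  have w₀ : (a - 1) * w * R₀ t = K + y t - (1 + (k t - c + n + 1 + t)) * k t := by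
    refine mul_left_cancel₀ hρ0 ?_
    field_simp at e₀
    linear_combination e₀ - i₀ + ρ t * i₁
  have w₁ : (1 - a) * ρ t * w * P₀ t = Y - y t - (t * (a + n) - y t) * k t := by
    field_simp at e₁
    refine mul_left_cancel₀ hρ0 ?_
    linear_combination e₁ - (t * (a + n) - y t) * i₀ - ρ t * i₁
  have J : (1 - a) * (ρ t * w + (k t + n + 2 - c) * v t) * T =
      -t * ρ t * (k t + 1 - a) * (k t + 1 - c) := by
    rw [hTdef]
    linear_combination ρ t * w₁ - t * ρ t * w₀ + (k t + n + 2 - c) * (ρ t * i₁ - t * i₀) -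
      ρ t * hβ
  have hqp : q t * p t = y t / t := by
    rw [qt, pt, ← i₁]
    field_simp
  have hkp : (q t - 1) * p t = k t := by
    rw [qt, pt]
    refine mul_left_cancel₀ hρ0 ?_
    rw [← i₀]
    field_simp
    rw [hTdef]
    ring
  have ha' : (1 - a : ℂ) ≠ 0 := sub_ne_zero.2 ha.symm
  have sP : P₀ t = q t * T / ρ t := by
    rw [qt]
    field_simp
  have sR : R₀ t = -(q t - 1) * T / t := by
    rw [qt]
    field_simp
    rw [hTdef]
    ring
  have sv : v t = p t * t * ρ t / ((1 - a) * T) := by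
    rw [pt]
    field_simp
  have sy : y t = t * (q t * p t) := by
    rw [hqp]
    field_simp
  have sw : w = -t * ((q t - 1) * p t + 1 - a) * ((q t - 1) * p t + 1 - c) / ((1 - a) * T) -
      ((q t - 1) * p t + n + 2 - c) * (p t * t / ((1 - a) * T)) := by
    rw [← hkp, sv] at J
    field_simp
    field_simp at J
    linear_combination J
  clear_value T
  rw [sP, sR, ← hkp, sy] at dq dp
  rw [sv, sw] at dp
  constructor
  · rw [dq]
    field_simp
    ring
  · rw [dp]
    field_simp
    ring

/-- The Hankel matrix of order `m` of a moment functional. -/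
noncomputable def hankelMatrix (L : ℂ[X] →ₗ[ℂ] ℂ) (m : ℕ) : Matrix (Fin m) (Fin m) ℂ :=
  Matrix.of fun i j => L (X ^ (i : ℕ) * X ^ (j : ℕ))

/-- The polynomial of degree less than `m` with prescribed moments. -/
noncomputable def momentPoly (L : ℂ[X] →ₗ[ℂ] ℂ) (m : ℕ) (v : Fin m → ℂ) : ℂ[X] :=
  ∑ i : Fin m, C (((hankelMatrix L m)⁻¹ *ᵥ v) i) * X ^ (i : ℕ)

theorem momentPoly_mem (L : ℂ[X] →ₗ[ℂ] ℂ) (m : ℕ) (v : Fin m → ℂ) :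
    momentPoly L m v ∈ degreeLT ℂ m :=
  Submodule.sum_mem _ fun i _ => C_mul_mem_degreeLT _ (X_pow_mem_degreeLT i.2)

theorem momentPoly_coeff (L : ℂ[X] →ₗ[ℂ] ℂ) (m : ℕ) (v : Fin m → ℂ) (k : ℕ) :
    (momentPoly L m v).coeff k =
      ∑ i : Fin m, if k = i then ((hankelMatrix L m)⁻¹ *ᵥ v) i else 0 := by
  simp [momentPoly, coeff_X_pow]

theorem map_momentPoly_mul {L : ℂ[X] →ₗ[ℂ] ℂ} {m : ℕ} (hL : hankelDet L m ≠ 0) (v : Fin m → ℂ)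
    (j : Fin m) : L (momentPoly L m v * X ^ (j : ℕ)) = v j := by
  have hu : IsUnit (hankelMatrix L m).det := isUnit_iff_ne_zero.2 hL
  have h1 : hankelMatrix L m *ᵥ ((hankelMatrix L m)⁻¹ *ᵥ v) = v := by
    rw [mulVec_mulVec, mul_nonsing_inv _ hu, one_mulVec]
  rw [← congrFun h1 j, mulVec_apply_eq_sum, momentPoly, Finset.sum_mul, map_sum]
  refine Finset.sum_congr rfl fun i _ => ?_
  rw [mul_assoc, map_C_mul, hankelMatrix, of_apply, mul_comm, mul_comm (X ^ (i : ℕ))]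

/-- The normalised orthogonal polynomial of degree `n`. -/
noncomputable def normalizedPoly (L : ℂ[X] →ₗ[ℂ] ℂ) (n : ℕ) : ℂ[X] :=
  momentPoly L (n + 1) fun j => if (j : ℕ) = n then 1 else 0

/-- The monic orthogonal polynomial of degree `m`. -/
noncomputable def monicPoly (L : ℂ[X] →ₗ[ℂ] ℂ) (m : ℕ) : ℂ[X] :=
  X ^ m - momentPoly L m fun j => L (X ^ m * X ^ (j : ℕ))

theorem orthogonalPair {L : ℂ[X] →ₗ[ℂ] ℂ} {n : ℕ} (h : hankelDet L (n + 1) ≠ 0)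
    (h' : hankelDet L n ≠ 0) :
    OrthogonalPair L n (monicPoly L (n + 1)) (normalizedPoly L n) where
  hankelDet_ne_zero := h
  hankelDet_ne_zero' := h'
  P_mem := by
    rw [monicPoly, sub_sub_cancel_left]
    exact Submodule.neg_mem _ (momentPoly_mem _ _ _)
  P_orth := fun i hi => by
    rw [monicPoly, sub_mul, map_sub, map_momentPoly_mul h _ ⟨i, hi⟩, sub_self]
  R_mem := momentPoly_mem _ _ _
  R_orth := fun i hi => by
    rw [normalizedPoly, map_momentPoly_mul h _ ⟨i, by omega⟩]
    exact if_neg (by simp; omega)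
  R_norm := by
    rw [normalizedPoly, map_momentPoly_mul h _ ⟨n, by omega⟩]
    simp

theorem differentiableAt_det {m : ℕ} {A : ℝ → Matrix (Fin m) (Fin m) ℂ} {t : ℝ}
    (hA : ∀ i j, DifferentiableAt ℝ (fun s => A s i j) t) :
    DifferentiableAt ℝ (fun s => (A s).det) t := by
  simp only [det_apply]
  refine DifferentiableAt.fun_sum fun σ _ => DifferentiableAt.const_smul ?_ _
  exact DifferentiableAt.fun_finsetProd fun i _ => hA _ _

theorem differentiableAt_inv_mulVec {m : ℕ} {A : ℝ → Matrix (Fin m) (Fin m) ℂ}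
    {v : ℝ → Fin m → ℂ} {t : ℝ} (hA : ∀ i j, DifferentiableAt ℝ (fun s => A s i j) t)
    (hv : ∀ i, DifferentiableAt ℝ (fun s => v s i) t) (h : (A t).det ≠ 0) (i : Fin m) :
    DifferentiableAt ℝ (fun s => ((A s)⁻¹ *ᵥ v s) i) t := by
  simp only [mulVec_apply_eq_sum, inv_def, Ring.inverse_eq_inv', Matrix.smul_apply, smul_eq_mul,
    adjugate_apply]
  refine DifferentiableAt.fun_sum fun j _ => ((differentiableAt_det hA).inv h).mul ?_ |>.mul (hv j)
  refine differentiableAt_det fun k l => ?_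
  by_cases hk : k = j
  · subst hk
    simp
  · simpa [updateRow_ne hk] using hA k l

/-- Coefficientwise differentiability of a family of polynomials of bounded degree. -/
structure HasPolyDerivAt (m : ℕ) (F : ℝ → ℂ[X]) (F' : ℂ[X]) (t : ℝ) : Prop where
  mem : ∀ s, F s ∈ degreeLT ℂ m
  mem' : F' ∈ degreeLT ℂ m
  coeff : ∀ k, HasDerivAt (fun s => (F s).coeff k) (F'.coeff k) t

/-- Pointwise differentiability of a family of functionals. -/
def HasFunctionalDerivAt (ℓ : ℝ → ℂ[X] →ₗ[ℂ] ℂ) (ℓ' : ℂ[X] →ₗ[ℂ] ℂ) (t : ℝ) : Prop :=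
  ∀ p, HasDerivAt (fun s => ℓ s p) (ℓ' p) t

theorem HasPolyDerivAt.functional {m : ℕ} {F : ℝ → ℂ[X]} {F' : ℂ[X]} {t : ℝ}
    (hF : HasPolyDerivAt m F F' t) {ℓ : ℝ → ℂ[X] →ₗ[ℂ] ℂ} {ℓ' : ℂ[X] →ₗ[ℂ] ℂ}
    (hℓ : HasFunctionalDerivAt ℓ ℓ' t) :
    HasDerivAt (fun s => ℓ s (F s)) (ℓ' (F t) + ℓ t F') t := by
  have e : ∀ (L : ℂ[X] →ₗ[ℂ] ℂ) (f : ℂ[X]), f ∈ degreeLT ℂ m →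
      L f = ∑ k : Fin m, f.coeff k * L (X ^ (k : ℕ)) := by
    intro L f hf
    conv_lhs => rw [eq_sum_of_mem_degreeLT hf]
    simp
  have h1 := HasDerivAt.fun_sum (u := Finset.univ) fun (k : Fin m) _ =>
    (hF.coeff k).mul (hℓ (X ^ (k : ℕ)))
  have h2 : (fun s => ℓ s (F s)) = fun s => ∑ k : Fin m, (F s).coeff k * ℓ s (X ^ (k : ℕ)) :=
    funext fun s => e (ℓ s) (F s) (hF.mem s)
  rw [h2, e _ _ (hF.mem t), e _ _ hF.mem', ← Finset.sum_add_distrib]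
  refine h1.congr_deriv (Finset.sum_congr rfl fun k _ => ?_)
  ring

theorem HasPolyDerivAt.eval {m : ℕ} {F : ℝ → ℂ[X]} {F' : ℂ[X]} {t : ℝ}
    (hF : HasPolyDerivAt m F F' t) (ξ : ℂ) :
    HasDerivAt (fun s => (F s).eval ξ) (F'.eval ξ) t := by
  have h := hF.functional (ℓ := fun _ => Polynomial.leval ξ) (ℓ' := 0) fun p => by
    simpa using hasDerivAt_const t _
  simpa using h

theorem hasPolyDerivAt_of_differentiableAt {m : ℕ} {F : ℝ → ℂ[X]} {t : ℝ}
    (hF : ∀ s, F s ∈ degreeLT ℂ m) (h : ∀ k, DifferentiableAt ℝ (fun s => (F s).coeff k) t) :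
    ∃ F', HasPolyDerivAt m F F' t := by
  refine ⟨∑ k : Fin m, C (deriv (fun s => (F s).coeff k) t) * X ^ (k : ℕ), hF,
    Submodule.sum_mem _ fun i _ => C_mul_mem_degreeLT _ (X_pow_mem_degreeLT i.2), fun k => ?_⟩
  have hc : (∑ i : Fin m, C (deriv (fun s => (F s).coeff i) t) * X ^ (i : ℕ) : ℂ[X]).coeff k =
      deriv (fun s => (F s).coeff k) t := by
    simp only [finsetSum_coeff, coeff_C_mul, coeff_X_pow]
    by_cases hk : k < m
    · rw [Finset.sum_eq_single ⟨k, hk⟩]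
      · simp
      · intro b _ hb
        rw [if_neg fun h => hb (Fin.ext h.symm), mul_zero]
      · simp
    · have : (fun s => (F s).coeff k) = fun _ => 0 :=
        funext fun s => mem_degreeLT_iff_coeff.1 (hF s) k (by omega)
      rw [this, deriv_const]
      refine Finset.sum_eq_zero fun i _ => ?_
      rw [if_neg (by omega), mul_zero]
  rw [hc]
  exact (h k).hasDerivAt

theorem exists_hasPolyDerivAt_momentPoly {ℓ : ℝ → ℂ[X] →ₗ[ℂ] ℂ} {ℓ' : ℂ[X] →ₗ[ℂ] ℂ} {t : ℝ}
    {m : ℕ} {v : ℝ → Fin m → ℂ} (hℓ : HasFunctionalDerivAt ℓ ℓ' t)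
    (h : hankelDet (ℓ t) m ≠ 0) (hv : ∀ i, DifferentiableAt ℝ (fun s => v s i) t) :
    ∃ F', HasPolyDerivAt m (fun s => momentPoly (ℓ s) m (v s)) F' t := by
  refine hasPolyDerivAt_of_differentiableAt (fun s => momentPoly_mem _ _ _) fun k => ?_
  simp only [momentPoly_coeff]
  refine DifferentiableAt.fun_sum fun i _ => ?_
  split_ifs
  · exact differentiableAt_inv_mulVec (fun i j => (hℓ _).differentiableAt) hv h i
  · exact differentiableAt_const _

/-- The deformation equations of the orthogonal polynomials of a family of functionals whose
logarithmic derivative in the parameter is multiplication by `X`. -/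
theorem exists_hasPolyDerivAt {ℓ : ℝ → ℂ[X] →ₗ[ℂ] ℂ} {t : ℝ} {n : ℕ} (ht : (t : ℂ) ≠ 0)
    (hℓ : HasFunctionalDerivAt ℓ ((t : ℂ)⁻¹ • ℓ t ∘ₗ LinearMap.mulLeft ℂ X) t)
    (h : ∀ᶠ s in 𝓝 t, hankelDet (ℓ s) (n + 1) ≠ 0) (h' : hankelDet (ℓ t) n ≠ 0) :
    ∃ P' R', HasPolyDerivAt (n + 1 + 1) (fun s => monicPoly (ℓ s) (n + 1)) P' t ∧
      HasPolyDerivAt (n + 1) (fun s => normalizedPoly (ℓ s) n) R' t ∧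
      C (t : ℂ) * P' =
        -C (ℓ t (monicPoly (ℓ t) (n + 1) * X ^ (n + 1))) * normalizedPoly (ℓ t) n ∧
      C (t : ℂ) * R' = C ((normalizedPoly (ℓ t) n).coeff n) * monicPoly (ℓ t) (n + 1) -
        X * normalizedPoly (ℓ t) n := by
  have h0 := h.self_of_nhds
  have H := orthogonalPair h0 h'
  obtain ⟨V', hV⟩ := exists_hasPolyDerivAt_momentPoly
    (v := fun s j => ℓ s (X ^ (n + 1) * X ^ (j : ℕ)))
    hℓ h0 fun i => (hℓ _).differentiableAt
  obtain ⟨R', hR⟩ := exists_hasPolyDerivAt_momentPoly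
    (v := fun _ j => if (j : ℕ) = n then 1 else 0) hℓ h0 fun i => differentiableAt_const _
  have hP : HasPolyDerivAt (n + 1 + 1) (fun s => monicPoly (ℓ s) (n + 1)) (-V') t := by
    refine ⟨fun s => ?_, ?_, fun k => ?_⟩
    · exact Submodule.sub_mem _ (X_pow_mem_degreeLT (by omega))
        (degreeLT_le_succ (momentPoly_mem _ _ _))
    · exact Submodule.neg_mem _ (degreeLT_le_succ hV.mem')
    · simp only [monicPoly, coeff_sub, coeff_neg]
      exact (hV.coeff k).const_sub _
  have hmul : ∀ (m i : ℕ) (F : ℝ → ℂ[X]) (F' : ℂ[X]), HasPolyDerivAt m F F' t → ∀ x,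
      (∀ᶠ s in 𝓝 t, ℓ s (F s * X ^ i) = x) →
      ℓ t (X * F t * X ^ i) + t * ℓ t (F' * X ^ i) = 0 := by
    intro m i F F' hF x hx
    have hg : HasFunctionalDerivAt (fun s => ℓ s ∘ₗ LinearMap.mulRight ℂ (X ^ i))
        (((t : ℂ)⁻¹ • ℓ t ∘ₗ LinearMap.mulLeft ℂ X) ∘ₗ LinearMap.mulRight ℂ (X ^ i)) t :=
      fun p => hℓ (p * X ^ i)
    have := derivative_eq_zero_of_eventually (hF.functional hg) hx
    simp only [LinearMap.comp_apply, LinearMap.smul_apply, LinearMap.mulLeft_apply,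
      LinearMap.mulRight_apply, smul_eq_mul] at this
    field_simp at this
    rw [mul_assoc]
    linear_combination this
  refine ⟨-V', R', hP, hR, ?_, ?_⟩
  · refine eq_of_sub_eq_zero (eq_zero_of_hankelDet_ne_zero h0 ?_ fun i hi => ?_)
    · refine Submodule.sub_mem _ (C_mul_mem_degreeLT _ (Submodule.neg_mem _ hV.mem')) ?_
      rw [neg_mul]
      exact Submodule.neg_mem _ (C_mul_mem_degreeLT _ H.R_mem)
    · have e := hmul _ i _ _ hP 0 (h.mono fun s hs => by
        rw [monicPoly, sub_mul, map_sub, map_momentPoly_mul hs _ ⟨i, hi⟩, sub_self])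
      have e2 : (C (t : ℂ) * -V' -
          -C (ℓ t (monicPoly (ℓ t) (n + 1) * X ^ (n + 1))) * normalizedPoly (ℓ t) n) * X ^ i =
          C (t : ℂ) * (-V' * X ^ i) + C (ℓ t (monicPoly (ℓ t) (n + 1) * X ^ (n + 1))) *
            (normalizedPoly (ℓ t) n * X ^ i) := by ring
      have e3 : X * monicPoly (ℓ t) (n + 1) * X ^ i = monicPoly (ℓ t) (n + 1) * X ^ (i + 1) := by
        ring
      rw [e3] at e
      rw [e2, map_add, map_C_mul, map_C_mul]
      rcases Nat.lt_succ_iff_lt_or_eq.1 hi with hin | rfl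
      · rw [H.P_orth (i + 1) (by omega)] at e
        rw [H.R_orth i hin]
        linear_combination e
      · rw [H.R_norm]
        linear_combination e
  · refine eq_of_sub_eq_zero (eq_zero_of_hankelDet_ne_zero h0 ?_ fun i hi => ?_)
    · have m1 := sub_leading_mem_degreeLT (X_mul_mem_degreeLT H.R_mem)
      rw [coeff_X_mul] at m1
      have e : C (t : ℂ) * R' - (C ((normalizedPoly (ℓ t) n).coeff n) * monicPoly (ℓ t) (n + 1) -
          X * normalizedPoly (ℓ t) n) = C (t : ℂ) * R' -
          C ((normalizedPoly (ℓ t) n).coeff n) * (monicPoly (ℓ t) (n + 1) - X ^ (n + 1)) +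
          (X * normalizedPoly (ℓ t) n - C ((normalizedPoly (ℓ t) n).coeff n) * X ^ (n + 1)) := by
        ring
      rw [e]
      exact Submodule.add_mem _ (Submodule.sub_mem _ (C_mul_mem_degreeLT _ hR.mem')
        (C_mul_mem_degreeLT _ H.P_mem)) m1
    · have e := hmul _ i _ _ hR (if i = n then 1 else 0) (h.mono fun s hs => by
        rw [map_momentPoly_mul hs _ ⟨i, hi⟩])
      have e2 : (C (t : ℂ) * R' - (C ((normalizedPoly (ℓ t) n).coeff n) * monicPoly (ℓ t) (n + 1) -
          X * normalizedPoly (ℓ t) n)) * X ^ i = C (t : ℂ) * (R' * X ^ i) -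
          C ((normalizedPoly (ℓ t) n).coeff n) * (monicPoly (ℓ t) (n + 1) * X ^ i) +
          X * normalizedPoly (ℓ t) n * X ^ i := by
        ring
      rw [e2, map_add, map_sub, map_C_mul, map_C_mul, H.P_orth i hi]
      change ℓ t (X * normalizedPoly (ℓ t) n * X ^ i) + _ = 0 at e
      linear_combination e

/-- The determinant formula in terms of moment functionals. -/
theorem hamiltonian_of_functionals {a c : ℂ} (ha : a ≠ 1) (hc : c ≠ 1) {n : ℕ} {U : Set ℝ}
    (hU : IsOpen U) {L L01 L10 L11 Lm : ℝ → ℂ[X] →ₗ[ℂ] ℂ}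
    (H : ∀ t ∈ U, ContiguityRelations a c t (L t) (L01 t) (L10 t) (L11 t) (Lm t))
    (dL : ∀ t ∈ U, HasFunctionalDerivAt L ((t : ℂ)⁻¹ • L t ∘ₗ LinearMap.mulLeft ℂ X) t)
    (dLm : ∀ t ∈ U, HasFunctionalDerivAt Lm ((t : ℂ)⁻¹ • Lm t ∘ₗ LinearMap.mulLeft ℂ X) t)
    (hden1 : ∀ t ∈ U, hankelDet (L10 t) n ≠ 0) (hden2 : ∀ t ∈ U, hankelDet (L01 t) (n + 1) ≠ 0)
    (hden3 : ∀ t ∈ U, hankelDet (L t) (n + 1) ≠ 0) (hden4 : ∀ t ∈ U, hankelDet (L t) n ≠ 0)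
    {q p : ℝ → ℂ}
    (hq : ∀ t ∈ U, q t = -(((c - a) / (c - a - 1)) ^ n *
      (hankelDet (L t) n * hankelDet (L11 t) (n + 1)) /
      (hankelDet (L10 t) n * hankelDet (L01 t) (n + 1))))
    (hp : ∀ t ∈ U, p t = (1 - a) * ((c - a - 1) / (c - a)) ^ n *
      (hankelDet (L10 t) n * hankelDet (L01 t) (n + 1) * hankelDet (Lm t) (n + 1)) /
      ((hankelDet (L t) (n + 1)) ^ 2 * hankelDet (L t) n))
    (t : ℝ) (htU : t ∈ U) :
    (t : ℂ) * deriv q t =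
        2 * q t * (q t - 1) ^ 2 * p t
          - ((a + n) * (q t - 1) ^ 2 + (c - n - 2) * q t * (q t - 1) + (t : ℂ) * q t) ∧
      (t : ℂ) * deriv p t =
        -(((q t - 1) ^ 2 + 2 * q t * (q t - 1)) * (p t) ^ 2
            - (2 * (a + n) * (q t - 1) + (c - n - 2) * (2 * q t - 1) + (t : ℂ)) * p t
            + ((1 / 4) * ((a + n) + (c - n - 2)) ^ 2 - (1 / 4) * (c - a) ^ 2)) := by
  have hev : ∀ᶠ s in 𝓝 t, s ∈ U := hU.mem_nhds htU
  have ht : (t : ℂ) ≠ 0 := (H t htU).t_ne_zero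
  set P : ℝ → ℂ[X] := fun s => monicPoly (L s) (n + 1) with hPdef
  set R : ℝ → ℂ[X] := fun s => normalizedPoly (L s) n with hRdef
  have hO : ∀ s ∈ U, OrthogonalPair (L s) n (P s) (R s) := fun s hs =>
    orthogonalPair (hden3 s hs) (hden4 s hs)
  obtain ⟨P', R', dP, dR, eP, eR⟩ := exists_hasPolyDerivAt ht (dL t htU) (hev.mono hden3)
    (hden4 t htU)
  change C (t : ℂ) * P' = -C (L t (P t * X ^ (n + 1))) * R t at eP
  change C (t : ℂ) * R' = C ((R t).coeff n) * P t - X * R t at eR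
  change HasPolyDerivAt (n + 1 + 1) P P' t at dP
  change HasPolyDerivAt (n + 1) R R' t at dR
  set ρ : ℝ → ℂ := fun s => (R s).coeff n with hρ
  set k : ℝ → ℂ := fun s => (X * R s).coeff n / ρ s - (P s).coeff n + (c - n - 1 - s) with hk
  set y : ℝ → ℂ := fun s => s * (a + n) - L s (P s * X ^ (n + 1)) * ρ s with hy
  set v : ℝ → ℂ := fun s => Lm s ((R s).comp (X + C (-1))) with hv
  have hρ0 : ∀ s ∈ U, ρ s ≠ 0 := fun s hs => (hO s hs).coeff_ne_zero
  have hkρ : ∀ s ∈ U, ρ s * k s =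
      (X * R s).coeff n - ρ s * (P s).coeff n + ρ s * (c - n - 1 - s) := fun s hs => by
    have := hρ0 s hs
    simp only [hk]
    field_simp
  have eP' : ∀ ξ, P'.eval ξ = -((t * (a + n) - y t) / ρ t) * (R t).eval ξ / t := fun ξ => by
    have h1 := congrArg (Polynomial.eval ξ) eP
    have h2 : L t (P t * X ^ (n + 1)) = (t * (a + n) - y t) / ρ t := by
      have := hρ0 t htU
      simp only [hy]
      field_simp
      ring
    simp only [eval_mul, eval_neg, eval_C] at h1
    rw [← h2]
    field_simp
    linear_combination h1
  have eR' : ∀ ξ, R'.eval ξ = (ρ t * (P t).eval ξ - ξ * (R t).eval ξ) / t := fun ξ => by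
    have h1 := congrArg (Polynomial.eval ξ) eR
    simp only [eval_mul, eval_sub, eval_X, eval_C] at h1
    field_simp
    linear_combination h1
  have dρ : HasDerivAt ρ (-(k t - c + n + 1 + t) * ρ t / t) t := by
    refine (dR.coeff n).congr_deriv ?_
    have h1 := congrArg (fun f => f.coeff n) eR
    simp only [coeff_sub, coeff_C_mul] at h1
    have h2 := hkρ t htU
    field_simp
    linear_combination h1 + h2
  have ds : HasDerivAt (fun s : ℝ => (s : ℂ)) 1 t := Complex.ofRealCLM.hasDerivAt
  have dk : DifferentiableAt ℝ k t := by
    have h1 : DifferentiableAt ℝ (fun s => (X * R s).coeff n) t := by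
      rcases n with _ | n
      · simp only [coeff_X_mul_zero]
        exact differentiableAt_const _
      · simp only [coeff_X_mul]
        exact (dR.coeff n).differentiableAt
    exact ((h1.div dρ.differentiableAt (hρ0 t htU)).sub (dP.coeff n).differentiableAt).add
      (ds.differentiableAt.const_sub _)
  have dy : DifferentiableAt ℝ y t := by
    have hg : HasFunctionalDerivAt (fun s => L s ∘ₗ LinearMap.mulRight ℂ (X ^ (n + 1)))
        (((t : ℂ)⁻¹ • L t ∘ₗ LinearMap.mulLeft ℂ X) ∘ₗ LinearMap.mulRight ℂ (X ^ (n + 1))) t :=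
      fun p => dL t htU (p * X ^ (n + 1))
    exact (ds.differentiableAt.mul_const _).sub
      ((dP.functional hg).differentiableAt.mul dρ.differentiableAt)
  have dv : HasDerivAt v ((ρ t * Lm t ((P t).comp (X + C (-1))) + v t) / t) t := by
    have hg : HasFunctionalDerivAt (fun s => Lm s ∘ₗ taylor (-1))
        (((t : ℂ)⁻¹ • Lm t ∘ₗ LinearMap.mulLeft ℂ X) ∘ₗ taylor (-1)) t :=
      fun p => dLm t htU (taylor (-1) p)
    refine (dR.functional hg).congr_deriv ?_
    simp only [LinearMap.comp_apply, LinearMap.smul_apply, LinearMap.mulLeft_apply,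
      taylor_apply, smul_eq_mul, hv]
    have h1 := congrArg (fun f => Lm t (f.comp (X + C (-1)))) eR
    simp only [mul_comp, sub_comp, C_comp, X_comp, map_sub (Lm t), map_C_mul] at h1
    have h2 : (X + C (-1)) * (R t).comp (X + C (-1)) =
        X * (R t).comp (X + C (-1)) - (R t).comp (X + C (-1)) := by
      rw [C_neg, C_1]
      ring
    rw [h2, map_sub] at h1
    field_simp
    linear_combination h1
  have hT : ∀ s ∈ U, ρ s * (P s).eval 0 + s * (R s).eval 0 =
      s * (-s) ^ n * (R s).eval (-a) * L01 s (R s) :=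
    fun s hs => (H s hs).eval_zero_combination (hO s hs)
  have hRa : ∀ s ∈ U, (R s).eval (-a) ≠ 0 := fun s hs h0 => by
    have := (H s hs).hankelDet_10 (hO s hs)
    rw [h0, mul_zero, zero_mul] at this
    exact (mul_ne_zero (pow_ne_zero _ (H s hs).ca_one_ne_zero) (hden1 s hs)) this
  have hMr : ∀ s ∈ U, L01 s (R s) ≠ 0 := fun s hs h0 => by
    have := (H s hs).hankelDet_01 (hO s hs)
    rw [h0, mul_zero] at this
    exact hden2 s hs this
  have h10 : ∀ s ∈ U, hankelDet (L10 s) n =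
      (-1) ^ n * (R s).eval (-a) * hankelDet (L s) (n + 1) / (c - a - 1) ^ n := fun s hs => by
    have := (H s hs).ca_one_ne_zero
    rw [← (H s hs).hankelDet_10 (hO s hs)]
    field_simp
  have h11 : ∀ s ∈ U, hankelDet (L11 s) (n + 1) =
      (-1) ^ (n + 1) * (P s).eval 0 * hankelDet (L s) (n + 1) / s ^ (n + 1) := fun s hs => by
    have := (H s hs).t_ne_zero
    rw [← (H s hs).hankelDet_11 (hO s hs)]
    field_simp
  have hone : ((-1 : ℂ) ^ n) ^ 2 = 1 := by
    rw [← pow_mul, mul_comm, pow_mul]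
    simp
  refine hamiltonian_of_recurrence (n := n) ha hc ht (hρ0 t htU) dρ
    (K := t * deriv k t) (Y := t * deriv y t) ?_ ?_
    ((dP.eval 0).congr_deriv (eP' 0)) ((dR.eval 0).congr_deriv (by rw [eR']; ring))
    ((dP.eval (1 - c)).congr_deriv (eP' _)) ((dR.eval (1 - c)).congr_deriv (eR' _)) dv
    ?_ ?_ ?_ ?_ ?_ ?_ ?_ ?_ ?_
  · rw [mul_div_cancel_left₀ _ ht]
    exact dk.hasDerivAt
  · rw [mul_div_cancel_left₀ _ ht]
    exact dy.hasDerivAt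
  · exact hev.mono fun s hs => (H s hs).eval_zero (hO s hs) (hkρ s hs) rfl
  · exact hev.mono fun s hs => (H s hs).eval_one_sub (hO s hs) (hkρ s hs) rfl
  · exact hev.mono fun s hs => ((H s hs).map_m_mul_eval_zero (hO s hs) (hkρ s hs) rfl).1
  · exact hev.mono fun s hs => ((H s hs).map_m_mul_eval_zero (hO s hs) (hkρ s hs) rfl).2
  · exact (hO t htU).eval_ne_zero 0
  · exact (hO t htU).eval_ne_zero (1 - c)
  · rw [hT t htU]
    exact mul_ne_zero (mul_ne_zero (mul_ne_zero ht (pow_ne_zero _ (neg_ne_zero.2 ht)))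
      (hRa t htU)) (hMr t htU)
  · refine hev.mono fun s hs => ?_
    have a1 := (H s hs).t_ne_zero
    have a2 := (H s hs).ca_ne_zero
    have a3 := (H s hs).ca_one_ne_zero
    have a4 := hRa s hs
    have a5 := hMr s hs
    have a6 := hden3 s hs
    have a7 : ((-1 : ℂ) ^ n) ≠ 0 := pow_ne_zero _ (by norm_num)
    rw [hq s hs, h10 s hs, h11 s hs, (H s hs).hankelDet_01 (hO s hs), hT s hs,
      ← (hO s hs).coeff_mul, neg_pow (s : ℂ), pow_succ (-1 : ℂ), div_pow]
    change -((c - a) ^ n / (c - a - 1) ^ n * (ρ s * _ * _) / _) = _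
    field_simp
    ring
  · refine hev.mono fun s hs => ?_
    have a1 := (H s hs).t_ne_zero
    have a2 := (H s hs).ca_ne_zero
    have a3 := (H s hs).ca_one_ne_zero
    have a4 := hρ0 s hs
    have a6 := hden3 s hs
    rw [hp s hs, h10 s hs, (H s hs).hankelDet_01 (hO s hs), (H s hs).hankelDet_m (hO s hs),
      hT s hs, ← (hO s hs).coeff_mul, neg_pow (s : ℂ), div_pow]
    change _ / (_ * (ρ s * _)) = _
    field_simp
    simp only [hv]
    linear_combination (R s).eval (-a) * L01 s (R s) * Lm s ((R s).comp (X + C (-1))) * hone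

/-- The complex numbers that are not integers. -/
def NotInt (z : ℂ) : Prop := z ∉ Set.range ((↑) : ℤ → ℂ)

theorem NotInt.add_intCast {z : ℂ} (h : NotInt z) (m : ℤ) : NotInt (z + m) := by
  rintro ⟨k, hk⟩
  exact h ⟨k - m, by push_cast; rw [hk]; ring⟩

theorem NotInt.neg {z : ℂ} (h : NotInt z) : NotInt (-z) := by
  rintro ⟨k, hk⟩
  exact h ⟨-k, by push_cast; rw [hk]; ring⟩

theorem NotInt.ne_intCast {z : ℂ} (h : NotInt z) (m : ℤ) : z ≠ m := fun e => h ⟨m, e.symm⟩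

theorem NotInt.add_one {z : ℂ} (h : NotInt z) : NotInt (z + 1) := by
  simpa using h.add_intCast 1

theorem NotInt.sub_one {z : ℂ} (h : NotInt z) : NotInt (z - 1) := by
  simpa [sub_eq_add_neg] using h.add_intCast (-1)

theorem NotInt.ne_zero {z : ℂ} (h : NotInt z) : z ≠ 0 := by
  simpa using h.ne_intCast 0

theorem NotInt.ne_one {z : ℂ} (h : NotInt z) : z ≠ 1 := by
  simpa using h.ne_intCast 1

theorem NotInt.add_natCast_ne_zero {z : ℂ} (h : NotInt z) (n : ℕ) : z + n ≠ 0 := by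
  simpa using (h.add_intCast n).ne_zero

/-- The coefficients of Kummer's series. -/
noncomputable def kummerCoeff (a c : ℂ) (n : ℕ) : ℂ :=
  (ascPochhammer ℂ n).eval a / ((ascPochhammer ℂ n).eval c * (n.factorial : ℂ))

theorem mul_eval_ascPochhammer (a : ℂ) (n : ℕ) :
    a * (ascPochhammer ℂ n).eval (a + 1) = (ascPochhammer ℂ n).eval a * (a + n) := by
  rw [← ascPochhammer_succ_eval, ascPochhammer_succ_left]
  simp

theorem NotInt.eval_ascPochhammer_ne_zero {c : ℂ} (hc : NotInt c) (n : ℕ) :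
    (ascPochhammer ℂ n).eval c ≠ 0 := by
  induction n with
  | zero => simp
  | succ n ih =>
    rw [ascPochhammer_succ_eval]
    exact mul_ne_zero ih (hc.add_natCast_ne_zero n)

theorem kummerCoeff_zero (a c : ℂ) : kummerCoeff a c 0 = 1 := by
  simp [kummerCoeff]

theorem kummerCoeff_succ {a c : ℂ} (hc : NotInt c) (n : ℕ) :
    kummerCoeff a c (n + 1) = kummerCoeff a c n * ((a + n) / ((c + n) * (n + 1))) := by
  have h1 := hc.eval_ascPochhammer_ne_zero n
  have h2 := hc.add_natCast_ne_zero n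
  have h3 : (n.factorial : ℂ) ≠ 0 := by exact_mod_cast n.factorial_ne_zero
  have h4 : (n : ℂ) + 1 ≠ 0 := by exact_mod_cast n.succ_ne_zero
  simp only [kummerCoeff, ascPochhammer_succ_eval, Nat.factorial_succ]
  push_cast
  field_simp

theorem kummerCoeff_add_one_left (a c : ℂ) (n : ℕ) :
    a * kummerCoeff (a + 1) c n = kummerCoeff a c n * (a + n) := by
  simp only [kummerCoeff]
  rw [mul_div_assoc', mul_eval_ascPochhammer]
  ring

theorem kummerCoeff_add_one_right {a c : ℂ} (hc : NotInt c) (n : ℕ) :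
    (c + n) * kummerCoeff a (c + 1) n = c * kummerCoeff a c n := by
  have h1 := hc.eval_ascPochhammer_ne_zero n
  have h2 := hc.add_one.eval_ascPochhammer_ne_zero n
  have h3 : (n.factorial : ℂ) ≠ 0 := by exact_mod_cast n.factorial_ne_zero
  have h5 := mul_eval_ascPochhammer c n
  simp only [kummerCoeff]
  field_simp
  linear_combination -(ascPochhammer ℂ n).eval a * h5

theorem summable_kummerCoeff {c : ℂ} (a : ℂ) (hc : NotInt c) (t : ℂ) :
    Summable fun n => kummerCoeff a c n * t ^ n := by
  refine summable_of_ratio_norm_eventually_le (r := 1 / 2) (by norm_num) ?_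
  obtain ⟨N, hN⟩ := exists_nat_gt (max (8 * ‖t‖) (max ‖a‖ (2 * ‖c‖)))
  filter_upwards [eventually_ge_atTop N] with n hn
  have hn' : (N : ℝ) ≤ n := by exact_mod_cast hn
  have h1 : 8 * ‖t‖ < n := (le_max_left _ _).trans_lt (hN.trans_le hn')
  have h2 : ‖a‖ < n := ((le_max_left _ _).trans (le_max_right _ _)).trans_lt (hN.trans_le hn')
  have h3 : 2 * ‖c‖ < n := ((le_max_right _ _).trans (le_max_right _ _)).trans_lt (hN.trans_le hn')
  have h4 : ‖a + n‖ ≤ 2 * n := by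
    refine (norm_add_le _ _).trans ?_
    rw [Complex.norm_natCast]
    linarith
  have h5 : (n : ℝ) / 2 ≤ ‖c + n‖ := by
    have := norm_sub_norm_le (n : ℂ) (-c)
    rw [Complex.norm_natCast, norm_neg, sub_neg_eq_add, add_comm] at this
    linarith
  have h6 : 0 < ‖c + n‖ := norm_pos_iff.2 (hc.add_natCast_ne_zero n)
  have h7 : ‖(n : ℂ) + 1‖ = n + 1 := by
    exact_mod_cast Complex.norm_natCast (n + 1)
  have h8 : (0 : ℝ) ≤ n := n.cast_nonneg
  have h9 : ‖(a + n) / ((c + n) * (n + 1)) * t‖ ≤ 1 / 2 := by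
    rw [norm_mul, norm_div, norm_mul, h7, div_mul_eq_mul_div, div_le_iff₀ (by positivity)]
    have := norm_nonneg t
    nlinarith [mul_le_mul_of_nonneg_right h4 this, mul_le_mul_of_nonneg_right h5 h8]
  rw [kummerCoeff_succ hc, pow_succ]
  calc _ = ‖(a + n) / ((c + n) * (n + 1)) * t‖ * ‖kummerCoeff a c n * t ^ n‖ := by
        rw [← norm_mul]
        ring_nf
    _ ≤ _ := mul_le_mul_of_nonneg_right h9 (norm_nonneg _)

theorem hasSum_kummerF {c : ℂ} (a : ℂ) (hc : NotInt c) (t : ℝ) :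
    HasSum (fun n => kummerCoeff a c n * (t : ℂ) ^ n) (kummerF a c t) :=
  (summable_kummerCoeff a hc t).hasSum

theorem hasDerivAt_kummerF {c : ℂ} (a : ℂ) (hc : NotInt c) (t : ℝ) :
    HasDerivAt (kummerF a c) (a / c * kummerF (a + 1) (c + 1) t) t := by
  have hco : ∀ n : ℕ, kummerCoeff a c (n + 1) * (n + 1) =
      a / c * kummerCoeff (a + 1) (c + 1) n := fun n => by
    have h1 := hc.ne_zero
    have h2 := hc.add_natCast_ne_zero n
    have h3 : (n : ℂ) + 1 ≠ 0 := by exact_mod_cast n.succ_ne_zero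
    have h4 := kummerCoeff_add_one_left a (c + 1) n
    have h5 := kummerCoeff_add_one_right (a := a) hc n
    rw [kummerCoeff_succ hc]
    field_simp
    linear_combination -(c + n) * h4 - (a + n) * h5
  have hs : ∀ s : ℂ, HasSum (fun n : ℕ => kummerCoeff a c n * (n * s ^ (n - 1)))
      (a / c * ∑' n, kummerCoeff (a + 1) (c + 1) n * s ^ n) := fun s => by
    rw [← hasSum_nat_add_iff' 1]
    simp only [Finset.sum_range_one, Nat.cast_zero, zero_mul, mul_zero, sub_zero]
    refine ((summable_kummerCoeff (a + 1) hc.add_one s).hasSum.mul_left (a / c)).congr_fun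
      fun n => ?_
    rw [← mul_assoc (a / c), ← hco]
    simp only [Nat.add_sub_cancel]
    push_cast
    ring
  set r : ℝ := |t| + 1
  have hr : t ∈ Metric.ball (0 : ℝ) r := by
    rw [mem_ball_zero_iff, Real.norm_eq_abs]
    exact lt_add_one _
  have key := hasDerivAt_tsum_of_isPreconnected (𝕜 := ℝ) (t := Metric.ball (0 : ℝ) r)
    (g := fun n s => kummerCoeff a c n * (s : ℂ) ^ n)
    (g' := fun n s => kummerCoeff a c n * (n * (s : ℂ) ^ (n - 1)))
    (hs (r : ℂ)).summable.norm Metric.isOpen_ball (convex_ball (0 : ℝ) r).isPreconnected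
    (fun n s _ => ?_) (fun n s hs => ?_) hr (summable_kummerCoeff a hc t) hr
  · rw [(hs t).tsum_eq] at key
    exact key
  · have h : HasDerivAt (fun s : ℝ => (s : ℂ)) 1 s := Complex.ofRealCLM.hasDerivAt
    refine ((h.pow n).const_mul (kummerCoeff a c n)).congr_deriv ?_
    simp
  · rw [mem_ball_zero_iff] at hs
    simp only [norm_mul, norm_pow, Complex.norm_real]
    gcongr
    exact hs.le.trans (le_abs_self r)

theorem kummerF_contiguous_right {c : ℂ} (a : ℂ) (hc : NotInt c) (t : ℝ) :
    c * kummerF a c t =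
      (c - a) * kummerF a (c + 1) t + a * kummerF (a + 1) (c + 1) t := by
  refine ((hasSum_kummerF a hc t).mul_left c).unique ?_
  refine (((hasSum_kummerF a hc.add_one t).mul_left (c - a)).add
    ((hasSum_kummerF (a + 1) hc.add_one t).mul_left a)).congr_fun fun n => ?_
  linear_combination (-(t : ℂ) ^ n) * kummerCoeff_add_one_right (a := a) hc n -
    (t : ℂ) ^ n * kummerCoeff_add_one_left a (c + 1) n

theorem kummerF_sub_kummerF_add_one_right {c : ℂ} (a : ℂ) (hc : NotInt c) (t : ℝ) :
    kummerF a c t - kummerF a (c + 1) t =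
      a / (c * (c + 1)) * (t * kummerF (a + 1) (c + 1 + 1) t) := by
  refine ((hasSum_kummerF a hc t).sub (hasSum_kummerF a hc.add_one t)).unique ?_
  rw [← hasSum_nat_add_iff' 1]
  simp only [Finset.sum_range_one, kummerCoeff_zero, sub_self, sub_zero]
  refine (((hasSum_kummerF (a + 1) hc.add_one.add_one t).mul_left _).mul_left _).congr_fun
    fun n => ?_
  have h1 := hc.ne_zero
  have h2 := hc.add_one.ne_zero
  have h3 : (n : ℂ) + 1 ≠ 0 := by exact_mod_cast n.succ_ne_zero
  have h4 := kummerCoeff_add_one_left a (c + 1 + 1) n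
  have h5 := kummerCoeff_add_one_right (a := a) hc n
  have h6 := kummerCoeff_add_one_right (a := a) hc.add_one n
  have h7 := hc.add_natCast_ne_zero n
  have h8 := hc.add_one.add_natCast_ne_zero n
  have h9 : kummerCoeff a (c + 1) n = c * kummerCoeff a c n / (c + n) := by
    rw [← h5, mul_div_cancel_left₀ _ h7]
  have h10 : kummerCoeff a (c + 1 + 1) n = (c + 1) * kummerCoeff a (c + 1) n / (c + 1 + n) := by
    rw [← h6, mul_div_cancel_left₀ _ h8]
  rw [h10, h9] at h4
  rw [kummerCoeff_succ hc, kummerCoeff_succ hc.add_one, h9]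
  trans kummerCoeff a c n * (a + n) / ((c + n) * (c + 1 + n)) * t ^ (n + 1)
  · field_simp
    ring
  · trans (a * kummerCoeff (a + 1) (c + 1 + 1) n) / (c * (c + 1)) * t ^ (n + 1)
    · rw [h4]
      field_simp
    · ring

theorem kummerF_sub_kummerF_add_one_left {c : ℂ} (a : ℂ) (hc : NotInt c) (t : ℝ) :
    kummerF (a + 1) c t - kummerF a c t = t / c * kummerF (a + 1) (c + 1) t := by
  rw [div_mul_eq_mul_div, mul_div_assoc]
  refine ((hasSum_kummerF (a + 1) hc t).sub (hasSum_kummerF a hc t)).unique ?_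
  rw [← hasSum_nat_add_iff' 1]
  simp only [Finset.sum_range_one, kummerCoeff_zero, sub_self, sub_zero]
  refine (((hasSum_kummerF (a + 1) hc.add_one t).div_const c).mul_left _).congr_fun
    fun n => ?_
  have h1 := hc.ne_zero
  have h3 : (n : ℂ) + 1 ≠ 0 := by exact_mod_cast n.succ_ne_zero
  have h4 := kummerCoeff_add_one_left a c n
  have h5 := kummerCoeff_add_one_right (a := a + 1) hc n
  have h7 := hc.add_natCast_ne_zero n
  have h9 : kummerCoeff (a + 1) (c + 1) n = c * kummerCoeff (a + 1) c n / (c + n) := by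
    rw [← h5, mul_div_cancel_left₀ _ h7]
  rw [kummerCoeff_succ hc, kummerCoeff_succ hc, h9]
  field_simp
  linear_combination (t : ℂ) ^ (n + 1) * h4

/-- The seed function without index shifts. -/
noncomputable def seed (c₁ c₂ a c : ℂ) (t : ℝ) : ℂ :=
  c₁ * (Complex.Gamma a * Complex.Gamma (c - a) / Complex.Gamma c) * kummerF a c t
  + c₂ * (1 / (Complex.sin (π * (c - a)) * Complex.Gamma (2 - c))) *
      ((t : ℂ) ^ (1 - c) * kummerF (a - c + 1) (2 - c) t)

theorem phiV_eq_seed (a c c₁ c₂ : ℂ) (i j : ℤ) :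
    phiV a c c₁ c₂ i j = seed c₁ c₂ (a + i) (c + j) := by
  funext t
  simp only [phiV, seed]
  rw [show c - a - i + j = c + j - (a + i) by ring, show 2 - (c + j) = 2 - c - j by ring,
    show 1 - (c + j) = 1 - c - j by ring, show a + i - (c + j) + 1 = a - c + 1 + i - j by ring]

theorem NotInt.two_sub {c : ℂ} (hc : NotInt c) : NotInt (2 - c) := by
  have := hc.neg.add_intCast 2
  rwa [Int.cast_ofNat, add_comm, ← sub_eq_add_neg] at this

theorem NotInt.one_sub {c : ℂ} (hc : NotInt c) : NotInt (1 - c) := by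
  have := hc.neg.add_intCast 1
  rwa [Int.cast_one, add_comm, ← sub_eq_add_neg] at this

theorem NotInt.Gamma_ne_zero {z : ℂ} (h : NotInt z) : Complex.Gamma z ≠ 0 :=
  Complex.Gamma_ne_zero fun m => by simpa using h.ne_intCast (-m)

theorem NotInt.sin_pi_mul_ne_zero {z : ℂ} (h : NotInt z) : Complex.sin (π * z) ≠ 0 := by
  rw [Ne, Complex.sin_eq_zero_iff]
  rintro ⟨k, hk⟩
  have hpi : (π : ℂ) ≠ 0 := by exact_mod_cast Real.pi_ne_zero
  exact h ⟨k, (mul_left_cancel₀ hpi (hk.trans (mul_comm _ _))).symm⟩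

theorem sin_pi_mul_add_one (z : ℂ) : Complex.sin (π * (z + 1)) = -Complex.sin (π * z) := by
  rw [mul_add, mul_one, Complex.sin_add_pi]

theorem cpow_add_one' {t : ℝ} (ht : 0 < t) (z : ℂ) : (t : ℂ) ^ (z + 1) = t ^ z * t := by
  have ht' : (t : ℂ) ≠ 0 := by exact_mod_cast ht.ne'
  rw [Complex.cpow_add _ _ ht', Complex.cpow_one]

theorem hasDerivAt_seed (c₁ c₂ : ℂ) {a c : ℂ} (ha : NotInt a) (hc : NotInt c)
    {t : ℝ} (ht : 0 < t) :
    HasDerivAt (seed c₁ c₂ a c) (seed c₁ c₂ (a + 1) (c + 1) t) t := by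
  have hc1 := hc.one_sub
  have h1 := hasDerivAt_kummerF a hc t
  have h2 := hasDerivAt_kummerF (a - c + 1) hc.two_sub t
  have h3 : HasDerivAt (fun s : ℝ => (s : ℂ) ^ (1 - c)) ((1 - c) * (t : ℂ) ^ (-c)) t := by
    have := hasDerivAt_ofReal_cpow_const ht.ne' hc1.ne_zero
    rwa [show 1 - c - 1 = -c by ring] at this
  refine ((h1.const_mul _).add ((h3.mul h2).const_mul _)).congr_deriv ?_
  have h4 := kummerF_sub_kummerF_add_one_right (a - c + 1) hc1 t
  rw [show 1 - c + 1 = 2 - c by ring] at h4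
  simp only [seed]
  rw [show c + 1 - (a + 1) = c - a by ring, show 2 - (c + 1) = 1 - c by ring,
    show 1 - (c + 1) = -c by ring, show a + 1 - (c + 1) + 1 = a - c + 1 by ring,
    Complex.Gamma_add_one a ha.ne_zero, Complex.Gamma_add_one c hc.ne_zero,
    show 2 - c = 1 - c + 1 by ring, Complex.Gamma_add_one _ hc1.ne_zero,
    show (t : ℂ) ^ (1 - c) = t ^ (-c) * t by rw [← cpow_add_one' ht]; ring_nf]
  rw [show 1 - c + 1 = 2 - c by ring, sub_eq_iff_eq_add.1 h4]
  have := hc.Gamma_ne_zero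
  have := hc1.Gamma_ne_zero
  have := hc.ne_zero
  have := hc1.ne_zero
  have := hc.two_sub.ne_zero
  field_simp
  ring

theorem seed_contiguous_right (c₁ c₂ : ℂ) {a c : ℂ} (ha : NotInt a) (hc : NotInt c)
    (hca : NotInt (c - a)) {t : ℝ} (ht : 0 < t) :
    seed c₁ c₂ a c t = seed c₁ c₂ a (c + 1) t + seed c₁ c₂ (a + 1) (c + 1) t := by
  have hc1 := hc.one_sub
  have h1 := kummerF_contiguous_right a hc t
  have h2 := kummerF_sub_kummerF_add_one_left (a - c) hc1 t
  simp only [seed]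
  rw [show c + 1 - (a + 1) = c - a by ring, show 2 - (c + 1) = 1 - c by ring,
    show 1 - (c + 1) = -c by ring, show a + 1 - (c + 1) + 1 = a - c + 1 by ring,
    show a - (c + 1) + 1 = a - c by ring, show c + 1 - a = c - a + 1 by ring,
    Complex.Gamma_add_one a ha.ne_zero, Complex.Gamma_add_one c hc.ne_zero,
    Complex.Gamma_add_one _ hca.ne_zero, sin_pi_mul_add_one,
    show 2 - c = 1 - c + 1 by ring, Complex.Gamma_add_one _ hc1.ne_zero,
    show (t : ℂ) ^ (1 - c) = t ^ (-c) * t by rw [← cpow_add_one' ht]; ring_nf]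
  have := hc.Gamma_ne_zero
  have := hc1.Gamma_ne_zero
  have := hc.ne_zero
  have := hc1.ne_zero
  have := hca.sin_pi_mul_ne_zero
  rw [show 1 - c + 1 = 2 - c by ring] at h2 ⊢
  rw [sub_eq_iff_eq_add.1 h2]
  have h3 : kummerF a c t =
      ((c - a) * kummerF a (c + 1) t + a * kummerF (a + 1) (c + 1) t) / c := by
    rw [← h1]
    field_simp
  rw [h3]
  field_simp
  ring

theorem seed_contiguous (c₁ c₂ : ℂ) {a c : ℂ} (ha : NotInt a) (hc : NotInt c)
    (hca : NotInt (c - a)) {t : ℝ} (ht : 0 < t) :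
    t * seed c₁ c₂ (a + 1) (c + 1 + 1) t + c * seed c₁ c₂ a (c + 1) t =
      (c - a) * seed c₁ c₂ a c t := by
  have hc1 := hc.one_sub
  have hc0 := hc.neg
  have h1 := kummerF_sub_kummerF_add_one_right a hc t
  have h2 := kummerF_sub_kummerF_add_one_right (a - c) hc0 t
  rw [show -c + 1 = 1 - c by ring, show 1 - c + 1 = 2 - c by ring] at h2
  simp only [seed]
  rw [show c + 1 + 1 - (a + 1) = c - a + 1 by ring, show 2 - (c + 1 + 1) = -c by ring,
    show 1 - (c + 1 + 1) = -c + -1 by ring, show a + 1 - (c + 1 + 1) + 1 = a - c by ring,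
    show 2 - (c + 1) = 1 - c by ring, show 1 - (c + 1) = -c by ring,
    show a - (c + 1) + 1 = a - c by ring, show c + 1 - a = c - a + 1 by ring,
    Complex.Gamma_add_one a ha.ne_zero, Complex.Gamma_add_one _ hc.add_one.ne_zero,
    Complex.Gamma_add_one c hc.ne_zero, Complex.Gamma_add_one _ hca.ne_zero, sin_pi_mul_add_one,
    show Complex.Gamma (2 - c) = (1 - c) * (-c * Complex.Gamma (-c)) by
      rw [← Complex.Gamma_add_one _ hc0.ne_zero, show -c + 1 = 1 - c by ring,
        ← Complex.Gamma_add_one _ hc1.ne_zero, show 1 - c + 1 = 2 - c by ring],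
    show Complex.Gamma (1 - c) = -c * Complex.Gamma (-c) by
      rw [← Complex.Gamma_add_one _ hc0.ne_zero, show -c + 1 = 1 - c by ring],
    show (t : ℂ) ^ (-c) = t ^ (-c + -1) * t by rw [← cpow_add_one' ht]; ring_nf,
    show (t : ℂ) ^ (1 - c) = t ^ (-c + -1) * t * t by
      rw [← cpow_add_one' ht, ← cpow_add_one' ht]; ring_nf]
  rw [sub_eq_iff_eq_add.1 h1, sub_eq_iff_eq_add.1 h2]
  have := hc.Gamma_ne_zero
  have := hc0.Gamma_ne_zero
  have := hc.ne_zero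
  have := hc1.ne_zero
  have := hc.add_one.ne_zero
  have := hca.sin_pi_mul_ne_zero
  field_simp
  ring

theorem mul_seed_add_mul_seed (c₁ c₂ : ℂ) {a c : ℂ} (ha : NotInt a) (hc : NotInt c)
    (hca : NotInt (c - a)) {t : ℝ} (ht : 0 < t) :
    t * seed c₁ c₂ (a + 1) (c + 1) t + a * seed c₁ c₂ a c t =
      (c - a - 1) * seed c₁ c₂ (a + 1) c t := by
  have hca' : NotInt (c - 1 - a) := by simpa [sub_right_comm] using hca.sub_one
  have h1 := seed_contiguous c₁ c₂ ha hc.sub_one hca' ht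
  have h2 := seed_contiguous_right c₁ c₂ ha hc.sub_one hca' ht
  rw [sub_add_cancel] at h1 h2
  linear_combination h1 + (c - 1 - a) * h2

theorem mul_seed_sub_one (c₁ c₂ : ℂ) {a c : ℂ} (ha : NotInt a) (hc : NotInt c)
    (hca : NotInt (c - a)) {t : ℝ} (ht : 0 < t) :
    (a - 1) * seed c₁ c₂ (a - 1) (c - 1) t =
      t * seed c₁ c₂ (a + 1) (c + 1) t + (c - 1 - t) * seed c₁ c₂ a c t := by
  have hca' : NotInt (c - 1 - a) := by simpa [sub_right_comm] using hca.sub_one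
  have h1 := seed_contiguous c₁ c₂ ha hc.sub_one hca' ht
  have h2 := mul_seed_add_mul_seed c₁ c₂ ha.sub_one hc.sub_one
    (by rwa [sub_sub_sub_cancel_right]) ht
  rw [sub_add_cancel] at h1
  rw [sub_add_cancel, sub_add_cancel] at h2
  linear_combination h2 - h1

theorem eulerD_seed (c₁ c₂ : ℂ) {a c : ℂ} (ha : NotInt a) (hc : NotInt c) {t : ℝ} (ht : 0 < t) :
    eulerD (seed c₁ c₂ a c) t = t * seed c₁ c₂ (a + 1) (c + 1) t := by
  rw [eulerD, (hasDerivAt_seed c₁ c₂ ha hc ht).deriv]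

theorem contDiffOn_seed (c₁ c₂ : ℂ) {a c : ℂ} (ha : NotInt a) (hc : NotInt c) :
    ContDiffOn ℝ ∞ (seed c₁ c₂ a c) (Set.Ioi 0) := by
  have hd : ∀ {a c : ℂ}, NotInt a → NotInt c →
      DifferentiableOn ℝ (seed c₁ c₂ a c) (Set.Ioi 0) := fun ha hc t ht =>
    (hasDerivAt_seed c₁ c₂ ha hc ht).differentiableAt.differentiableWithinAt
  rw [contDiffOn_infty]
  intro n
  induction n generalizing a c with
  | zero => exact contDiffOn_zero.2 (hd ha hc).continuousOn
  | succ n ih =>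
    push_cast
    refine (contDiffOn_succ_iff_deriv_of_isOpen isOpen_Ioi).2 ⟨hd ha hc, by simp, ?_⟩
    exact (ih ha.add_one hc.add_one).congr fun t ht => (hasDerivAt_seed c₁ c₂ ha hc ht).deriv

theorem contDiffOn_eulerD {f : ℝ → ℂ} (hf : ContDiffOn ℝ ∞ f (Set.Ioi 0)) :
    ContDiffOn ℝ ∞ (eulerD f) (Set.Ioi 0) :=
  Complex.ofRealCLM.contDiff.contDiffOn.mul
    ((contDiffOn_infty_iff_deriv_of_isOpen isOpen_Ioi).1 hf).2

theorem contDiffOn_iterate_eulerD {f : ℝ → ℂ} (hf : ContDiffOn ℝ ∞ f (Set.Ioi 0)) (k : ℕ) :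
    ContDiffOn ℝ ∞ (eulerD^[k] f) (Set.Ioi 0) := by
  induction k with
  | zero => exact hf
  | succ k ih =>
    rw [Function.iterate_succ_apply']
    exact contDiffOn_eulerD ih

theorem hasDerivAt_of_contDiffOn {f : ℝ → ℂ} (hf : ContDiffOn ℝ ∞ f (Set.Ioi 0)) {t : ℝ}
    (ht : 0 < t) : HasDerivAt f ((t : ℂ)⁻¹ * eulerD f t) t := by
  have ht' : (t : ℂ) ≠ 0 := by exact_mod_cast ht.ne'
  rw [eulerD, inv_mul_cancel_left₀ ht']
  exact ((hf.differentiableOn (by simp)).differentiableAt (Ioi_mem_nhds ht)).hasDerivAt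

theorem eqOn_eulerD {f g : ℝ → ℂ} (h : Set.EqOn f g (Set.Ioi 0)) :
    Set.EqOn (eulerD f) (eulerD g) (Set.Ioi 0) := fun t ht => by
  simp only [eulerD]
  rw [(h.eventuallyEq_of_mem (Ioi_mem_nhds ht)).deriv_eq]

/-- The functional sending `X ^ k` to the value at `t` of the `k`-th Euler derivative of `f`. -/
noncomputable def eulerFunctional (f : ℝ → ℂ) (t : ℝ) : ℂ[X] →ₗ[ℂ] ℂ :=
  Polynomial.lsum fun k => LinearMap.toSpanSingleton ℂ ℂ (eulerD^[k] f t)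

theorem eulerFunctional_X_pow (f : ℝ → ℂ) (t : ℝ) (k : ℕ) :
    eulerFunctional f t (X ^ k) = eulerD^[k] f t := by
  rw [← monomial_one_right_eq_X_pow]
  simp [eulerFunctional]

theorem eq_of_map_X_pow {L M : ℂ[X] →ₗ[ℂ] ℂ} (h : ∀ k : ℕ, L (X ^ k) = M (X ^ k)) (p : ℂ[X]) :
    L p = M p := by
  induction p using Polynomial.induction_on' with
  | add p q hp hq => rw [map_add, map_add, hp, hq]
  | monomial k x => rw [← C_mul_X_pow_eq_monomial, map_C_mul, map_C_mul, h]

theorem eulerFunctional_X_mul (f : ℝ → ℂ) (t : ℝ) (p : ℂ[X]) :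
    eulerFunctional f t (X * p) = eulerFunctional (eulerD f) t p := by
  refine eq_of_map_X_pow (L := eulerFunctional f t ∘ₗ LinearMap.mulLeft ℂ X) (fun k => ?_) p
  rw [LinearMap.comp_apply, LinearMap.mulLeft_apply, ← pow_succ', eulerFunctional_X_pow,
    eulerFunctional_X_pow, Function.iterate_succ_apply]

theorem eulerFunctional_congr {f g : ℝ → ℂ} (h : Set.EqOn f g (Set.Ioi 0)) {t : ℝ} (ht : 0 < t)
    (p : ℂ[X]) : eulerFunctional f t p = eulerFunctional g t p := by
  refine eq_of_map_X_pow (fun k => ?_) p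
  rw [eulerFunctional_X_pow, eulerFunctional_X_pow]
  have : Set.EqOn (eulerD^[k] f) (eulerD^[k] g) (Set.Ioi 0) := by
    induction k with
    | zero => exact h
    | succ k ih =>
      rw [Function.iterate_succ_apply', Function.iterate_succ_apply']
      exact eqOn_eulerD ih
  exact this ht

theorem eulerFunctional_add {f g : ℝ → ℂ} (hf : ContDiffOn ℝ ∞ f (Set.Ioi 0))
    (hg : ContDiffOn ℝ ∞ g (Set.Ioi 0)) {t : ℝ} (ht : 0 < t) (p : ℂ[X]) :
    eulerFunctional (fun s => f s + g s) t p = eulerFunctional f t p + eulerFunctional g t p := by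
  rw [← LinearMap.add_apply]
  refine eq_of_map_X_pow (fun k => ?_) p
  rw [LinearMap.add_apply, eulerFunctional_X_pow, eulerFunctional_X_pow, eulerFunctional_X_pow]
  induction k generalizing t with
  | zero => rfl
  | succ k ih =>
    have h : Set.EqOn (eulerD^[k] fun s => f s + g s) (eulerD^[k] f + eulerD^[k] g) (Set.Ioi 0) :=
      fun s hs => ih hs
    simp only [Function.iterate_succ_apply']
    rw [eqOn_eulerD h ht]
    have h1 := hasDerivAt_of_contDiffOn (contDiffOn_iterate_eulerD hf k) ht
    have h2 := hasDerivAt_of_contDiffOn (contDiffOn_iterate_eulerD hg k) ht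
    have ht' : (t : ℂ) ≠ 0 := by exact_mod_cast ht.ne'
    rw [eulerD, (h1.add h2).deriv, mul_add, mul_inv_cancel_left₀ ht', mul_inv_cancel_left₀ ht']

theorem eulerFunctional_const_mul (x : ℂ) (f : ℝ → ℂ) (t : ℝ) (p : ℂ[X]) :
    eulerFunctional (fun s => x * f s) t p = x * eulerFunctional f t p := by
  rw [← smul_eq_mul x, ← LinearMap.smul_apply]
  refine eq_of_map_X_pow (fun k => ?_) p
  rw [LinearMap.smul_apply, smul_eq_mul, eulerFunctional_X_pow, eulerFunctional_X_pow]
  induction k generalizing f with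
  | zero => rfl
  | succ k ih =>
    have h : eulerD (fun s => x * f s) = fun s => x * eulerD f s := by
      funext s
      simp only [eulerD, deriv_const_mul_field]
      ring
    rw [Function.iterate_succ_apply, h, ih, Function.iterate_succ_apply]

theorem eulerFunctional_ofReal_mul {f : ℝ → ℂ} (hf : ContDiffOn ℝ ∞ f (Set.Ioi 0)) {t : ℝ}
    (ht : 0 < t) (p : ℂ[X]) :
    eulerFunctional (fun s => s * f s) t p = t * eulerFunctional f t (p.comp (X + C 1)) := by
  change _ = (((t : ℂ) • eulerFunctional f t) ∘ₗ taylor 1) p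
  refine eq_of_map_X_pow (fun k => ?_) p
  induction k generalizing f with
  | zero =>
    rw [eulerFunctional_X_pow, LinearMap.comp_apply, taylor_apply, pow_zero, one_comp,
      ← pow_zero (X : ℂ[X]), LinearMap.smul_apply, eulerFunctional_X_pow]
    rfl
  | succ k ih =>
    have h : Set.EqOn (eulerD fun s => s * f s) (fun s => s * (f s + eulerD f s)) (Set.Ioi 0) :=
      fun s hs => by
        have h1 := hasDerivAt_of_contDiffOn hf hs
        have h2 : HasDerivAt (fun s : ℝ => (s : ℂ)) 1 s := Complex.ofRealCLM.hasDerivAt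
        have hs' : (s : ℂ) ≠ 0 := by exact_mod_cast (ne_of_gt hs : s ≠ 0)
        have h3 : HasDerivAt (fun s : ℝ => s * f s) _ s := h2.mul h1
        rw [eulerD, h3.deriv]
        field_simp
    rw [pow_succ', eulerFunctional_X_mul, eulerFunctional_congr h ht,
      ih (hf.add (contDiffOn_eulerD hf))]
    simp only [LinearMap.comp_apply, LinearMap.smul_apply, taylor_apply, mul_comp, X_comp]
    rw [eulerFunctional_add hf (contDiffOn_eulerD hf) ht, ← eulerFunctional_X_mul, add_mul,
      map_add, C_1, one_mul, add_comm]

theorem hasFunctionalDerivAt_eulerFunctional {f : ℝ → ℂ} (hf : ContDiffOn ℝ ∞ f (Set.Ioi 0))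
    {t : ℝ} (ht : 0 < t) :
    HasFunctionalDerivAt (eulerFunctional f)
      ((t : ℂ)⁻¹ • eulerFunctional f t ∘ₗ LinearMap.mulLeft ℂ X) t := fun p => by
  induction p using Polynomial.induction_on' with
  | add p q hp hq =>
    simp only [map_add]
    exact hp.add hq
  | monomial k x =>
    simp only [← C_mul_X_pow_eq_monomial, map_C_mul, eulerFunctional_X_pow]
    refine (hasDerivAt_of_contDiffOn (contDiffOn_iterate_eulerD hf k) ht).const_mul x
      |>.congr_deriv ?_
    rw [LinearMap.smul_apply, LinearMap.comp_apply, LinearMap.mulLeft_apply, ← pow_succ',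
      eulerFunctional_X_pow, Function.iterate_succ_apply', smul_eq_mul]

theorem tauV_eq_hankelDet (a c c₁ c₂ : ℂ) (i j : ℤ) (m : ℕ) (t : ℝ) :
    tauV a c c₁ c₂ i j m t = hankelDet (eulerFunctional (seed c₁ c₂ (a + i) (c + j)) t) m := by
  rw [tauV, if_neg (by omega), phiV_eq_seed, hankelDet]
  simp only [← pow_add, eulerFunctional_X_pow]
  rfl

theorem contiguityRelations_eulerFunctional (c₁ c₂ : ℂ) {a c : ℂ} (ha : NotInt a) (hc : NotInt c)
    (hca : NotInt (c - a)) {t : ℝ} (ht : 0 < t) :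
    ContiguityRelations a c t (eulerFunctional (seed c₁ c₂ a c) t)
      (eulerFunctional (seed c₁ c₂ a (c + 1)) t) (eulerFunctional (seed c₁ c₂ (a + 1) c) t)
      (eulerFunctional (seed c₁ c₂ (a + 1) (c + 1)) t)
      (eulerFunctional (seed c₁ c₂ (a - 1) (c - 1)) t) := by
  have hs := contDiffOn_seed c₁ c₂ ha hc
  have hs01 := contDiffOn_seed c₁ c₂ ha hc.add_one
  have hs11 := contDiffOn_seed c₁ c₂ ha.add_one hc.add_one
  have hca1 : NotInt (c + 1 - a) := by simpa [sub_add_eq_add_sub] using hca.add_one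
  have key : ∀ {f g : ℝ → ℂ} {x y : ℂ}, ContDiffOn ℝ ∞ f (Set.Ioi 0) →
      (∀ s : ℝ, 0 < s → eulerD f s + x * f s = y * g s) → ∀ p : ℂ[X],
      eulerFunctional f t ((X + C x) * p) = y * eulerFunctional g t p := fun {f g x y} hf h p => by
    rw [add_mul, map_add, map_C_mul, eulerFunctional_X_mul, ← eulerFunctional_const_mul,
      ← eulerFunctional_const_mul, ← eulerFunctional_add (contDiffOn_eulerD hf)
        (contDiffOn_const.mul hf) ht]
    exact eulerFunctional_congr (fun s hs => h s hs) ht p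
  refine ⟨by exact_mod_cast ht.ne', hca.ne_zero, hca.sub_one.ne_zero, ha.sub_one.ne_zero,
    fun p => ?_, fun p => ?_, key hs fun s h0 => ?_, key hs01 fun s h0 => ?_,
    key hs01 fun s h0 => ?_, fun p => ?_⟩
  · rw [eulerFunctional_X_mul, ← eulerFunctional_ofReal_mul hs11 ht]
    exact eulerFunctional_congr (fun s h0 => eulerD_seed c₁ c₂ ha hc h0) ht p
  · rw [eulerFunctional_X_mul, ← eulerFunctional_ofReal_mul hs ht]
    refine eulerFunctional_congr (fun s h0 => ?_) ht p
    simpa using eulerD_seed c₁ c₂ ha.sub_one hc.sub_one h0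
  · rw [eulerD_seed c₁ c₂ ha hc h0, mul_seed_add_mul_seed c₁ c₂ ha hc hca h0]
  · rw [eulerD_seed c₁ c₂ ha hc.add_one h0, seed_contiguous c₁ c₂ ha hc hca h0]
  · rw [eulerD_seed c₁ c₂ ha hc.add_one h0, mul_seed_add_mul_seed c₁ c₂ ha hc.add_one hca1 h0]
    ring
  · have h := key (g := fun s => (a - 1) * seed c₁ c₂ (a - 1) (c - 1) s + s * seed c₁ c₂ a c s)
      (x := c - 1) (y := 1) hs (fun s h0 => by
        rw [eulerD_seed c₁ c₂ ha hc h0, mul_seed_sub_one c₁ c₂ ha hc hca h0]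
        ring) p
    have hst : ContDiffOn ℝ ∞ (fun s : ℝ => s * seed c₁ c₂ a c s) (Set.Ioi 0) :=
      Complex.ofRealCLM.contDiff.contDiffOn.mul hs
    rw [h, one_mul, eulerFunctional_add
      (contDiffOn_const.mul (contDiffOn_seed c₁ c₂ ha.sub_one hc.sub_one)) hst ht,
      eulerFunctional_const_mul,
      eulerFunctional_ofReal_mul hs ht, add_sub_cancel_right]

end PainleveV

/-- determinant formula for a family of classical transcendental
solutions of the Hamiltonian system S_V with parameters
`κ∞ = c-a`, `κ₀ = a+n`, `θ = c-n-2`. -/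
theorem pV_hamiltonian_det_solution'
    (a c c₁ c₂ : ℂ)
    (ha : a ∉ Set.range ((↑·) : ℤ → ℂ))
    (hc : c ∉ Set.range ((↑·) : ℤ → ℂ))
    (hca : c - a ∉ Set.range ((↑·) : ℤ → ℂ))
    (n : ℕ) (U : Set ℝ) (hU : IsOpen U) (hU0 : U ⊆ Set.Ioi 0)
    (hden1 : ∀ t ∈ U, tauV a c c₁ c₂ 1 0 n t ≠ 0)
    (hden2 : ∀ t ∈ U, tauV a c c₁ c₂ 0 1 (n + 1) t ≠ 0)
    (hden3 : ∀ t ∈ U, tauV a c c₁ c₂ 0 0 (n + 1) t ≠ 0)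
    (hden4 : ∀ t ∈ U, tauV a c c₁ c₂ 0 0 n t ≠ 0)
    (q p : ℝ → ℂ)
    (hq : ∀ t, q t = -(((c - a) / (c - a - 1)) ^ n *
      (tauV a c c₁ c₂ 0 0 n t * tauV a c c₁ c₂ 1 1 (n + 1) t) /
      (tauV a c c₁ c₂ 1 0 n t * tauV a c c₁ c₂ 0 1 (n + 1) t)))
    (hp : ∀ t, p t = (1 - a) * ((c - a - 1) / (c - a)) ^ n *
      (tauV a c c₁ c₂ 1 0 n t * tauV a c c₁ c₂ 0 1 (n + 1) t *
        tauV a c c₁ c₂ (-1) (-1) (n + 1) t) /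
      ((tauV a c c₁ c₂ 0 0 (n + 1) t) ^ 2 * tauV a c c₁ c₂ 0 0 n t)) :
    ∀ t ∈ U,
      (t : ℂ) * deriv q t =
        2 * q t * (q t - 1) ^ 2 * p t
          - ((a + n) * (q t - 1) ^ 2 + (c - n - 2) * q t * (q t - 1) + (t : ℂ) * q t) ∧
      (t : ℂ) * deriv p t =
        -(((q t - 1) ^ 2 + 2 * q t * (q t - 1)) * (p t) ^ 2
            - (2 * (a + n) * (q t - 1) + (c - n - 2) * (2 * q t - 1) + (t : ℂ)) * p t
            + ((1 / 4) * ((a + n) + (c - n - 2)) ^ 2 - (1 / 4) * (c - a) ^ 2)) := by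
  have H : ∀ t ∈ U, _ := fun t ht =>
    PainleveV.contiguityRelations_eulerFunctional c₁ c₂ ha hc hca (hU0 ht)
  have hn : ((n : ℤ) + 1) = ((n + 1 : ℕ) : ℤ) := by push_cast; rfl
  have hneg : ∀ z : ℂ, z + ((-1 : ℤ) : ℂ) = z - 1 := fun z => by
    push_cast
    ring
  simp only [hn, PainleveV.tauV_eq_hankelDet, hneg, Int.cast_zero, Int.cast_one, add_zero]
    at hden1 hden2 hden3 hden4 hq hp
  exact PainleveV.hamiltonian_of_functionals (PainleveV.NotInt.ne_one ha)
    (PainleveV.NotInt.ne_one hc) hU H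
    (fun t ht => PainleveV.hasFunctionalDerivAt_eulerFunctional
      (PainleveV.contDiffOn_seed c₁ c₂ ha hc) (hU0 ht))
    (fun t ht => PainleveV.hasFunctionalDerivAt_eulerFunctional
      (PainleveV.contDiffOn_seed c₁ c₂ (PainleveV.NotInt.sub_one ha)
        (PainleveV.NotInt.sub_one hc)) (hU0 ht))
    hden1 hden2 hden3 hden4 (fun t _ => hq t) (fun t _ => hp t)
end
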